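/- Let k be a field and let m, n, r be nonnegative integers with r < min{m,n}, and suppose that r = 0 or m = n. Set R = R_{r+1}(k;m,n) = k[X_ij]/I_{r+1}(X). Then every semidualizing R-module is isomorphic to R; that is, there is exactly one isomorphism class of semidualizing R-modules. -/

import Mathlib

open CategoryTheory

/-- The `i`-th Ext module of two `R`-modules, over a commutative ring `R`. -/
noncomputable def ExtModule (R : Type) [CommRing R] (M N : ModuleCat.{0} R) (i : ℕ) :
    ModuleCat R :=
  ((Ext R (ModuleCat.{0} R) i).obj (Opposite.op M)).obj N

/-- `C` is a semidualizing `R`-module: it is finitely generated, the homothety map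
`R → Hom_R(C,C)` is bijective, and `Ext^i_R(C,C) = 0` for all `i > 0`. -/
def IsSemidualizing (R : Type) [CommRing R] (C : Type) [AddCommGroup C] [Module R C] : Prop :=
  Module.Finite R C ∧
  Function.Bijective (algebraMap R (Module.End R C)) ∧
  ∀ i : ℕ, 0 < i → Subsingleton (ExtModule R (ModuleCat.of R C) (ModuleCat.of R C) i)

/-- `M` has finite injective dimension over `R`: `Ext^i_R(-, M)` vanishes uniformly
for all large `i`. -/
def HasFiniteInjectiveDimension (R : Type) [CommRing R] (M : Type) [AddCommGroup M]
    [Module R M] : Prop :=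
  ∃ n : ℕ, ∀ (N : ModuleCat.{0} R) (i : ℕ), n < i →
    Subsingleton (ExtModule R N (ModuleCat.of R M) i)

/-- A Gorenstein local ring: a commutative Noetherian local ring having finite injective
dimension as a module over itself. -/
def IsGorensteinLocalRing (R : Type) [CommRing R] : Prop :=
  IsNoetherianRing R ∧ IsLocalRing R ∧ HasFiniteInjectiveDimension R R

/-- The length of an `R`-module, i.e. the Krull dimension of its lattice of submodules. -/
noncomputable def moduleLength (R M : Type) [CommRing R] [AddCommGroup M] [Module R M] :
    WithBot ℕ∞ :=
  Order.krullDim (Submodule R M)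

/-- The ideal of the polynomial ring `A[X_ij]` generated by the size `t` minors of the
generic `m × n` matrix `(X_ij)`. -/
noncomputable def minorsIdeal (A : Type) [CommRing A] (m n t : ℕ) :
    Ideal (MvPolynomial (Fin m × Fin n) A) :=
  Ideal.span { d | ∃ (ρ : Fin t → Fin m) (γ : Fin t → Fin n),
    d = (Matrix.of fun i j => MvPolynomial.X (ρ i, γ j)).det }

/-- The determinantal ring `R_t(A; m, n) = A[X_ij]/I_t(X)`. -/
abbrev DetRing (A : Type) [CommRing A] (m n t : ℕ) : Type :=
  MvPolynomial (Fin m × Fin n) A ⧸ minorsIdeal A m n t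

section ExtComputation

open Abelian

variable {R : Type} [CommRing R]

/-- Vanishing of the derived-functor `Ext` implies vanishing of the derived-category `Ext`. -/
theorem abelianExt_subsingleton_of_extModule (M N : ModuleCat.{0} R) (i : ℕ)
    (h : Subsingleton (ExtModule R M N (i + 1))) :
    Subsingleton (Abelian.Ext.{0} M N (i + 1)) := by
  let P := ProjectiveResolution.of M
  refine subsingleton_of_forall_eq 0 fun e => ?_
  obtain ⟨f, hf, rfl⟩ := P.extMk_surjective e (i + 2) rfl
  rw [P.extMk_eq_zero_iff f (i + 2) rfl hf i rfl]
  have e1 := P.isoExt (R := R) (i + 1) N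
  have h0 : Limits.IsZero (ExtModule R M N (i + 1)) := ModuleCat.isZero_of_subsingleton _
  have hz : Limits.IsZero ((P.complex.linearYonedaObj R N).homology (i + 1)) :=
    Limits.IsZero.of_iso h0 e1.symm
  rw [← HomologicalComplex.exactAt_iff_isZero_homology,
    HomologicalComplex.exactAt_iff' _ i (i + 1) (i + 2) (by simp) (by simp),
    ShortComplex.moduleCat_exact_iff] at hz
  obtain ⟨g, hg⟩ := hz f hf
  exact ⟨g, hg⟩

/-- Dimension shift along a presentation by a free module. -/
theorem exists_extend_of_ext_vanishing (M N : Type) [AddCommGroup M] [Module R M]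
    [AddCommGroup N] [Module R N] {n : ℕ} (p : (Fin n → R) →ₗ[R] M)
    (hp : Function.Surjective p)
    (h : ∀ i, Subsingleton (Abelian.Ext.{0} (ModuleCat.of R M) (ModuleCat.of R N) (i + 1))) :
    (∀ i, Subsingleton (Abelian.Ext.{0} (ModuleCat.of R (LinearMap.ker p))
      (ModuleCat.of R N) (i + 1))) ∧
    ∀ f : LinearMap.ker p →ₗ[R] N, ∃ g : (Fin n → R) →ₗ[R] N, ∀ x, g x.1 = f x := by
  have hS := LinearMap.shortExact_shortComplexKer hp
  have hproj : ∀ i, Subsingleton (Abelian.Ext.{0} (ModuleCat.of R (Fin n → R))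
      (ModuleCat.of R N) (i + 1)) := fun i => Ext.subsingleton_of_projective _ _ i
  constructor
  · intro i
    refine subsingleton_of_forall_eq 0 fun e => ?_
    have : Subsingleton (Abelian.Ext.{0} (ModuleCat.of R M) (ModuleCat.of R N) (i + 1 + 1)) :=
      h (i + 1)
    obtain ⟨x, hx⟩ := Ext.contravariant_sequence_exact₁ hS (ModuleCat.of R N) e
      (n₁ := i + 1 + 1) (by lia) ((h (i + 1)).elim _ _)
    rw [← hx, (hproj i).elim x 0]
    simp
  · intro f
    obtain ⟨x, hx⟩ := Ext.contravariant_sequence_exact₁ hS (ModuleCat.of R N)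
      (Ext.mk₀ (ModuleCat.ofHom f)) (n₁ := 1) (by lia) ((h 0).elim _ _)
    obtain ⟨g, rfl⟩ := Ext.mk₀_bijective _ _ |>.2 x
    rw [Ext.mk₀_comp_mk₀] at hx
    have h2 := (Ext.mk₀_bijective _ _).1 hx
    refine ⟨g.hom, fun x => ?_⟩
    have := congrArg (fun q => q.hom x) h2
    simpa using this

end ExtComputation

section Presentation

variable {R : Type} [CommRing R]

/-- The action of a matrix on column vectors with entries in a module. -/
def Matrix.act {p q : ℕ} (A : Matrix (Fin p) (Fin q) R) (N : Type) [AddCommGroup N] [Module R N] :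
    (Fin q → N) →ₗ[R] (Fin p → N) :=
  LinearMap.pi fun i => ∑ j, A i j • LinearMap.proj j

@[simp]
theorem Matrix.act_apply {p q : ℕ} (A : Matrix (Fin p) (Fin q) R) (N : Type) [AddCommGroup N]
    [Module R N] (v : Fin q → N) (i : Fin p) : A.act N v i = ∑ j, A i j • v j := by
  simp [Matrix.act]

theorem Matrix.act_act {p q s : ℕ} (A : Matrix (Fin p) (Fin q) R) (B : Matrix (Fin q) (Fin s) R)
    (N : Type) [AddCommGroup N] [Module R N] (v : Fin s → N) :
    A.act N (B.act N v) = (A * B).act N v := by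
  ext i
  simp only [Matrix.act_apply, Matrix.mul_apply, Finset.smul_sum, Finset.sum_smul, smul_smul]
  exact Finset.sum_comm

/-- A module-theoretic form of the semidualizing property: `C` has a complex of finite free
modules presenting it, whose dual with respect to `C` is exact in positive degrees. -/
structure DualExact (R : Type) [CommRing R] (C : Type) [AddCommGroup C] [Module R C] : Prop where
  bijective : Function.Bijective (algebraMap R (Module.End R C))
  exists_complex : ∃ (n : ℕ → ℕ) (A : ∀ i, Matrix (Fin (n (i + 1))) (Fin (n i)) R)
    (c : Fin (n 0) → C),
    (∀ z : C, ∃ v : Fin (n 0) → R, z = ∑ i, v i • c i) ∧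
    (A 0).act C c = 0 ∧
    (∀ v : Fin (n 0) → R, ∑ i, v i • c i = 0 → ∃ w, v = Matrix.vecMul w (A 0)) ∧
    (∀ i, A (i + 1) * A i = 0) ∧
    (∀ i, ∀ u, (A (i + 1)).act C u = 0 → ∃ s, u = (A i).act C s)

end Presentation

section OfSemidualizing

variable {R : Type} [CommRing R]

theorem Module.Finite.exists_fin_surjective (M : Type) [AddCommGroup M] [Module R M]
    [Module.Finite R M] : ∃ (n : ℕ) (p : (Fin n → R) →ₗ[R] M), Function.Surjective p :=
  Module.Finite.exists_fin' R M

/-- One step of the construction of a free resolution with exact dual. -/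
theorem exists_presentation_step [IsNoetherianRing R] (C : Type) [AddCommGroup C] [Module R C]
    {n : ℕ} (K : Submodule R (Fin n → R))
    (h : ∀ i, Subsingleton (Abelian.Ext.{0} (ModuleCat.of R K) (ModuleCat.of R C) (i + 1))) :
    ∃ (m : ℕ) (A : Matrix (Fin m) (Fin n) R), LinearMap.range A.vecMulLinear = K ∧
      (∀ i, Subsingleton (Abelian.Ext.{0} (ModuleCat.of R (LinearMap.ker A.vecMulLinear))
        (ModuleCat.of R C) (i + 1))) ∧
      ∀ f : LinearMap.ker A.vecMulLinear →ₗ[R] C, ∃ g : (Fin m → R) →ₗ[R] C,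
        ∀ x, g x.1 = f x := by
  obtain ⟨m, p, hp⟩ := Module.Finite.exists_fin_surjective (R := R) K
  let A : Matrix (Fin m) (Fin n) R := fun i => (p (Pi.single i 1)).1
  have hA : A.vecMulLinear = K.subtype ∘ₗ p := by
    refine LinearMap.pi_ext' fun i => LinearMap.ext_ring ?_
    have : A.vecMulLinear (Pi.single i 1) = A i := Matrix.single_one_vecMul i A
    simpa using this
  have hker : LinearMap.ker A.vecMulLinear = LinearMap.ker p := by
    rw [hA, LinearMap.ker_comp_of_ker_eq_bot]; simp
  refine ⟨m, A, ?_, ?_⟩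
  · rw [hA, LinearMap.range_comp, LinearMap.range_eq_top.2 hp]; simp
  · rw [hker]
    exact exists_extend_of_ext_vanishing K C p hp h

/-- Semidualizing modules over Noetherian rings are dual exact. -/
theorem IsSemidualizing.dualExact [IsNoetherianRing R] {C : Type} [AddCommGroup C] [Module R C]
    (h : IsSemidualizing R C) : DualExact R C := by
  obtain ⟨hfin, hbij, hext⟩ := h
  refine ⟨hbij, ?_⟩
  obtain ⟨n₀, p, hp⟩ := Module.Finite.exists_fin_surjective (R := R) C
  have h0 := exists_extend_of_ext_vanishing C C p hp fun i =>
    abelianExt_subsingleton_of_extModule _ _ i (hext (i + 1) i.succ_pos)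
  let Good : (Σ n : ℕ, Submodule R (Fin n → R)) → Prop := fun s =>
    (∀ i, Subsingleton (Abelian.Ext.{0} (ModuleCat.of R s.2) (ModuleCat.of R C) (i + 1))) ∧
      ∀ f : s.2 →ₗ[R] C, ∃ g : (Fin s.1 → R) →ₗ[R] C, ∀ x, g x.1 = f x
  have step : ∀ s : {s // Good s}, ∃ (s' : {s // Good s}) (A : Matrix (Fin s'.1.1) (Fin s.1.1) R),
      LinearMap.range A.vecMulLinear = s.1.2 ∧ LinearMap.ker A.vecMulLinear = s'.1.2 := by
    intro s
    obtain ⟨m, A, h1, h2, h3⟩ := exists_presentation_step C s.1.2 s.2.1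
    exact ⟨⟨⟨m, _⟩, h2, h3⟩, A, h1, rfl⟩
  choose next A hA1 hA2 using step
  let seq : ℕ → {s // Good s} := fun i => Nat.rec ⟨⟨n₀, LinearMap.ker p⟩, h0⟩ (fun _ s => next s) i
  have hp' : ∀ v : Fin n₀ → R, p v = ∑ i, v i • p (Pi.single i 1) := by
    intro v
    conv_lhs => rw [← Finset.univ_sum_single v, map_sum]
    refine Finset.sum_congr rfl fun i _ => ?_
    rw [← map_smul, ← Pi.single_smul, smul_eq_mul, mul_one]
  have hrow : ∀ s i, A s i ∈ s.1.2 := by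
    intro s i
    rw [← hA1 s]
    exact ⟨Pi.single i 1, by simp; rfl⟩
  refine ⟨fun i => (seq i).1.1, fun i => A (seq i), fun i => p (Pi.single i 1), ?_, ?_, ?_, ?_, ?_⟩
  · intro z
    obtain ⟨v, rfl⟩ := hp z
    exact ⟨v, hp' v⟩
  · ext i
    rw [Matrix.act_apply]
    have := hrow (seq 0) i
    have h2 : p (A (seq 0) i) = 0 := this
    rw [hp'] at h2
    exact h2
  · intro v hv
    have h2 : v ∈ LinearMap.range (A (seq 0)).vecMulLinear := by
      rw [hA1]
      show p v = 0
      rw [hp']; exact hv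
    obtain ⟨w, hw⟩ := h2
    exact ⟨w, hw.symm⟩
  · intro i
    ext a b
    have h2 : A (seq (i + 1)) a ∈ LinearMap.ker (A (seq i)).vecMulLinear := by
      rw [hA2]; exact hrow (seq (i + 1)) a
    exact congrFun h2 b
  · intro i u hu
    let fu : (Fin (seq (i + 1)).1.1 → R) →ₗ[R] C :=
      ∑ j, (LinearMap.toSpanSingleton R C (u j)) ∘ₗ LinearMap.proj j
    have hfu : ∀ v, fu v = ∑ j, v j • u j := by intro v; simp [fu]
    have hle : LinearMap.ker (A (seq i)).vecMulLinear ≤ LinearMap.ker fu := by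
      rw [hA2]
      have : (next (seq i)).1.2 = (seq (i + 1)).1.2 := rfl
      rw [this, ← hA1 (seq (i + 1))]
      rintro _ ⟨w, rfl⟩
      rw [LinearMap.mem_ker, hfu]
      simp only [Matrix.vecMulLinear_apply, Matrix.vecMul, dotProduct, Finset.sum_smul]
      rw [Finset.sum_comm]
      refine Finset.sum_eq_zero fun x _ => ?_
      have := congrFun hu x
      simp only [Matrix.act_apply, Pi.zero_apply] at this
      simp only [mul_smul, ← Finset.smul_sum]
      rw [this, smul_zero]
    let q : (seq i).1.2 →ₗ[R] C :=
      ((LinearMap.ker (A (seq i)).vecMulLinear).liftQ fu hle) ∘ₗ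
        ((A (seq i)).vecMulLinear.quotKerEquivRange.symm.toLinearMap) ∘ₗ
        (LinearEquiv.ofEq _ _ (hA1 (seq i)).symm).toLinearMap
    obtain ⟨g, hg⟩ := (seq i).2.2 q
    refine ⟨fun j => g (Pi.single j 1), ?_⟩
    ext j
    rw [Matrix.act_apply]
    have hg' : ∀ v : Fin (seq i).1.1 → R, g v = ∑ l, v l • g (Pi.single l 1) := by
      intro v
      conv_lhs => rw [← Finset.univ_sum_single v, map_sum]
      refine Finset.sum_congr rfl fun i _ => ?_
      rw [← map_smul, ← Pi.single_smul, smul_eq_mul, mul_one]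
    rw [← hg', hg ⟨_, hrow (seq i) j⟩]
    have e1 : (LinearEquiv.ofEq _ _ (hA1 (seq i)).symm) ⟨_, hrow (seq i) j⟩ =
        (A (seq i)).vecMulLinear.quotKerEquivRange (Submodule.Quotient.mk (Pi.single j 1)) := by
      ext1
      simp
      rfl
    simp only [q, LinearMap.comp_apply, LinearEquiv.coe_coe, e1, LinearEquiv.symm_apply_apply]
    rw [Submodule.liftQ_apply]
    rw [hfu]
    simp [Pi.single_apply, ite_smul]

end OfSemidualizing

section RegularSequences

open RingTheory.Sequence
open scoped Pointwise

variable {R : Type} [CommRing R] {C : Type} [AddCommGroup C] [Module R C]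

/-- The complex of free modules with matrices `A` is a presentation of the module
generated by `c`. -/
structure IsFreePresentation (n : ℕ → ℕ) (A : ∀ i, Matrix (Fin (n (i + 1))) (Fin (n i)) R)
    (c : Fin (n 0) → C) : Prop where
  gen : ∀ z : C, ∃ v : Fin (n 0) → R, z = ∑ i, v i • c i
  act_zero : (A 0).act C c = 0
  rel : ∀ v : Fin (n 0) → R, ∑ i, v i • c i = 0 → ∃ w, v = Matrix.vecMul w (A 0)
  mul_eq_zero : ∀ i, A (i + 1) * A i = 0

theorem Matrix.act_map {p q : ℕ} (A : Matrix (Fin p) (Fin q) R) {N N' : Type} [AddCommGroup N]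
    [Module R N] [AddCommGroup N'] [Module R N'] (f : N →ₗ[R] N') (v : Fin q → N) :
    A.act N' (fun i => f (v i)) = fun i => f (A.act N v i) := by
  ext i; simp

variable {n : ℕ → ℕ} {A : ∀ i, Matrix (Fin (n (i + 1))) (Fin (n i)) R} {c : Fin (n 0) → C}

theorem IsFreePresentation.exists_hom (h : IsFreePresentation n A c) {N : Type} [AddCommGroup N]
    [Module R N] (u : Fin (n 0) → N) (hu : (A 0).act N u = 0) :
    ∃ φ : C →ₗ[R] N, ∀ i, φ (c i) = u i := by
  classical
  let p : (Fin (n 0) → R) →ₗ[R] C := Fintype.linearCombination R c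
  let q : (Fin (n 0) → R) →ₗ[R] N := Fintype.linearCombination R u
  have hp : ∀ v, p v = ∑ i, v i • c i := fun v => by simp [p, Fintype.linearCombination_apply]
  have hq : ∀ v, q v = ∑ i, v i • u i := fun v => by simp [q, Fintype.linearCombination_apply]
  have hsurj : Function.Surjective p := fun z => by
    obtain ⟨v, rfl⟩ := h.gen z
    exact ⟨v, hp v⟩
  have hle : LinearMap.ker p ≤ LinearMap.ker q := by
    intro v hv
    rw [LinearMap.mem_ker, hp] at hv
    obtain ⟨w, rfl⟩ := h.rel v hv
    rw [LinearMap.mem_ker, hq]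
    simp only [Matrix.vecMul, dotProduct, Finset.sum_smul]
    rw [Finset.sum_comm]
    refine Finset.sum_eq_zero fun x _ => ?_
    have := congrFun hu x
    simp only [Matrix.act_apply, Pi.zero_apply] at this
    simp only [mul_smul, ← Finset.smul_sum]
    rw [this, smul_zero]
  refine ⟨(LinearMap.ker p).liftQ q hle ∘ₗ (p.quotKerEquivOfSurjective hsurj).symm, fun i => ?_⟩
  have h1 : c i = p.quotKerEquivOfSurjective hsurj (Submodule.Quotient.mk (Pi.single i 1)) := by
    simp [hp, Pi.single_apply, ite_smul]
  rw [h1, LinearMap.comp_apply, LinearEquiv.coe_coe, LinearEquiv.symm_apply_apply,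
    Submodule.liftQ_apply, hq]
  simp [Pi.single_apply, ite_smul]

theorem IsFreePresentation.finite (h : IsFreePresentation n A c) : Module.Finite R C := by
  classical
  refine ⟨⟨Finset.univ.image c, ?_⟩⟩
  rw [eq_top_iff]
  rintro z -
  obtain ⟨v, rfl⟩ := h.gen z
  exact Submodule.sum_mem _ fun i _ => Submodule.smul_mem _ _ (Submodule.subset_span (by simp))

theorem IsFreePresentation.hom_ext (h : IsFreePresentation n A c) {N : Type} [AddCommGroup N]
    [Module R N] {φ ψ : C →ₗ[R] N} (he : ∀ i, φ (c i) = ψ (c i)) : φ = ψ := by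
  ext z
  obtain ⟨v, rfl⟩ := h.gen z
  simp [he]

/-- `N` is a quotient of `C` such that `Hom(C, N)` is cyclic, isomorphic to `P`, and the dual
of the presentation of `C` with values in `N` is exact. -/
structure DualExactQuotient (A : ∀ i, Matrix (Fin (n (i + 1))) (Fin (n i)) R)
    {P N : Type} [AddCommGroup P] [Module R P] [AddCommGroup N] [Module R N]
    (p : P) (π : C →ₗ[R] N) : Prop where
  gen : ∀ z : P, ∃ r : R, z = r • p
  surj : Function.Surjective π
  exact : ∀ i, ∀ u, (A (i + 1)).act N u = 0 → ∃ s, u = (A i).act N s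
  hom : ∀ φ : C →ₗ[R] N, ∃ r : R, φ = r • π
  smul_eq_zero : ∀ r : R, r • π = 0 ↔ r • p = 0

variable {P N : Type} [AddCommGroup P] [Module R P] [AddCommGroup N] [Module R N]
    {p : P} {π : C →ₗ[R] N}

theorem DualExactQuotient.isSMulRegular [IsNoetherianRing R]
    (hF : IsFreePresentation n A c) (hC : Function.Injective (algebraMap R (Module.End R C)))
    (h : DualExactQuotient A p π) {x : R} (hx : IsSMulRegular P x) : IsSMulRegular N x := by
  have hfin : Module.Finite R C := hF.finite
  have hfin2 : Module.Finite R N := Module.Finite.of_surjective π h.surj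
  let T := LinearMap.ker (LinearMap.lsmul R N x)
  have hsub : Subsingleton (C →ₗ[R] T) := by
    refine subsingleton_of_forall_eq 0 fun φ => ?_
    obtain ⟨r, hr⟩ := h.hom (T.subtype ∘ₗ φ)
    have h1 : (x * r) • π = 0 := by
      rw [mul_smul, ← hr]
      ext z
      exact (φ z).2
    rw [h.smul_eq_zero, mul_smul] at h1
    have h2 : r • p = 0 := hx.right_eq_zero_of_smul h1
    rw [← h.smul_eq_zero] at h2
    rw [h2] at hr
    ext z
    exact congrArg (fun f : C →ₗ[R] N => f z) hr
  obtain ⟨r, hr, hreg⟩ := IsSMulRegular.subsingleton_linearMap_iff.1 hsub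
  have hr0 : r = 0 := by
    apply hC
    ext z
    rw [Module.mem_annihilator] at hr
    simp [hr z]
  subst hr0
  have hT : Subsingleton T := IsSMulRegular.zero_iff_subsingleton.1 hreg
  refine IsSMulRegular.of_right_eq_zero_of_smul fun z hz => ?_
  exact congrArg Subtype.val (hT.elim ⟨z, hz⟩ 0)

theorem mem_smul_top_iff' {x : R} {z : N} : z ∈ x • (⊤ : Submodule R N) ↔ ∃ y, z = x • y := by
  rw [Submodule.mem_smul_pointwise_iff_exists]
  simp [eq_comm]

theorem DualExactQuotient.quotSMulTop (hF : IsFreePresentation n A c)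
    (h : DualExactQuotient A p π) {x : R} (hx : IsSMulRegular N x) :
    DualExactQuotient A (P := QuotSMulTop x P) (N := QuotSMulTop x N) (Submodule.Quotient.mk p)
      (Submodule.mkQ _ ∘ₗ π) := by
  have key : ∀ i, ∀ u : Fin (n i) → N, (∃ w, (A i).act N u = x • w) →
      ∃ t, (A i).act N (u - x • t) = 0 := by
    rintro i u ⟨w, hw⟩
    have h1 : (A (i + 1)).act N w = 0 := by
      have : x • (A (i + 1)).act N w = 0 := by
        rw [← map_smul, ← hw, Matrix.act_act, hF.mul_eq_zero]
        ext; simp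
      ext j
      exact hx.right_eq_zero_of_smul (congrFun this j)
    obtain ⟨s, rfl⟩ := h.exact i w h1
    exact ⟨s, by rw [map_sub, map_smul, hw, sub_self]⟩
  have lift : ∀ i, ∀ u : Fin (n i) → QuotSMulTop x N, (A i).act _ u = 0 →
      ∃ u' : Fin (n i) → N, (A i).act N u' = 0 ∧
        ∀ j, u j = (x • (⊤ : Submodule R N)).mkQ (u' j) := by
    intro i u hu
    choose u' hu' using fun j => Submodule.mkQ_surjective _ (u j)
    have h1 : ∃ w, (A i).act N u' = x • w := by
      have h2 : ∀ j, ∃ y, (A i).act N u' j = x • y := by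
        intro j
        rw [← mem_smul_top_iff', ← Submodule.Quotient.mk_eq_zero, ← Submodule.mkQ_apply]
        have h3 := congrFun (Matrix.act_map (A i) (x • (⊤ : Submodule R N)).mkQ u') j
        rw [← h3]
        simp only [hu']
        exact congrFun hu j
      choose w hw using h2
      exact ⟨w, funext hw⟩
    obtain ⟨t, ht⟩ := key i u' h1
    refine ⟨_, ht, fun j => ?_⟩
    rw [← hu', Pi.sub_apply, map_sub, Pi.smul_apply]
    have : (x • (⊤ : Submodule R N)).mkQ (x • t j) = 0 := by
      rw [Submodule.mkQ_apply, Submodule.Quotient.mk_eq_zero, mem_smul_top_iff']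
      exact ⟨_, rfl⟩
    rw [this, sub_zero]
  refine ⟨?_, ?_, ?_, ?_, ?_⟩
  · intro z
    obtain ⟨z, rfl⟩ := Submodule.mkQ_surjective _ z
    obtain ⟨r, rfl⟩ := h.gen z
    exact ⟨r, by simp⟩
  · exact (Submodule.mkQ_surjective _).comp h.surj
  · intro i u hu
    obtain ⟨u', h1, h2⟩ := lift (i + 1) u hu
    obtain ⟨s, rfl⟩ := h.exact i u' h1
    refine ⟨fun j => (x • (⊤ : Submodule R N)).mkQ (s j), ?_⟩
    rw [Matrix.act_map]
    exact funext h2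
  · intro φ
    obtain ⟨u', h1, h2⟩ := lift 0 (fun i => φ (c i)) (by
      rw [Matrix.act_map, hF.act_zero]; ext; simp)
    obtain ⟨ψ, hψ⟩ := hF.exists_hom u' h1
    obtain ⟨r, rfl⟩ := h.hom ψ
    refine ⟨r, hF.hom_ext fun i => ?_⟩
    rw [h2, ← hψ]
    simp
  · intro r
    constructor
    · intro hr
      have h1 : ∀ z, ∃ y, r • π z = x • y := by
        intro z
        rw [← mem_smul_top_iff', ← Submodule.Quotient.mk_eq_zero, ← Submodule.mkQ_apply]
        have := congrArg (fun f : C →ₗ[R] _ => f z) hr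
        simpa using this
      choose y hy using h1
      let ψ : C →ₗ[R] N :=
        { toFun := y
          map_add' := fun a b => hx (by
            show x • _ = x • _
            rw [smul_add, ← hy, ← hy, ← hy, map_add, smul_add])
          map_smul' := fun s a => hx (by
            show x • _ = x • _
            rw [← hy, RingHom.id_apply, smul_comm x s, ← hy, map_smul, smul_comm]) }
      obtain ⟨s, hs⟩ := h.hom ψ
      have h2 : (r - x * s) • π = 0 := by
        rw [sub_smul, mul_smul, ← hs, sub_eq_zero]
        ext z
        exact hy z
      rw [h.smul_eq_zero, sub_smul, sub_eq_zero] at h2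
      rw [← Submodule.Quotient.mk_smul, h2, mul_smul, Submodule.Quotient.mk_eq_zero,
        mem_smul_top_iff']
      exact ⟨_, rfl⟩
    · intro hr
      rw [← Submodule.Quotient.mk_smul, Submodule.Quotient.mk_eq_zero, mem_smul_top_iff'] at hr
      obtain ⟨y, hy⟩ := hr
      obtain ⟨s, rfl⟩ := h.gen y
      have h2 : (r - x * s) • π = 0 := by
        rw [h.smul_eq_zero, sub_smul, hy, mul_smul, sub_self]
      rw [sub_smul, sub_eq_zero] at h2
      ext z
      have h3 := congrArg (fun f : C →ₗ[R] _ => f z) h2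
      simp only [LinearMap.smul_apply] at h3
      simp only [LinearMap.smul_apply, LinearMap.comp_apply, LinearMap.zero_apply]
      rw [← map_smul, h3, Submodule.mkQ_apply, Submodule.Quotient.mk_eq_zero, mem_smul_top_iff']
      exact ⟨s • π z, by rw [mul_smul]⟩

theorem DualExactQuotient.isWeaklyRegular [IsNoetherianRing R]
    (hF : IsFreePresentation n A c) (hC : Function.Injective (algebraMap R (Module.End R C)))
    (rs : List R) : ∀ {P N : Type} [AddCommGroup P] [Module R P] [AddCommGroup N] [Module R N]
    {p : P} {π : C →ₗ[R] N} (_ : DualExactQuotient A p π) (_ : IsWeaklyRegular P rs),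
    IsWeaklyRegular N rs ∧ ∀ g : R, (∀ z : N, g • z ∈ Ideal.ofList rs • (⊤ : Submodule R N)) →
      g • p ∈ Ideal.ofList rs • (⊤ : Submodule R P) := by
  induction rs with
  | nil =>
    intro P N _ _ _ _ p π h _
    refine ⟨by simp, fun g hg => ?_⟩
    have : g • p = 0 := by
      rw [← h.smul_eq_zero]
      ext z
      simpa using hg (π z)
    rw [this]
    exact zero_mem _
  | cons x rs ih =>
    intro P N _ _ _ _ p π h hreg
    rw [isWeaklyRegular_cons_iff] at hreg
    have hx := h.isSMulRegular hF hC hreg.1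
    obtain ⟨h1, h2⟩ := ih (h.quotSMulTop hF hx) hreg.2
    refine ⟨(isWeaklyRegular_cons_iff _ _ _).2 ⟨hx, h1⟩, fun g hg => ?_⟩
    have aux : ∀ (M : Type) [AddCommGroup M] [Module R M] (z : M),
        z ∈ Ideal.ofList (x :: rs) • (⊤ : Submodule R M) ↔
        (x • (⊤ : Submodule R M)).mkQ z ∈
          Ideal.ofList rs • (⊤ : Submodule R (QuotSMulTop x M)) := by
      intro M _ _ z
      have e1 : (⊤ : Submodule R (QuotSMulTop x M)) =
          (⊤ : Submodule R M).map (Submodule.mkQ _) := by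
        rw [Submodule.map_top, Submodule.range_mkQ]
      rw [e1, ← Submodule.map_smul'', ← Submodule.mem_comap, Submodule.comap_map_mkQ,
        Ideal.ofList_cons_smul]
    rw [aux]
    refine h2 g fun z => ?_
    obtain ⟨z, rfl⟩ := Submodule.mkQ_surjective _ z
    rw [← map_smul, ← aux]
    exact hg z

theorem DualExact.finite (h : DualExact R C) : Module.Finite R C := by
  obtain ⟨-, n, A, c, h1, h2, h3, h4, -⟩ := h
  exact IsFreePresentation.finite ⟨h1, h2, h3, h4⟩

/-- Weakly regular sequences on `R` are weakly regular on a dual exact module `C`, and `C`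
is faithful modulo such a sequence. -/
theorem DualExact.isWeaklyRegular [IsNoetherianRing R] (h : DualExact R C) {rs : List R}
    (hrs : IsWeaklyRegular R rs) :
    IsWeaklyRegular C rs ∧ ∀ g : R, (∀ z : C, g • z ∈ Ideal.ofList rs • (⊤ : Submodule R C)) →
      g ∈ Ideal.ofList rs := by
  obtain ⟨hbij, n, A, c, h1, h2, h3, h4, h5⟩ := h
  have hF : IsFreePresentation n A c := ⟨h1, h2, h3, h4⟩
  have hQ : DualExactQuotient A (1 : R) (LinearMap.id : C →ₗ[R] C) := by
    refine ⟨fun z => ⟨z, by simp⟩, Function.surjective_id, h5, fun φ => ?_, fun r => ?_⟩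
    · obtain ⟨r, rfl⟩ := hbij.2 φ
      exact ⟨r, rfl⟩
    · constructor
      · intro hr
        have : r = 0 := hbij.1 (by
          rw [map_zero]; exact hr)
        simp [this]
      · intro hr
        have : r = 0 := by simpa using hr
        simp [this]
  obtain ⟨h6, h7⟩ := DualExactQuotient.isWeaklyRegular hF hbij.1 rs hQ hrs
  exact ⟨h6, fun g hg => by simpa using h7 g hg⟩

end RegularSequences

section Localization

variable {R : Type} [CommRing R]

theorem IsLocalizedModule.exists_smul_eq_of_finite (W : Submonoid R) {M M' : Type} [AddCommGroup M]
    [Module R M] [AddCommGroup M'] [Module R M'] (f : M →ₗ[R] M') [IsLocalizedModule W f]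
    {p : ℕ} (u : Fin p → M') : ∃ s ∈ W, ∃ v : Fin p → M, ∀ j, s • u j = f (v j) := by
  choose x hx using fun j => IsLocalizedModule.surj W f (u j)
  refine ⟨∏ j, (x j).2, Submonoid.prod_mem _ fun j _ => (x j).2.2,
    fun j => (∏ k ∈ Finset.univ.erase j, ((x k).2 : R)) • (x j).1, fun j => ?_⟩
  rw [map_smul, ← hx j, ← Finset.mul_prod_erase _ _ (Finset.mem_univ j), mul_comm, mul_smul]
  rfl

theorem IsLocalizedModule.exists_smul_eq_zero_of_finite (W : Submonoid R) {M M' : Type}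
    [AddCommGroup M] [Module R M] [AddCommGroup M'] [Module R M'] (f : M →ₗ[R] M')
    [IsLocalizedModule W f] {p : ℕ} (u : Fin p → M) (hu : ∀ j, f (u j) = 0) :
    ∃ w ∈ W, ∀ j, w • u j = 0 := by
  choose x hx using fun j => (IsLocalizedModule.eq_zero_iff W f).1 (hu j)
  refine ⟨∏ j, x j, Submonoid.prod_mem _ fun j _ => (x j).2, fun j => ?_⟩
  rw [← Finset.prod_erase_mul _ _ (Finset.mem_univ j), mul_smul]
  have := hx j
  rw [Submonoid.smul_def] at this
  rw [this, smul_zero]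

/-- Dual exactness localizes. -/
theorem DualExact.localization (W : Submonoid R) {R' : Type} [CommRing R'] [Algebra R R']
    [IsLocalization W R'] {C C' : Type} [AddCommGroup C] [Module R C] [AddCommGroup C']
    [Module R C'] [Module R' C'] [IsScalarTower R R' C'] (f : C →ₗ[R] C') [IsLocalizedModule W f]
    (h : DualExact R C) : DualExact R' C' := by
  obtain ⟨hbij, n, A, c, h1, h2, h3, h4, h5⟩ := h
  have hF : IsFreePresentation n A c := ⟨h1, h2, h3, h4⟩
  have hunit : ∀ w ∈ W, IsUnit (algebraMap R R' w) := fun w hw =>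
    IsLocalization.map_units R' ⟨w, hw⟩
  have cancel : ∀ w ∈ W, ∀ a b : C', w • a = w • b → a = b := fun w hw a b hab =>
    IsLocalizedModule.smul_injective f ⟨w, hw⟩ hab
  have hinv : ∀ w ∈ W, ∃ w' : R', w' * algebraMap R R' w = 1 := fun w hw =>
    (hunit w hw).exists_left_inv
  have hact : ∀ i (u : Fin (n i) → C'),
      ((A i).map (algebraMap R R')).act C' u = (A i).act C' u := by
    intro i u
    ext j
    simp
  have hgen : ∀ z : C', ∃ v : Fin (n 0) → R', z = ∑ i, v i • f (c i) := by
    intro z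
    obtain ⟨⟨y, s⟩, hy⟩ := IsLocalizedModule.surj W f z
    obtain ⟨v, rfl⟩ := h1 y
    obtain ⟨s', hs'⟩ := hinv s s.2
    refine ⟨fun i => s' * algebraMap R R' (v i), cancel s s.2 _ _ ?_⟩
    simp only at hy
    rw [← Submonoid.smul_def, hy, map_sum, Finset.smul_sum]
    refine Finset.sum_congr rfl fun i _ => ?_
    rw [mul_smul, algebraMap_smul, ← algebraMap_smul R' (s : R), smul_smul, mul_comm, hs', one_smul,
      map_smul]
  refine ⟨⟨?_, ?_⟩, n, fun i => (A i).map (algebraMap R R'), fun i => f (c i), hgen, ?_, ?_, ?_, ?_⟩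
  · rw [injective_iff_map_eq_zero]
    intro r' hr'
    obtain ⟨⟨a, s⟩, hs⟩ := IsLocalization.surj W r'
    simp only at hs
    have h6 : ∀ j, f (a • c j) = 0 := by
      intro j
      rw [map_smul, ← algebraMap_smul R' a, ← hs, mul_comm, mul_smul]
      have : r' • f (c j) = 0 := congrArg (fun g : Module.End R' C' => g (f (c j))) hr'
      rw [this, smul_zero]
    obtain ⟨w, hw, h7⟩ := IsLocalizedModule.exists_smul_eq_zero_of_finite W f _ h6
    have h8 : w * a = 0 := by
      apply hbij.1
      rw [map_zero]
      refine hF.hom_ext fun j => ?_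
      simpa only [Module.algebraMap_end_apply, mul_smul, LinearMap.zero_apply] using h7 j
    have h9 : algebraMap R R' a = 0 := by
      rw [← (hunit w hw).mul_right_eq_zero, ← map_mul, h8, map_zero]
    rwa [h9, (hunit s s.2).mul_left_eq_zero] at hs
  · intro φ
    obtain ⟨s, hs, z, hz⟩ := IsLocalizedModule.exists_smul_eq_of_finite W f fun j => φ (f (c j))
    have h6 : ∀ i, f ((A 0).act C z i) = 0 := by
      intro i
      have : (A 0).act C' (fun j => f (z j)) i = f ((A 0).act C z i) :=
        congrFun (Matrix.act_map (A 0) f z) i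
      rw [← this]
      simp only [← hz, Matrix.act_apply]
      have h7 : f (∑ j, A 0 i j • c j) = 0 := by
        have := congrFun h2 i
        rw [Matrix.act_apply] at this
        rw [this]; simp
      have h8 : ∑ j, A 0 i j • s • φ (f (c j)) = s • φ (f (∑ j, A 0 i j • c j)) := by
        rw [map_sum, map_sum, Finset.smul_sum]
        refine Finset.sum_congr rfl fun j _ => ?_
        rw [map_smul, ← algebraMap_smul R' (A 0 i j) (f (c j)), map_smul, algebraMap_smul,
          smul_comm]
      rw [h8, h7, map_zero, smul_zero]
    obtain ⟨w, hw, h7⟩ := IsLocalizedModule.exists_smul_eq_zero_of_finite W f _ h6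
    obtain ⟨ψ, hψ⟩ := hF.exists_hom (fun j => w • z j) (by
      have : (fun j => w • z j) = w • z := rfl
      rw [this, map_smul]
      ext i
      exact h7 i)
    obtain ⟨r, rfl⟩ := hbij.2 ψ
    obtain ⟨t, ht⟩ := hinv _ (W.mul_mem hw hs)
    refine ⟨t * algebraMap R R' r, ?_⟩
    ext z'
    obtain ⟨v, rfl⟩ := hgen z'
    simp only [map_sum, map_smul]
    refine Finset.sum_congr rfl fun j _ => ?_
    congr 1
    rw [Module.algebraMap_end_apply]
    refine cancel _ (W.mul_mem hw hs) _ _ ?_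
    have h10 : (w * s) • φ (f (c j)) = r • f (c j) := by
      rw [mul_smul w s, hz, ← map_smul, ← hψ, Module.algebraMap_end_apply, map_smul]
    rw [h10, mul_smul t, ← algebraMap_smul R' (w * s), smul_smul, mul_comm _ t, ht, one_smul,
      algebraMap_smul]
  · rw [hact, Matrix.act_map, h2]
    ext; simp
  · intro v' hv'
    obtain ⟨s, hs, v, hv⟩ :=
      IsLocalizedModule.exists_smul_eq_of_finite W (Algebra.linearMap R R') v'
    have h6 : ∀ i : Fin 1, f (∑ i, v i • c i) = 0 := by
      intro _
      have : s • ∑ i, v' i • f (c i) = 0 := by rw [hv', smul_zero]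
      rw [← this, map_sum, Finset.smul_sum]
      refine Finset.sum_congr rfl fun i _ => ?_
      rw [← smul_assoc, hv, Algebra.linearMap_apply, algebraMap_smul, map_smul]
    obtain ⟨w, hw, h7⟩ := IsLocalizedModule.exists_smul_eq_zero_of_finite W f _ h6
    obtain ⟨y, hy⟩ := h3 (fun i => w * v i) (by
      simp only [mul_smul, ← Finset.smul_sum]; exact h7 0)
    obtain ⟨t, ht⟩ := hinv _ (W.mul_mem hw hs)
    refine ⟨fun i => t * algebraMap R R' (y i), ?_⟩
    ext j
    have h8 : algebraMap R R' (w * v j) =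
        ∑ i, algebraMap R R' (y i) * algebraMap R R' (A 0 i j) := by
      have := congrArg (algebraMap R R') (congrFun hy j)
      simpa [Matrix.vecMul, dotProduct] using this
    have h9 : algebraMap R R' (v j) = algebraMap R R' s * v' j := by
      rw [← Algebra.smul_def, hv]; rfl
    simp only [Matrix.vecMul, dotProduct, mul_assoc, Matrix.map_apply, ← Finset.mul_sum]
    rw [← h8, map_mul, h9, ← mul_assoc (algebraMap R R' w), ← map_mul, ← mul_assoc, ht, one_mul]
  · intro i
    rw [← Matrix.map_mul, h4]
    simp
  · intro i u' hu'
    rw [hact] at hu'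
    obtain ⟨s, hs, u, hu⟩ := IsLocalizedModule.exists_smul_eq_of_finite W f u'
    have h6 : ∀ j, f ((A (i + 1)).act C u j) = 0 := by
      intro j
      have : (A (i + 1)).act C' (fun j => f (u j)) j = f ((A (i + 1)).act C u j) :=
        congrFun (Matrix.act_map (A (i + 1)) f u) j
      rw [← this]
      simp only [← hu]
      have h7 : (fun k => s • u' k) = s • u' := rfl
      rw [h7, map_smul, hu', smul_zero]
      rfl
    obtain ⟨w, hw, h7⟩ := IsLocalizedModule.exists_smul_eq_zero_of_finite W f _ h6
    obtain ⟨y, hy⟩ := h5 i (w • u) (by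
      rw [map_smul]; ext j; exact h7 j)
    obtain ⟨t, ht⟩ := hinv _ (W.mul_mem hw hs)
    refine ⟨fun j => t • f (y j), ?_⟩
    have e1 : (fun j => t • f (y j)) = t • fun j => f (y j) := rfl
    rw [e1, map_smul, hact, Matrix.act_map, ← hy]
    ext j
    refine cancel _ (W.mul_mem hw hs) _ _ ?_
    rw [Pi.smul_apply, Pi.smul_apply, ← algebraMap_smul R' (w * s) (t • _), smul_smul, mul_comm _ t,
      ht, one_smul, map_smul, ← hu, mul_smul]

end Localization

section Descent

open RingTheory.Sequence
open scoped Pointwise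

variable {R : Type} [CommRing R]

/-- Every dual exact `R`-module is cyclic. -/
def DualExactCyclic (R : Type) [CommRing R] : Prop :=
  ∀ (C : Type) [AddCommGroup C] [Module R C], DualExact R C → ∃ c : C, ∀ z, ∃ r : R, z = r • c

theorem DualExact.eq_zero_of_forall_smul {C : Type} [AddCommGroup C] [Module R C]
    (h : DualExact R C) {r : R} (hr : ∀ z : C, r • z = 0) : r = 0 :=
  h.bijective.1 (by ext z; simp [hr z])

theorem DualExact.nonempty_linearEquiv {C : Type} [AddCommGroup C] [Module R C]
    (h : DualExact R C) {c : C} (hc : ∀ z, ∃ r : R, z = r • c) : Nonempty (C ≃ₗ[R] R) := by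
  refine ⟨(LinearEquiv.ofBijective (LinearMap.toSpanSingleton R C c) ⟨?_, fun z => ?_⟩).symm⟩
  · rw [injective_iff_map_eq_zero]
    intro r hr
    rw [LinearMap.toSpanSingleton_apply] at hr
    refine h.eq_zero_of_forall_smul fun z => ?_
    obtain ⟨s, rfl⟩ := hc z
    rw [smul_comm, hr, smul_zero]
  · obtain ⟨r, rfl⟩ := hc z
    exact ⟨r, by simp⟩

theorem isSMulRegular_quotSMulTop_iff {M : Type} [AddCommGroup M] [Module R M] {x s : R} :
    IsSMulRegular (QuotSMulTop x M) s ↔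
      ∀ z : M, (∃ y : M, s • z = x • y) → ∃ y : M, z = x • y := by
  rw [isSMulRegular_iff_right_eq_zero_of_smul]
  have key : ∀ z : M, (Submodule.Quotient.mk z : QuotSMulTop x M) = 0 ↔
      ∃ y, z = x • y := fun z => by
    rw [Submodule.Quotient.mk_eq_zero, mem_smul_top_iff']
  constructor
  · intro h z hz
    rw [← key] at hz ⊢
    exact h _ hz
  · intro h z hz
    obtain ⟨z, rfl⟩ := Submodule.Quotient.mk_surjective _ z
    rw [key]
    exact h z ((key _).1 hz)

theorem DualExact.isSMulRegular [IsDomain R] [IsNoetherianRing R] {C : Type} [AddCommGroup C]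
    [Module R C] (h : DualExact R C) {x : R} (hx : x ≠ 0) : IsSMulRegular C x := by
  have h1 : IsWeaklyRegular R [x] := by
    rw [isWeaklyRegular_singleton_iff]
    exact IsSMulRegular.of_right_eq_zero_of_smul fun z hz => by
      simpa [hx] using hz
  exact (isWeaklyRegular_singleton_iff _ _).1 (h.isWeaklyRegular h1).1

theorem DualExact.exists_smul_of_prime [IsDomain R] [IsNoetherianRing R] {C : Type}
    [AddCommGroup C] [Module R C] (h : DualExact R C) {x s : R} (hx : Prime x) (hs : ¬ x ∣ s)
    {z y : C} (hz : s • z = x • y) : ∃ y, z = x • y := by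
  have h1 : IsWeaklyRegular R [x, s] := by
    rw [isWeaklyRegular_cons_iff, isWeaklyRegular_singleton_iff, isSMulRegular_quotSMulTop_iff]
    refine ⟨IsSMulRegular.of_right_eq_zero_of_smul fun z hz => by simpa [hx.ne_zero] using hz, ?_⟩
    rintro z ⟨y, hy⟩
    obtain ⟨w, hw⟩ := (hx.dvd_or_dvd (Dvd.intro y hy.symm)).resolve_left hs
    exact ⟨w, hw⟩
  have h2 := (h.isWeaklyRegular h1).1
  rw [isWeaklyRegular_cons_iff, isWeaklyRegular_singleton_iff, isSMulRegular_quotSMulTop_iff] at h2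
  exact h2.2 z ⟨y, hz⟩

theorem DualExact.cyclic_of_smul [IsDomain R] [IsNoetherianRing R] {C : Type} [AddCommGroup C]
    [Module R C] (h : DualExact R C) {w : R}
    (hw : w ∈ Submonoid.closure {x : R | IsUnit x ∨ Prime x}) :
    ∀ c : C, (∀ z : C, ∃ s : R, w • z = s • c) → ∃ c' : C, ∀ z, ∃ r : R, z = r • c' := by
  induction hw using Submonoid.closure_induction_left with
  | one => exact fun c hc => ⟨c, fun z => by simpa using hc z⟩
  | mul_left x hx w' _ ih =>
    intro c hc
    obtain hx | hx := hx
    · refine ih c fun z => ?_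
      obtain ⟨s, hs⟩ := hc z
      obtain ⟨u, hu⟩ := hx.exists_left_inv
      exact ⟨u * s, by rw [mul_smul, ← hs, smul_smul, ← mul_assoc, hu, one_mul]⟩
    · by_cases hcx : ∃ c₁, c = x • c₁
      · obtain ⟨c₁, rfl⟩ := hcx
        refine ih c₁ fun z => ?_
        obtain ⟨s, hs⟩ := hc z
        refine ⟨s, h.isSMulRegular hx.ne_zero ?_⟩
        show x • _ = x • _
        rw [← mul_smul, hs, smul_comm]
      · refine ih c fun z => ?_
        obtain ⟨s, hs⟩ := hc z
        have h1 : x ∣ s := by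
          by_contra hxs
          refine hcx (h.exists_smul_of_prime hx hxs (y := w' • z) ?_)
          rw [← hs, mul_smul]
        obtain ⟨s', rfl⟩ := h1
        refine ⟨s', h.isSMulRegular hx.ne_zero ?_⟩
        show x • _ = x • _
        rw [← mul_smul, hs, mul_smul]

theorem DualExactCyclic.exists_smul_of_isLocalization [IsNoetherianRing R] (W : Submonoid R)
    (R' : Type) [CommRing R'] [Algebra R R'] [IsLocalization W R'] (h : DualExactCyclic R')
    {C : Type} [AddCommGroup C] [Module R C] (hC : DualExact R C) :
    ∃ w ∈ W, ∃ c : C, ∀ z : C, ∃ s : R, w • z = s • c := by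
  let f := LocalizedModule.mkLinearMap W C
  have hf : Module.Finite R C := hC.finite
  let _ : Module R' (LocalizedModule W C) := LocalizedModule.moduleOfIsLocalization
  have : IsScalarTower R R' (LocalizedModule W C) := inferInstance
  have hC' : DualExact R' (LocalizedModule W C) := hC.localization W f
  obtain ⟨c', hc'⟩ := h _ hC'
  obtain ⟨⟨c, s⟩, hs⟩ := IsLocalizedModule.surj W f c'
  simp only at hs
  obtain ⟨t, ht⟩ := (IsLocalization.map_units R' s).exists_left_inv
  have hgen : ∀ z : C, ∃ w ∈ W, ∃ a : R, w • z = a • c := by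
    intro z
    obtain ⟨r', hr'⟩ := hc' (f z)
    have h1 : c' = t • f c := by
      rw [← hs, Submonoid.smul_def, ← algebraMap_smul R' (s : R), smul_smul, ht, one_smul]
    obtain ⟨⟨a, w⟩, hw⟩ := IsLocalization.surj W (r' * t)
    simp only at hw
    have h2 : f ((w : R) • z - a • c) = 0 := by
      rw [map_sub, map_smul, map_smul, hr', h1, smul_smul, ← algebraMap_smul R' (w : R), smul_smul,
        mul_comm, hw, algebraMap_smul, sub_self]
    obtain ⟨v, hv⟩ := (IsLocalizedModule.eq_zero_iff W f).1 h2
    rw [Submonoid.smul_def, smul_sub, sub_eq_zero, smul_smul, smul_smul] at hv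
    exact ⟨v * w, W.mul_mem v.2 w.2, _, hv⟩
  obtain ⟨n, p, hp⟩ := Module.Finite.exists_fin_surjective (R := R) C
  choose w hw a ha using fun i : Fin n => hgen (p (Pi.single i 1))
  have key : ∀ i, ∃ s : R, (∏ j, w j) • p (Pi.single i 1) = s • c := fun i => by
    refine ⟨(∏ j ∈ Finset.univ.erase i, w j) * a i, ?_⟩
    rw [← Finset.prod_erase_mul _ _ (Finset.mem_univ i), mul_smul, mul_smul, ha]
  choose b hb using key
  refine ⟨∏ j, w j, Submonoid.prod_mem _ fun i _ => hw i, c, fun z => ?_⟩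
  obtain ⟨v, rfl⟩ := hp z
  refine ⟨∑ i, v i * b i, ?_⟩
  conv_lhs => rw [← Finset.univ_sum_single v, map_sum]
  rw [Finset.smul_sum, Finset.sum_smul]
  refine Finset.sum_congr rfl fun i _ => ?_
  have : (Pi.single i (v i) : Fin n → R) = v i • Pi.single i 1 := by
    rw [← Pi.single_smul, smul_eq_mul, mul_one]
  rw [this, map_smul, smul_comm, hb, smul_smul]

/-- Cyclicity of dual exact modules descends along localization at products of primes. -/
theorem DualExactCyclic.of_isLocalization [IsDomain R] [IsNoetherianRing R] (W : Submonoid R)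
    (hW : W ≤ Submonoid.closure {x : R | IsUnit x ∨ Prime x}) (R' : Type) [CommRing R']
    [Algebra R R'] [IsLocalization W R'] (h : DualExactCyclic R') : DualExactCyclic R := by
  intro C _ _ hC
  obtain ⟨w, hw, c, hc⟩ := h.exists_smul_of_isLocalization W R' hC
  exact hC.cyclic_of_smul (hW hw) c hc

theorem DualExactCyclic.of_ringEquiv [IsDomain R] [IsNoetherianRing R] {R' : Type} [CommRing R']
    (e : R ≃+* R') (h : DualExactCyclic R') : DualExactCyclic R := by
  let _ := e.toRingHom.toAlgebra
  have : IsLocalization (⊥ : Submonoid R) R' :=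
    IsLocalization.of_le_isUnit_of_bijective (by
      rintro _ ⟨x, hx, rfl⟩
      rw [SetLike.mem_coe, Submonoid.mem_bot] at hx
      simp [hx]) e.bijective
  exact DualExactCyclic.of_isLocalization ⊥ bot_le R' h

/-- Over a field, every dual exact module is cyclic. -/
theorem DualExactCyclic.of_field (K : Type) [Field K] : DualExactCyclic K := by
  intro C _ _ h
  by_cases h0 : ∀ c : C, c = 0
  · exact ⟨0, fun z => ⟨0, by simp [h0 z]⟩⟩
  · push Not at h0
    obtain ⟨c, hc⟩ := h0
    refine ⟨c, fun z => ?_⟩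
    obtain ⟨f, hf⟩ := Module.Projective.exists_dual_ne_zero K hc
    obtain ⟨r, hr⟩ := h.bijective.2 ((LinearMap.toSpanSingleton K C z) ∘ₗ f)
    have h1 : r • c = f c • z := congrArg (fun g : Module.End K C => g c) hr
    exact ⟨(f c)⁻¹ * r, by rw [mul_smul, h1, inv_smul_smul₀ hf]⟩

end Descent

section RankFactorization

variable {K V : Type*} [Field K] [AddCommGroup V] [Module K V]

theorem exists_linearIndependent_comp_of_le_finrank [FiniteDimensional K V] {ι : Type*}
    (v : ι → V) {q : ℕ} (h : q ≤ Module.finrank K (Submodule.span K (Set.range v))) :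
    ∃ γ : Fin q → ι, LinearIndependent K (v ∘ γ) := by
  obtain ⟨f, hf, -, hli⟩ := Submodule.exists_fun_fin_finrank_span_eq K (Set.range v)
  choose g hg using hf
  refine ⟨fun a => g (Fin.castLE h a), ?_⟩
  have : v ∘ (fun a => g (Fin.castLE h a)) = f ∘ Fin.castLE h := by
    funext a; simp [hg]
  rw [this]
  exact hli.comp _ (Fin.castLE_injective h)

theorem finrank_span_le_of_det_eq_zero {ι : Type*} {m q : ℕ} (v : ι → Fin m → K)
    (h : ∀ (ρ : Fin (q + 1) → Fin m) (γ : Fin (q + 1) → ι),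
      (Matrix.of fun a b => v (γ b) (ρ a)).det = 0) :
    Module.finrank K (Submodule.span K (Set.range v)) ≤ q := by
  by_contra! hlt
  obtain ⟨γ, hγ⟩ := exists_linearIndependent_comp_of_le_finrank v (Nat.succ_le_of_lt hlt)
  let B : Matrix (Fin (q + 1)) (Fin m) K := v ∘ γ
  have hB : B.rank = q + 1 := by
    have : LinearIndependent K B.row := hγ
    simpa using this.rank_matrix
  rw [← Matrix.rank_transpose, Matrix.rank_eq_finrank_span_row] at hB
  obtain ⟨ρ, hρ⟩ := exists_linearIndependent_comp_of_le_finrank (K := K) B.transpose.row hB.ge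
  let A : Matrix (Fin (q + 1)) (Fin (q + 1)) K := B.transpose.row ∘ ρ
  have hA : IsUnit A := Matrix.linearIndependent_rows_iff_isUnit.1 hρ
  rw [Matrix.isUnit_iff_isUnit_det] at hA
  exact hA.ne_zero (h ρ γ)

theorem exists_hyperplane_between [FiniteDimensional K V] {L L' H : Submodule K V}
    (φ : V →ₗ[K] K) (hφ : H = LinearMap.ker φ) {i : ℕ} (hLL' : L ≤ L')
    (hL : Module.finrank K L ≤ i) (hL' : Module.finrank K L' ≤ i + 1) :
    ∃ N : Submodule K V, L ≤ N ∧ N ≤ L' ∧ Module.finrank K N ≤ i ∧ (L ≤ H → N ≤ H) ∧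
      ∃ y ∈ L', ∀ w ∈ L', ∃ c : K, w - c • y ∈ N := by
  have key : ∀ ψ : V →ₗ[K] K, L ≤ LinearMap.ker ψ → ∀ y ∈ L', ψ y ≠ 0 →
      L ≤ L' ⊓ LinearMap.ker ψ ∧ L' ⊓ LinearMap.ker ψ ≤ L' ∧
      Module.finrank K (L' ⊓ LinearMap.ker ψ : Submodule K V) ≤ i ∧
      ∀ w ∈ L', ∃ c : K, w - c • y ∈ L' ⊓ LinearMap.ker ψ := by
    intro ψ hψ y hy hy0
    refine ⟨le_inf hLL' hψ, inf_le_left, ?_, fun w hw => ⟨ψ w / ψ y, ?_, ?_⟩⟩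
    · have hlt : L' ⊓ LinearMap.ker ψ < L' :=
        lt_of_le_of_ne inf_le_left fun e => hy0 (e.ge hy).2
      have := Submodule.finrank_lt_finrank_of_lt hlt
      omega
    · exact sub_mem hw (Submodule.smul_mem _ _ hy)
    · simp [hy0]
  by_cases hcase : L ≤ H ∧ ¬ L' ≤ H
  · obtain ⟨y, hy, hyH⟩ := SetLike.not_le_iff_exists.1 hcase.2
    obtain ⟨h1, h2, h3, h4⟩ := key φ (hφ ▸ hcase.1) y hy (by simpa [hφ] using hyH)
    exact ⟨_, h1, h2, h3, fun _ => hφ ▸ inf_le_right, y, hy, h4⟩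
  · have hH : ∀ N ≤ L', L ≤ H → N ≤ H := fun N hN hLH => by
      have : L' ≤ H := by tauto
      exact hN.trans this
    by_cases hle : L' ≤ L
    · exact ⟨L, le_rfl, hLL', hL, id, 0, zero_mem _, fun w hw => ⟨0, by simpa using hle hw⟩⟩
    · obtain ⟨y, hy, hyL⟩ := SetLike.not_le_iff_exists.1 hle
      obtain ⟨ψ, hψy, hψ⟩ := Submodule.exists_le_ker_of_notMem hyL
      obtain ⟨h1, h2, h3, h4⟩ := key ψ hψ y hy hψy
      exact ⟨_, h1, h2, h3, hH _ h2, y, hy, h4⟩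

/-- Vectors whose initial segments have bounded rank can be expressed triangularly, by coefficients
in a common sequence whose first terms lie in a prescribed hyperplane. -/
theorem exists_triangular_expression [FiniteDimensional K V] {H : Submodule K V}
    (φ : V →ₗ[K] K) (hφ : H = LinearMap.ker φ) (v : ℕ → V) (ρ : ℕ → ℕ) (t : ℕ)
    (hρ0 : ρ 0 = 0) (hρ : ∀ j, ρ (j + 1) = ρ j ∨ ρ (j + 1) = ρ j + 1)
    (ht : ρ (t + 1) = ρ t + 1)
    (hrank : ∀ j, Module.finrank K (Submodule.span K (v '' Set.Iio j)) ≤ ρ j)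
    (hH : ∀ c < t, v c ∈ H) (j : ℕ) (L : Submodule K V) (hvL : ∀ c < j, v c ∈ L)
    (hL : Module.finrank K L ≤ ρ j) (hLH : L ≤ H ∨ t < j) :
    ∃ y : ℕ → V, (∀ a, y a ∈ L) ∧
      (∀ w ∈ L, ∃ z : ℕ → K, w = ∑ a ∈ Finset.range (ρ j), z a • y a) ∧
      (∀ c < j, ∃ z : ℕ → K, v c = ∑ a ∈ Finset.range (ρ (c + 1)), z a • y a) ∧
      ∀ a < ρ t, y a ∈ H := by
  have hmono : Monotone ρ := monotone_nat_of_le_succ fun j => by rcases hρ j with h | h <;> omega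
  induction j generalizing L with
  | zero =>
    have hbot : L = ⊥ := by
      rw [hρ0] at hL
      exact Submodule.finrank_eq_zero.1 (Nat.le_zero.1 hL)
    subst hbot
    exact ⟨0, fun _ => zero_mem _, fun w hw => ⟨0, by simpa using hw⟩,
      fun c hc => absurd hc (Nat.not_lt_zero c), fun _ _ => zero_mem _⟩
  | succ j ih =>
    rcases hρ j with he | he
    · have hjt : j ≠ t := by rintro rfl; omega
      obtain ⟨y, hy, hspan, hv, hyH⟩ := ih L (fun c hc => hvL c (by omega)) (by omega)
        (hLH.imp id fun _ => by omega)
      refine ⟨y, hy, by rwa [he], fun c hc => ?_, hyH⟩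
      rcases Nat.lt_succ_iff_lt_or_eq.1 hc with h | rfl
      · exact hv c h
      · rw [he]; exact hspan _ (hvL _ hc)
    · let L₀ := Submodule.span K (v '' Set.Iio j)
      have hL₀L : L₀ ≤ L := Submodule.span_le.2 <| by
        rintro _ ⟨c, hc, rfl⟩
        exact hvL c (Nat.lt_succ_of_lt hc)
      obtain ⟨N, h1, h2, h3, h4, y₀, hy₀, h5⟩ :=
        exists_hyperplane_between φ hφ hL₀L (hrank j) (he ▸ hL)
      have hNH : N ≤ H ∨ t < j := by
        rcases lt_or_ge t j with h | h
        · exact Or.inr h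
        · refine Or.inl (h4 (Submodule.span_le.2 ?_))
          rintro _ ⟨c, hc, rfl⟩
          exact hH c (lt_of_lt_of_le hc h)
      obtain ⟨y, hy, hspan, hv, hyH⟩ := ih N
        (fun c hc => h1 (Submodule.subset_span ⟨c, hc, rfl⟩)) h3 hNH
      have hsum : ∀ q ≤ ρ j, ∀ z : ℕ → K,
          ∑ a ∈ Finset.range q, z a • Function.update y (ρ j) y₀ a =
            ∑ a ∈ Finset.range q, z a • y a := fun q hq z =>
        Finset.sum_congr rfl fun a ha => by
          rw [Function.update_of_ne]
          have := Finset.mem_range.1 ha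
          omega
      have hspan' : ∀ w ∈ L, ∃ z : ℕ → K,
          w = ∑ a ∈ Finset.range (ρ (j + 1)), z a • Function.update y (ρ j) y₀ a := by
        intro w hw
        obtain ⟨c, hc⟩ := h5 w hw
        obtain ⟨z, hz⟩ := hspan _ hc
        refine ⟨Function.update z (ρ j) c, ?_⟩
        rw [he, Finset.sum_range_succ, hsum _ le_rfl, Function.update_self, Function.update_self]
        rw [sub_eq_iff_eq_add] at hz
        rw [hz]
        congr 1
        exact Finset.sum_congr rfl fun a ha => by
          rw [Function.update_of_ne]
          have := Finset.mem_range.1 ha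
          omega
      refine ⟨Function.update y (ρ j) y₀, fun a => ?_, hspan', fun c hc => ?_, fun a ha => ?_⟩
      · rcases eq_or_ne a (ρ j) with rfl | h
        · simpa using hy₀
        · rw [Function.update_of_ne h]; exact h2 (hy a)
      · rcases Nat.lt_succ_iff_lt_or_eq.1 hc with h | rfl
        · obtain ⟨z, hz⟩ := hv c h
          exact ⟨z, by rw [hsum _ (hmono h), hz]⟩
        · exact hspan' _ (hvL _ hc)
      · rcases eq_or_ne a (ρ j) with rfl | h
        · have hjt : j < t := by
            by_contra! hle
            exact absurd (hmono hle) (by omega)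
          rw [Function.update_self]
          exact (hLH.resolve_right (by omega)) hy₀
        · rw [Function.update_of_ne h]; exact hyH a ha

/-- The matrices satisfying prescribed rank conditions on initial column blocks, and having
prescribed initial zeros, factor accordingly. -/
theorem exists_factorization_of_minors_eq_zero {m n : ℕ} (M : Fin m → Fin n → K) (ρ : ℕ → ℕ)
    (s : Fin m) (t : ℕ) (htn : t < n)
    (hρ0 : ρ 0 = 0) (hρ : ∀ j, ρ (j + 1) = ρ j ∨ ρ (j + 1) = ρ j + 1)
    (ht : ρ (t + 1) = ρ t + 1)
    (hzero : ∀ i j, i < s ∨ (i = s ∧ j.val < t) → M i j = 0)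
    (hminor : ∀ j ≤ n, ∀ (α : Fin (ρ j + 1) → Fin m) (γ : Fin (ρ j + 1) → Fin n),
      (∀ b, (γ b).val < j) → (Matrix.of fun a b => M (α a) (γ b)).det = 0) :
    ∃ (y : Fin m → ℕ → K) (z : ℕ → Fin n → K),
      (∀ i j, M i j = ∑ a ∈ Finset.range (ρ (j.val + 1)), y i a * z a j) ∧
      ∀ i a, i < s ∨ (i = s ∧ a < ρ t) → y i a = 0 := by
  classical
  have hmono : Monotone ρ := monotone_nat_of_le_succ fun j => by rcases hρ j with h | h <;> omega
  let v : ℕ → Fin m → K := fun c i => if h : c < n then M i ⟨c, h⟩ else 0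
  let L := Submodule.span K (v '' Set.Iio n)
  have hrank' : ∀ j ≤ n, Module.finrank K (Submodule.span K (v '' Set.Iio j)) ≤ ρ j := by
    intro j hj
    have := finrank_span_le_of_det_eq_zero (K := K) (q := ρ j)
      (fun c : {c : Fin n // c.val < j} => fun i => M i c.1) fun α γ =>
        hminor j hj α (fun b => (γ b).1) fun b => (γ b).2
    refine le_trans (Submodule.finrank_mono (Submodule.span_mono ?_)) this
    rintro _ ⟨c, hc, rfl⟩
    have hcj : c < j := hc
    refine ⟨⟨⟨c, by omega⟩, hcj⟩, ?_⟩
    funext i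
    simp [v, show c < n by omega]
  have hrank : ∀ j, Module.finrank K (Submodule.span K (v '' Set.Iio j)) ≤ ρ j := by
    intro j
    rcases le_or_gt j n with h | h
    · exact hrank' j h
    · refine le_trans (Submodule.finrank_mono (Submodule.span_le.2 ?_))
        ((hrank' n le_rfl).trans (hmono h.le))
      rintro _ ⟨c, -, rfl⟩
      by_cases hc : c < n
      · exact Submodule.subset_span ⟨c, hc, rfl⟩
      · have : v c = 0 := by funext i; simp [v, hc]
        rw [this]; exact zero_mem _
  obtain ⟨y, hyL, -, hv, hyH⟩ := exists_triangular_expression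
    (H := LinearMap.ker (LinearMap.proj s : (Fin m → K) →ₗ[K] K)) (LinearMap.proj s) rfl v ρ t
    hρ0 hρ ht hrank (fun c hc => by
      have hcn : c < n := by omega
      simp [v, hcn, hzero s ⟨c, hcn⟩ (Or.inr ⟨rfl, hc⟩)]) n L
    (fun c hc => Submodule.subset_span ⟨c, hc, rfl⟩) (hrank n) (Or.inr htn)
  choose z hz using hv
  refine ⟨fun i a => y a i, fun a j => z j j.2 a, fun i j => ?_, ?_⟩
  · have := congrFun (hz j j.2) i
    simp only [v, j.2, dite_true, Finset.sum_apply, Pi.smul_apply, smul_eq_mul] at this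
    simpa [mul_comm] using this
  · rintro i a (hi | ⟨rfl, ha⟩)
    · have hle : L ≤ LinearMap.ker (LinearMap.proj i : (Fin m → K) →ₗ[K] K) := by
        refine Submodule.span_le.2 ?_
        rintro _ ⟨c, hc, rfl⟩
        have hcn : c < n := hc
        simp [v, hcn, hzero i ⟨c, hcn⟩ (Or.inl hi)]
      exact hle (hyL a)
    · exact hyH a ha

end RankFactorization

section RankIdeals

open MvPolynomial

theorem Matrix.det_eq_zero_of_eq_sum {A : Type*} [CommRing A] {q q' : ℕ} (hq : q' < q)
    (M : Matrix (Fin q) (Fin q) A) (u : Fin q → ℕ → A) (w : ℕ → Fin q → A)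
    (h : ∀ a b, M a b = ∑ c ∈ Finset.range q', u a c * w c b) : M.det = 0 := by
  have hM : M = (Matrix.of fun a (c : Fin q) => u a c) *
      (Matrix.of fun (c : Fin q) b => if c.val < q' then w c b else 0) := by
    ext a b
    rw [h, Matrix.mul_apply]
    simp only [Matrix.of_apply, mul_ite, mul_zero]
    rw [Fin.sum_univ_eq_sum_range (fun c => if c < q' then u a c * w c b else 0) q,
      ← Finset.sum_filter]
    refine Finset.sum_congr ?_ fun _ _ => rfl
    ext c
    simp only [Finset.mem_range, Finset.mem_filter]
    omega
  rw [hM, Matrix.det_mul, Matrix.det_eq_zero_of_row_eq_zero (A := Matrix.of fun (c : Fin q) b =>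
    if c.val < q' then w c b else 0) ⟨q', hq⟩ (by simp), mul_zero]

theorem MvPolynomial.isHomogeneous_det {σ A : Type*} [CommRing A] {q : ℕ}
    (M : Matrix (Fin q) (Fin q) (MvPolynomial σ A)) (h : ∀ a b, (M a b).IsHomogeneous 1) :
    M.det.IsHomogeneous q := by
  rw [Matrix.det_apply]
  refine IsHomogeneous.sum _ _ _ fun τ _ => ?_
  have hp : (∏ i, M (τ i) i).IsHomogeneous q := by
    simpa using IsHomogeneous.prod Finset.univ (fun i => M (τ i) i) (fun _ => 1) fun i _ => h _ _
  rcases Int.units_eq_one_or (Equiv.Perm.sign τ) with hs | hs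
  · simpa [hs] using hp
  · simpa [hs] using hp.neg

/-- A function bounding the ranks of the initial column blocks of a matrix. -/
def IsRankFunction (ρ : ℕ → ℕ) : Prop :=
  ρ 0 = 0 ∧ ∀ j, ρ (j + 1) = ρ j ∨ ρ (j + 1) = ρ j + 1

theorem IsRankFunction.monotone {ρ : ℕ → ℕ} (h : IsRankFunction ρ) : Monotone ρ :=
  monotone_nat_of_le_succ fun j => by rcases h.2 j with h | h <;> omega

variable (D : Type) [CommRing D] (m n : ℕ)

/-- The ideal of the first `s` rows and the first `t` entries of row `s`, together with the
`(ρ j + 1)`-minors of the first `j` columns. -/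
noncomputable def rankIdeal (ρ : ℕ → ℕ) (s t : ℕ) : Ideal (MvPolynomial (Fin m × Fin n) D) :=
  Ideal.span ({f | ∃ p : Fin m × Fin n,
      (p.1.val < s ∨ (p.1.val = s ∧ p.2.val < t)) ∧ f = X p} ∪
    {f | ∃ j ≤ n, ∃ (α : Fin (ρ j + 1) → Fin m) (γ : Fin (ρ j + 1) → Fin n),
      (∀ b, (γ b).val < j) ∧ f = (Matrix.of fun a b => X (α a, γ b)).det})

/-- The generic matrix factorization satisfying the conditions defining `rankIdeal`. -/
noncomputable def rankParam (ρ : ℕ → ℕ) (s t : ℕ) :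
    MvPolynomial (Fin m × Fin n) D →ₐ[D] MvPolynomial ((Fin m × ℕ) ⊕ (ℕ × Fin n)) D :=
  aeval fun p => ∑ a ∈ Finset.range (ρ (p.2.val + 1)),
    (if p.1.val < s ∨ (p.1.val = s ∧ a < ρ t) then 0 else X (Sum.inl (p.1, a))) *
      X (Sum.inr (a, p.2))

variable {D m n}

theorem X_mem_rankIdeal {ρ : ℕ → ℕ} {s t : ℕ} {p : Fin m × Fin n}
    (hp : p.1.val < s ∨ (p.1.val = s ∧ p.2.val < t)) : X p ∈ rankIdeal D m n ρ s t :=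
  Ideal.subset_span (Or.inl ⟨p, hp, rfl⟩)

theorem det_mem_rankIdeal {ρ : ℕ → ℕ} {s t : ℕ} {j : ℕ} (hj : j ≤ n)
    (α : Fin (ρ j + 1) → Fin m) (γ : Fin (ρ j + 1) → Fin n) (hγ : ∀ b, (γ b).val < j) :
    (Matrix.of fun a b => X (α a, γ b)).det ∈ rankIdeal D m n ρ s t :=
  Ideal.subset_span (Or.inr ⟨j, hj, α, γ, hγ, rfl⟩)

theorem rankIdeal_le {ρ : ℕ → ℕ} {s t : ℕ} {J : Ideal (MvPolynomial (Fin m × Fin n) D)}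
    (h1 : ∀ p : Fin m × Fin n, p.1.val < s ∨ (p.1.val = s ∧ p.2.val < t) → X p ∈ J)
    (h2 : ∀ j ≤ n, ∀ (α : Fin (ρ j + 1) → Fin m) (γ : Fin (ρ j + 1) → Fin n),
      (∀ b, (γ b).val < j) → (Matrix.of fun a b => X (α a, γ b)).det ∈ J) :
    rankIdeal D m n ρ s t ≤ J := by
  refine Ideal.span_le.2 ?_
  rintro f (⟨p, hp, rfl⟩ | ⟨j, hj, α, γ, hγ, rfl⟩)
  · exact h1 p hp
  · exact h2 j hj α γ hγ

theorem rankIdeal_le_ker {ρ ρ' : ℕ → ℕ} (hρ' : IsRankFunction ρ') (hle : ∀ j, ρ' j ≤ ρ j)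
    (s t : ℕ) : rankIdeal D m n ρ s t ≤ RingHom.ker (rankParam D m n ρ' s t) := by
  refine rankIdeal_le (fun p hp => ?_) fun j hj α γ hγ => ?_
  · rw [RingHom.mem_ker, rankParam, aeval_X]
    refine Finset.sum_eq_zero fun a ha => ?_
    rw [if_pos, zero_mul]
    refine hp.imp id fun h => ⟨h.1, ?_⟩
    have := hρ'.monotone (show p.2.val + 1 ≤ t by omega)
    have := Finset.mem_range.1 ha
    omega
  · rw [RingHom.mem_ker, AlgHom.map_det]
    refine Matrix.det_eq_zero_of_eq_sum (q' := ρ' j) (Nat.lt_succ_of_le (hle j)) _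
      (fun a c => if (α a).val < s ∨ ((α a).val = s ∧ c < ρ' t) then 0 else X (Sum.inl (α a, c)))
      (fun c b => if c < ρ' ((γ b).val + 1) then X (Sum.inr (c, γ b)) else 0) fun a b => ?_
    have hb : ρ' ((γ b).val + 1) ≤ ρ' j := hρ'.monotone (hγ b)
    simp only [AlgHom.mapMatrix_apply, Matrix.map_apply, Matrix.of_apply, rankParam, aeval_X,
      mul_ite (_ < _), mul_zero]
    rw [← Finset.sum_filter]
    refine Finset.sum_congr ?_ fun _ _ => rfl
    ext c
    simp only [Finset.mem_range, Finset.mem_filter]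
    omega

theorem X_notMem_ker [Nontrivial D] {ρ : ℕ → ℕ} (s : Fin m) (t : Fin n)
    (ht : ρ (t.val + 1) = ρ t + 1) :
    X (s, t) ∉ RingHom.ker (rankParam D m n ρ s t) := by
  rw [RingHom.mem_ker, rankParam, aeval_X, ht, Finset.sum_range_succ, Finset.sum_eq_zero, zero_add]
  · rw [if_neg (by simp)]
    intro h
    have := congrArg (aeval (fun _ => (1 : D))) h
    simp at this
  · intro a ha
    rw [if_pos (Or.inr ⟨rfl, Finset.mem_range.1 ha⟩), zero_mul]

theorem ker_le_radical {ρ : ℕ → ℕ} (hρ : IsRankFunction ρ) (s : Fin m) (t : Fin n)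
    (ht : ρ (t.val + 1) = ρ t + 1) :
    RingHom.ker (rankParam D m n ρ s t) ≤ (rankIdeal D m n ρ s t).radical := by
  intro f hf
  rw [Ideal.radical_eq_sInf, Ideal.mem_sInf]
  rintro 𝔮 ⟨hI, h𝔮⟩
  let K := FractionRing (MvPolynomial (Fin m × Fin n) D ⧸ 𝔮)
  let ev : MvPolynomial (Fin m × Fin n) D →+* K :=
    (algebraMap (MvPolynomial (Fin m × Fin n) D ⧸ 𝔮) K).comp (Ideal.Quotient.mk 𝔮)
  have hev : ∀ g, ev g = 0 ↔ g ∈ 𝔮 := fun g => by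
    simp [ev, Ideal.Quotient.eq_zero_iff_mem]
  obtain ⟨y, z, hyz, hy⟩ := exists_factorization_of_minors_eq_zero
    (fun i j => ev (X (i, j))) ρ s t t.2 hρ.1 hρ.2 ht
    (fun i j hij => (hev _).2 (hI (X_mem_rankIdeal (hij.imp id fun h => ⟨congrArg _ h.1, h.2⟩))))
    fun j hj α γ hγ => by
      have := (hev _).2 (hI (det_mem_rankIdeal (ρ := ρ) (s := s) (t := t) (D := D) hj α γ hγ))
      rw [RingHom.map_det] at this
      exact this
  let φ : MvPolynomial ((Fin m × ℕ) ⊕ (ℕ × Fin n)) D →+* K :=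
    eval₂Hom (ev.comp C) (Sum.elim (fun p => y p.1 p.2) fun p => z p.1 p.2)
  have hφ : φ.comp (rankParam D m n ρ s t).toRingHom = ev := by
    refine MvPolynomial.ringHom_ext (fun d => ?_) fun p => ?_
    · simp [φ, rankParam]
    · simp only [AlgHom.toRingHom_eq_coe, RingHom.comp_apply, RingHom.coe_coe, rankParam, aeval_X,
        map_sum, map_mul]
      rw [hyz p.1 p.2]
      refine Finset.sum_congr rfl fun a _ => ?_
      split_ifs with h
      · rw [hy p.1 a (h.imp id fun h => ⟨Fin.ext h.1, h.2⟩)]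
        simp
      · simp [φ]
  rw [← hev, ← hφ]
  have : rankParam D m n ρ s t f = 0 := hf
  simp [this]

attribute [local instance] MvPolynomial.gradedAlgebra in
/-- Graded Nakayama: a homogeneous ideal contains an ideal which it generates up to a multiple of a
variable. -/
theorem Ideal.le_of_le_sup_span_X {σ : Type*} {I P : Ideal (MvPolynomial σ D)} (x : σ)
    (hI : I.IsHomogeneous (homogeneousSubmodule σ D)) (hIP : I ≤ P) (hP : P.IsPrime)
    (hx : X x ∉ P) (h : P ≤ I ⊔ Ideal.span {X x}) : P ≤ I := by
  have step : ∀ N : ℕ, ∀ f ∈ P, ∃ i ∈ I, ∃ g ∈ P, f = i + X x ^ N * g := by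
    intro N
    induction N with
    | zero => exact fun f hf => ⟨0, zero_mem _, f, hf, by simp⟩
    | succ N ih =>
      intro f hf
      obtain ⟨i, hi, g, hg, rfl⟩ := ih f hf
      obtain ⟨i', hi', w, hw, rfl⟩ := Submodule.mem_sup.1 (h hg)
      obtain ⟨g', rfl⟩ := Ideal.mem_span_singleton'.1 hw
      refine ⟨i + X x ^ N * i', add_mem hi (Ideal.mul_mem_left _ _ hi'), g', ?_, by ring⟩
      have : g' * X x ∈ P := by
        have := sub_mem hg (hIP hi')
        rwa [add_sub_cancel_left] at this
      exact (hP.mem_or_mem this).resolve_right hx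
  intro f hf
  obtain ⟨i, hi, g, -, hfg⟩ := step (f.totalDegree + 1) f hf
  rw [← sum_homogeneousComponent f]
  refine Ideal.sum_mem _ fun d hd => ?_
  rw [hfg, map_add]
  have hzero : homogeneousComponent d (X x ^ (f.totalDegree + 1) * g) = 0 := by
    ext c
    rw [coeff_homogeneousComponent, coeff_zero]
    split_ifs with hc
    · rw [show (X x ^ (f.totalDegree + 1) : MvPolynomial σ D) =
        monomial (Finsupp.single x (f.totalDegree + 1)) 1 by rw [X_pow_eq_monomial],
        coeff_monomial_mul', if_neg]
      intro hle
      have h1 := Finsupp.degree_mono hle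
      rw [Finsupp.degree_single, hc] at h1
      have := Finset.mem_range.1 hd
      omega
    · rfl
  rw [hzero, add_zero]
  exact homogeneousComponent_mem_of_mem hI hi d

attribute [local instance] MvPolynomial.gradedAlgebra in
theorem rankIdeal_isHomogeneous (ρ : ℕ → ℕ) (s t : ℕ) :
    (rankIdeal D m n ρ s t).IsHomogeneous (homogeneousSubmodule (Fin m × Fin n) D) := by
  refine Ideal.homogeneous_span _ _ ?_
  rintro f (⟨p, hp, rfl⟩ | ⟨j, hj, α, γ, hγ, rfl⟩)
  · exact ⟨1, isHomogeneous_X _ _⟩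
  · exact ⟨_, isHomogeneous_det _ fun a b => isHomogeneous_X _ _⟩

theorem rankIdeal_succ_eq_sup (ρ : ℕ → ℕ) (s : Fin m) (t : Fin n) :
    rankIdeal D m n ρ s (t + 1) = rankIdeal D m n ρ s t ⊔ Ideal.span {X (s, t)} := by
  apply le_antisymm
  · refine rankIdeal_le (fun p hp => ?_) fun j hj α γ hγ =>
      Ideal.mem_sup_left (det_mem_rankIdeal hj α γ hγ)
    by_cases h : p = (s, t)
    · exact Ideal.mem_sup_right (Ideal.subset_span (by simp [h]))
    · refine Ideal.mem_sup_left (X_mem_rankIdeal (hp.imp id fun h' => ⟨h'.1, ?_⟩))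
      have : p.2 ≠ t := fun h2 => h (Prod.ext (Fin.ext h'.1) h2)
      have := Fin.val_ne_of_ne this
      omega
  · refine sup_le (rankIdeal_le (fun p hp => X_mem_rankIdeal (hp.imp id fun h => ⟨h.1, by omega⟩))
      fun j hj α γ hγ => det_mem_rankIdeal hj α γ hγ) ?_
    rw [Ideal.span_singleton_le_iff_mem]
    exact X_mem_rankIdeal (Or.inr ⟨rfl, Nat.lt_succ_self _⟩)

theorem isRankFunction_min (r : ℕ) : IsRankFunction fun j => min j r := by
  refine ⟨by simp, fun j => ?_⟩
  dsimp only
  omega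

theorem minorsIdeal_eq_rankIdeal {r : ℕ} (hr : r < n) :
    minorsIdeal D m n (r + 1) = rankIdeal D m n (fun j => min j r) 0 0 := by
  apply le_antisymm
  · refine Ideal.span_le.2 ?_
    rintro f ⟨α, γ, rfl⟩
    have := det_mem_rankIdeal (D := D) (ρ := fun j => min j r) (s := 0) (t := 0) le_rfl
      (fun a => α (Fin.cast (by simp [hr.le]) a)) (fun a => γ (Fin.cast (by simp [hr.le]) a))
      fun b => Fin.is_lt _
    convert this using 1
    rw [← Matrix.det_submatrix_equiv_self (finCongr (show min n r + 1 = r + 1 by omega))]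
    rfl
  · refine rankIdeal_le (fun p hp => by omega) fun j hj α γ hγ => ?_
    rcases le_or_gt j r with h | h
    · have hj' : min j r = j := min_eq_left h
      have : ¬ Function.Injective γ := fun hinj => by
        have := Fintype.card_le_of_injective (fun b => (⟨γ b, hγ b⟩ : Fin j)) fun a b hab =>
          hinj (Fin.ext (Fin.mk.inj_iff.1 hab))
        simp at this
        omega
      simp only [Function.Injective, not_forall] at this
      obtain ⟨b, b', hbb, hne⟩ := this
      rw [Matrix.det_zero_of_column_eq hne fun a => by simp [hbb]]
      exact zero_mem _
    · have hj' : min j r = r := min_eq_right h.le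
      generalize min j r = q at α γ hγ hj'
      subst hj'
      exact Ideal.subset_span ⟨α, γ, rfl⟩

theorem ker_constantCoeff_eq_span_X :
    RingHom.ker (constantCoeff (R := D) (σ := Fin m × Fin n)) = Ideal.span (Set.range X) := by
  apply le_antisymm
  · intro f hf
    rw [← Set.image_univ, mem_ideal_span_X_image]
    intro c hc
    by_contra! h
    have hc0 : c = 0 := Finsupp.ext fun i => h i trivial
    rw [mem_support_iff, hc0] at hc
    exact hc hf
  · refine Ideal.span_le.2 ?_
    rintro _ ⟨p, rfl⟩
    simp

theorem minorsIdeal_one_eq_ker :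
    minorsIdeal D m n 1 = RingHom.ker (constantCoeff (R := D) (σ := Fin m × Fin n)) := by
  rw [ker_constantCoeff_eq_span_X, minorsIdeal]
  congr 1
  ext f
  constructor
  · rintro ⟨α, γ, rfl⟩
    exact ⟨(α 0, γ 0), by simp⟩
  · rintro ⟨p, rfl⟩
    exact ⟨fun _ => p.1, fun _ => p.2, by simp⟩

variable [IsDomain D]

theorem rankIdeal_eq_ker {ρ : ℕ → ℕ} (hρ : IsRankFunction ρ) (s : Fin m) (t : Fin n)
    (ht : ρ (t.val + 1) = ρ t + 1) (hrad : (rankIdeal D m n ρ s (t + 1)).IsRadical) :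
    rankIdeal D m n ρ s t = RingHom.ker (rankParam D m n ρ s t) := by
  refine le_antisymm (rankIdeal_le_ker hρ (fun _ => le_rfl) _ _) ?_
  refine Ideal.le_of_le_sup_span_X (s, t) (rankIdeal_isHomogeneous _ _ _)
    (rankIdeal_le_ker hρ (fun _ => le_rfl) _ _) (RingHom.ker_isPrime _) (X_notMem_ker s t ht) ?_
  rw [← rankIdeal_succ_eq_sup]
  refine (ker_le_radical hρ s t ht).trans ((Ideal.radical_mono ?_).trans hrad)
  rw [rankIdeal_succ_eq_sup]
  exact le_sup_left

theorem rankIdeal_isRadical_of_succ {ρ : ℕ → ℕ} (hρ : IsRankFunction ρ) (s : Fin m) (t : Fin n)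
    (hrad : ∀ ρ, IsRankFunction ρ → (rankIdeal D m n ρ s (t + 1)).IsRadical) :
    (rankIdeal D m n ρ s t).IsRadical := by
  rcases hρ.2 t with ht | ht
  swap
  · rw [rankIdeal_eq_ker hρ s t ht (hrad ρ hρ)]
    exact (RingHom.ker_isPrime (rankParam D m n ρ s t)).isRadical
  rcases Nat.eq_zero_or_pos (ρ t) with h0 | hpos
  · have hX : X (s, t) ∈ rankIdeal D m n ρ s t := by
      have h1 : ρ (t.val + 1) = 0 := ht.trans h0
      have := det_mem_rankIdeal (D := D) (ρ := ρ) (s := s) (t := t) (j := t + 1) t.2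
        (fun _ => s) (fun _ => t) fun _ => Nat.lt_succ_self _
      rw [h1] at this
      simpa using this
    have := hrad ρ hρ
    rwa [rankIdeal_succ_eq_sup, sup_eq_left.2 ((Ideal.span_singleton_le_iff_mem _).2 hX)] at this
  let ρ' : ℕ → ℕ := fun j => if j ≤ t then min (ρ j) (ρ t - 1) else ρ j
  have hρ't : ρ' t = ρ t - 1 := by simp [ρ']
  have hρ't1 : ρ' (t.val + 1) = ρ' t + 1 := by
    rw [hρ't]; simp only [ρ']; rw [if_neg (by omega)]; omega
  have hle : ∀ j, ρ' j ≤ ρ j := fun j => by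
    simp only [ρ']; split_ifs <;> omega
  have hρ' : IsRankFunction ρ' := by
    refine ⟨by simp [ρ', hρ.1], fun j => ?_⟩
    rcases lt_trichotomy j t with h | h | h
    · have := hρ.2 j
      simp only [ρ']
      rw [if_pos (by omega), if_pos (by omega)]
      omega
    · rw [h]; exact Or.inr hρ't1
    · have := hρ.2 j
      simp only [ρ']
      rwa [if_neg (by omega), if_neg (by omega)]
  have hker := rankIdeal_eq_ker (D := D) hρ' s t hρ't1 (hrad ρ' hρ')
  have hprime : (RingHom.ker (rankParam D m n ρ' s t)).IsPrime := RingHom.ker_isPrime _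
  have hIJ : rankIdeal D m n ρ s t ≤ RingHom.ker (rankParam D m n ρ' s t) :=
    rankIdeal_le_ker hρ' hle _ _
  have hmul : RingHom.ker (rankParam D m n ρ' s t) ≤
      Submodule.comap (LinearMap.mulLeft (MvPolynomial (Fin m × Fin n) D) (X (s, t)))
        (rankIdeal D m n ρ s t) := by
    rw [← hker]
    refine Submodule.span_le.2 ?_
    rintro f (⟨p, hp, rfl⟩ | ⟨j, hj, α, γ, hγ, rfl⟩)
    · exact Ideal.mul_mem_left _ _ (X_mem_rankIdeal hp)
    change X (s, t) * _ ∈ rankIdeal D m n ρ s t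
    by_cases hj' : ρ' j = ρ j
    · refine Ideal.mul_mem_left _ _ (Ideal.subset_span (Or.inr ⟨j, hj, ?_⟩))
      rw [← hj']
      exact ⟨α, γ, hγ, rfl⟩
    · have hjt : j ≤ t := by
        by_contra h
        exact hj' (by simp only [ρ']; rw [if_neg h])
      have hjv : ρ' j + 1 = ρ t := by
        have h1 : ρ' j = min (ρ j) (ρ t - 1) := if_pos hjt
        have h2 := hρ.monotone hjt
        omega
      generalize ρ' j + 1 = q at α γ hγ hjv
      subst hjv
      have hdet : (Matrix.of fun a b =>
          (X ((Fin.cons s α : Fin (ρ t + 1) → Fin m) a,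
            (Fin.cons t γ : Fin (ρ t + 1) → Fin n) b) :
              MvPolynomial (Fin m × Fin n) D)).det ∈ rankIdeal D m n ρ s t := by
        refine Ideal.subset_span (Or.inr ⟨t + 1, t.2, ?_⟩)
        rw [ht]
        refine ⟨_, _, fun b => ?_, rfl⟩
        refine Fin.cases ?_ (fun b => ?_) b
        · simp
        · simp only [Fin.cons_succ]
          have := hγ b
          omega
      rw [Matrix.det_succ_row_zero, Fin.sum_univ_succ] at hdet
      have hrest : ∀ b : Fin (ρ t), (X (s, γ b) : MvPolynomial (Fin m × Fin n) D) ∈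
          rankIdeal D m n ρ s t := fun b =>
        X_mem_rankIdeal (Or.inr ⟨rfl, (hγ b).trans_le hjt⟩)
      rw [Ideal.add_mem_iff_left] at hdet
      · simpa [Matrix.submatrix] using hdet
      · refine Ideal.sum_mem _ fun b _ => ?_
        refine Ideal.mul_mem_right _ _ (Ideal.mul_mem_left _ _ ?_)
        simpa using hrest b
  have hx : X (s, t) ∉ RingHom.ker (rankParam D m n ρ' s t) := X_notMem_ker s t hρ't1
  intro f hf
  have hfJ : f ∈ RingHom.ker (rankParam D m n ρ' s t) :=
    hprime.isRadical (Ideal.radical_mono hIJ hf)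
  have hsup : rankIdeal D m n ρ s t ≤ rankIdeal D m n ρ s (t + 1) := by
    rw [rankIdeal_succ_eq_sup]; exact le_sup_left
  have hf' := hrad ρ hρ (Ideal.radical_mono hsup hf)
  rw [rankIdeal_succ_eq_sup] at hf'
  obtain ⟨i, hi, w, hw, rfl⟩ := Submodule.mem_sup.1 hf'
  obtain ⟨g, rfl⟩ := Ideal.mem_span_singleton'.1 hw
  have hg : g * X (s, t) ∈ RingHom.ker (rankParam D m n ρ' s t) := by
    have := sub_mem hfJ (hIJ hi)
    rwa [add_sub_cancel_left] at this
  have := hmul ((hprime.mem_or_mem hg).resolve_right hx)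
  refine add_mem hi ?_
  rw [mul_comm]
  exact this

theorem rankIdeal_isRadical {ρ : ℕ → ℕ} (hρ : IsRankFunction ρ) (s t : ℕ) (hs : s ≤ m)
    (ht : t ≤ n) : (rankIdeal D m n ρ s t).IsRadical := by
  induction hs using Nat.decreasingInduction generalizing ρ t with
  | self =>
    have : rankIdeal D m n ρ m t = RingHom.ker (constantCoeff (R := D) (σ := Fin m × Fin n)) := by
      apply le_antisymm
      · refine rankIdeal_le (fun p _ => by simp) fun j hj α γ hγ => ?_
        rw [RingHom.mem_ker, RingHom.map_det]
        exact Matrix.det_eq_zero_of_row_eq_zero 0 fun b => by simp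
      · rw [ker_constantCoeff_eq_span_X]
        refine Ideal.span_le.2 ?_
        rintro _ ⟨p, rfl⟩
        exact X_mem_rankIdeal (Or.inl p.1.2)
    rw [this]
    exact (RingHom.ker_isPrime _).isRadical
  | of_succ s hs ih =>
    induction ht using Nat.decreasingInduction generalizing ρ with
    | self =>
      have : rankIdeal D m n ρ s n = rankIdeal D m n ρ (s + 1) 0 := by
        have e : ∀ p : Fin m × Fin n, (p.1.val < s ∨ (p.1.val = s ∧ p.2.val < n)) ↔
            (p.1.val < s + 1 ∨ (p.1.val = s + 1 ∧ p.2.val < 0)) := fun p => by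
          have := p.2.2; omega
        simp only [rankIdeal, e]
      rw [this]
      exact ih hρ 0 (Nat.zero_le _)
    | of_succ t ht iht =>
      exact rankIdeal_isRadical_of_succ hρ (⟨s, hs⟩ : Fin m) (⟨t, ht⟩ : Fin n) fun ρ hρ => iht hρ

theorem minorsIdeal_eq_ker {r : ℕ} (hr : r < n) (hr1 : 1 ≤ r) (hm : 0 < m) :
    minorsIdeal D m n (r + 1) = RingHom.ker (rankParam D m n (fun j => min j r) 0 0) := by
  rw [minorsIdeal_eq_rankIdeal hr]
  exact rankIdeal_eq_ker (isRankFunction_min r) ⟨0, hm⟩ ⟨0, by omega⟩ (by simp [hr1])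
    (rankIdeal_isRadical (isRankFunction_min r) _ _ hm.le (by simp; omega))

theorem minorsIdeal_isPrime {r : ℕ} (hr : r < n) (hm : 0 < m) :
    (minorsIdeal D m n (r + 1)).IsPrime := by
  rcases Nat.eq_zero_or_pos r with rfl | h
  · rw [minorsIdeal_one_eq_ker]
    exact RingHom.ker_isPrime _
  rw [minorsIdeal_eq_ker hr h hm]
  exact RingHom.ker_isPrime _

theorem minorsIdeal_sup_span_X_isPrime {r : ℕ} (hr : r < n) (hr2 : 2 ≤ r) (hm : 0 < m) :
    (minorsIdeal D m n (r + 1) ⊔ Ideal.span {X (⟨0, hm⟩, ⟨0, by omega⟩)}).IsPrime := by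
  have h := rankIdeal_eq_ker (D := D) (isRankFunction_min r) (⟨0, hm⟩ : Fin m)
    (⟨1, by omega⟩ : Fin n) (by simp; omega)
    (rankIdeal_isRadical (isRankFunction_min r) _ _ hm.le (by simp; omega))
  rw [minorsIdeal_eq_rankIdeal hr, ← rankIdeal_succ_eq_sup _ (⟨0, hm⟩ : Fin m)
    (⟨0, by omega⟩ : Fin n)]
  exact h ▸ RingHom.ker_isPrime _

end RankIdeals

section DetRing

theorem DualExactCyclic.localization_of_ringHoms {R : Type} [CommRing R] [IsDomain R]
    [IsNoetherianRing R] (W : Submonoid R) (h0 : (0 : R) ∉ W) {R' : Type} [CommRing R']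
    (ψ : R →+* R') (hψ : ∀ w : W, IsUnit (ψ w))
    (χ : R' →+* Localization W) (h1 : χ.comp ψ = algebraMap R (Localization W))
    (h2 : (IsLocalization.lift (S := Localization W) hψ).comp χ = RingHom.id R')
    (h : DualExactCyclic R') : DualExactCyclic (Localization W) := by
  have hle : W ≤ nonZeroDivisors R := le_nonZeroDivisors_of_noZeroDivisors h0
  have : IsDomain (Localization W) := IsLocalization.isDomain_localization hle
  have : IsNoetherianRing (Localization W) :=
    IsLocalization.isNoetherianRing W _ inferInstance
  have h3 : χ.comp (IsLocalization.lift (S := Localization W) hψ) = RingHom.id _ := by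
    refine IsLocalization.ringHom_ext W ?_
    rw [RingHom.comp_assoc, IsLocalization.lift_comp, h1, RingHom.id_comp]
  exact DualExactCyclic.of_ringEquiv (RingEquiv.ofRingHom _ χ h2 h3) h

namespace DetRing

variable {A : Type} [CommRing A] {m n t : ℕ}

/-- The embedding of the coefficients. -/
noncomputable def C : A →+* DetRing A m n t :=
  (Ideal.Quotient.mk _).comp MvPolynomial.C

/-- The entries of the generic matrix. -/
noncomputable def X (i : Fin m) (j : Fin n) : DetRing A m n t :=
  Ideal.Quotient.mk _ (MvPolynomial.X (i, j))

theorem det_X_eq_zero (α : Fin t → Fin m) (γ : Fin t → Fin n) :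
    (Matrix.of fun a b => (X (α a) (γ b) : DetRing A m n t)).det = 0 := by
  have : (Ideal.Quotient.mk (minorsIdeal A m n t))
      (Matrix.of fun a b => MvPolynomial.X (α a, γ b)).det = 0 :=
    Ideal.Quotient.eq_zero_iff_mem.2 (Ideal.subset_span ⟨α, γ, rfl⟩)
  rw [RingHom.map_det] at this
  exact this

theorem map_det_eq_zero {B B' : Type} [CommRing B] [CommRing B'] (f : B →+* B')
    {M : Fin m → Fin n → B} (α : Fin t → Fin m) (γ : Fin t → Fin n)
    (h : (Matrix.of fun a b => M (α a) (γ b)).det = 0) :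
    (Matrix.of fun a b => f (M (α a) (γ b))).det = 0 := by
  rw [← map_zero f, ← h, RingHom.map_det]
  rfl

variable {B : Type} [CommRing B]

/-- The universal property of the determinantal ring. -/
noncomputable def lift (f : A →+* B) (M : Fin m → Fin n → B)
    (h : ∀ (α : Fin t → Fin m) (γ : Fin t → Fin n),
      (Matrix.of fun a b => M (α a) (γ b)).det = 0) : DetRing A m n t →+* B :=
  Ideal.Quotient.lift _ (MvPolynomial.eval₂Hom f fun p => M p.1 p.2) <| by
    suffices hle : minorsIdeal A m n t ≤
        RingHom.ker (MvPolynomial.eval₂Hom f fun p => M p.1 p.2) from fun a ha => hle ha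
    refine Ideal.span_le.2 ?_
    rintro _ ⟨α, γ, rfl⟩
    rw [SetLike.mem_coe, RingHom.mem_ker, RingHom.map_det, ← h α γ]
    congr 1
    ext a b
    simp

@[simp]
theorem lift_C (f : A →+* B) (M : Fin m → Fin n → B) (h) (a : A) :
    lift (t := t) f M h (C a) = f a := by
  change MvPolynomial.eval₂Hom f _ (MvPolynomial.C a) = f a
  simp

@[simp]
theorem lift_X (f : A →+* B) (M : Fin m → Fin n → B) (h) (i : Fin m) (j : Fin n) :
    lift (t := t) f M h (X i j) = M i j := by
  change MvPolynomial.eval₂Hom f (fun p : Fin m × Fin n => M p.1 p.2)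
    (MvPolynomial.X (i, j)) = M i j
  simp

theorem hom_ext {f g : DetRing A m n t →+* B} (h1 : f.comp C = g.comp C)
    (h2 : ∀ i j, f (X i j) = g (X i j)) : f = g := by
  refine Ideal.Quotient.ringHom_ext (MvPolynomial.ringHom_ext (fun a => ?_) fun p => h2 p.1 p.2)
  exact RingHom.congr_fun h1 a

theorem C_injective {r : ℕ} : Function.Injective (C : A →+* DetRing A m n (r + 1)) := by
  have hl : ∀ a : A, lift (t := r + 1) (m := m) (n := n) (RingHom.id A) (fun _ _ => 0)
      (fun _ _ => Matrix.det_eq_zero_of_row_eq_zero 0 fun _ => rfl) (C a) = a := fun a => by simp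
  exact Function.LeftInverse.injective hl

theorem isDomain [IsDomain A] {r : ℕ} (hr : r < n) (hm : 0 < m) :
    IsDomain (DetRing A m n (r + 1)) := by
  have := minorsIdeal_isPrime (D := A) hr hm
  exact Ideal.Quotient.isDomain _

theorem minorsIdeal_map (f : A →+* B) :
    (minorsIdeal A m n t).map (MvPolynomial.map f) = minorsIdeal B m n t := by
  have key : ∀ (α : Fin t → Fin m) (γ : Fin t → Fin n), MvPolynomial.map f
      (Matrix.of fun a b => MvPolynomial.X (α a, γ b)).det =
      (Matrix.of fun a b => MvPolynomial.X (α a, γ b)).det := fun α γ => by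
    rw [RingHom.map_det]
    congr 1
    ext a b
    simp
  rw [minorsIdeal, Ideal.map_span]
  congr 1
  ext d
  constructor
  · rintro ⟨_, ⟨α, γ, rfl⟩, rfl⟩
    exact ⟨α, γ, key α γ⟩
  · rintro ⟨α, γ, rfl⟩
    exact ⟨_, ⟨α, γ, rfl⟩, key α γ⟩

theorem prime_C [IsDomain A] {r : ℕ} (hr : r < n) (hm : 0 < m) {x : A} (hx : Prime x) :
    Prime (C x : DetRing A m n (r + 1)) := by
  let A' := A ⧸ Ideal.span {x}
  have hp : (Ideal.span {x}).IsPrime := (Ideal.span_singleton_prime hx.ne_zero).2 hx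
  have : IsDomain A' := Ideal.Quotient.isDomain _
  have : IsDomain (DetRing A' m n (r + 1)) := isDomain hr hm
  let q : A →+* A' := Ideal.Quotient.mk _
  let φ : DetRing A m n (r + 1) →+* DetRing A' m n (r + 1) :=
    lift (C.comp q) X det_X_eq_zero
  rw [← Ideal.span_singleton_prime (by
    rw [Ne, map_eq_zero_iff _ C_injective]; exact hx.ne_zero)]
  suffices Ideal.span {C x} = RingHom.ker φ by
    rw [this]; exact RingHom.ker_isPrime φ
  apply le_antisymm
  · rw [Ideal.span_singleton_le_iff_mem, RingHom.mem_ker]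
    have : q x = 0 := Ideal.Quotient.eq_zero_iff_mem.2 (Ideal.mem_span_singleton_self x)
    simp [φ, this]
  · intro f hf
    obtain ⟨f, rfl⟩ := Ideal.Quotient.mk_surjective f
    have hφ : φ.comp (Ideal.Quotient.mk _) =
        (Ideal.Quotient.mk _).comp (MvPolynomial.map q) := by
      refine MvPolynomial.ringHom_ext (fun a => ?_) fun p => ?_
      · rw [RingHom.comp_apply, RingHom.comp_apply, MvPolynomial.map_C]
        exact lift_C (C.comp q) X det_X_eq_zero a
      · rw [RingHom.comp_apply, RingHom.comp_apply, MvPolynomial.map_X]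
        exact lift_X (C.comp q) X det_X_eq_zero p.1 p.2
    have hf' : MvPolynomial.map q f ∈ (minorsIdeal A m n (r + 1)).map (MvPolynomial.map q) := by
      rw [minorsIdeal_map, ← Ideal.Quotient.eq_zero_iff_mem]
      exact (RingHom.congr_fun hφ f).symm.trans hf
    obtain ⟨i, hi, hif⟩ := (Ideal.mem_map_iff_of_surjective _
      (MvPolynomial.map_surjective q Ideal.Quotient.mk_surjective)).1 hf'
    have hker : f - i ∈ RingHom.ker (MvPolynomial.map (σ := Fin m × Fin n) q) := by
      rw [RingHom.mem_ker, map_sub, hif, sub_self]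
    rw [MvPolynomial.ker_map, Ideal.mk_ker, Ideal.map_span, Set.image_singleton,
      Ideal.mem_span_singleton'] at hker
    obtain ⟨g, hg⟩ := hker
    rw [Ideal.mem_span_singleton']
    refine ⟨Ideal.Quotient.mk _ g, ?_⟩
    have : Ideal.Quotient.mk (minorsIdeal A m n (r + 1)) i = 0 :=
      Ideal.Quotient.eq_zero_iff_mem.2 hi
    rw [eq_sub_iff_add_eq] at hg
    rw [← hg, map_add, this, add_zero, map_mul]
    rfl

theorem dualExactCyclic_of_fractionRing [IsDomain A] [IsNoetherianRing A]
    [UniqueFactorizationMonoid A] {r : ℕ} (hr : r < n) (hm : 0 < m)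
    (h : DualExactCyclic (DetRing (FractionRing A) m n (r + 1))) :
    DualExactCyclic (DetRing A m n (r + 1)) := by
  have : IsDomain (DetRing A m n (r + 1)) := isDomain hr hm
  let W : Submonoid (DetRing A m n (r + 1)) := (nonZeroDivisors A).map C
  have hW : W ≤ Submonoid.closure {x | IsUnit x ∨ Prime x} := by
    rintro _ ⟨a, ha, rfl⟩
    have ha0 : a ≠ 0 := nonZeroDivisors.ne_zero ha
    clear ha
    induction a using UniqueFactorizationMonoid.induction_on_prime with
    | h₁ => exact absurd rfl ha0
    | h₂ a hu => exact Submonoid.subset_closure (Or.inl (hu.map C))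
    | h₃ a p _ hp ih =>
      rw [map_mul]
      exact mul_mem (Submonoid.subset_closure (Or.inr (prime_C hr hm hp)))
        (ih (right_ne_zero_of_mul ha0))
  have h0 : (0 : DetRing A m n (r + 1)) ∉ W := by
    rintro ⟨a, ha, h⟩
    rw [map_eq_zero_iff _ C_injective] at h
    exact nonZeroDivisors.ne_zero ha h
  let ψ : DetRing A m n (r + 1) →+* DetRing (FractionRing A) m n (r + 1) :=
    lift (C.comp (algebraMap A (FractionRing A))) X det_X_eq_zero
  have hψ : ∀ w : W, IsUnit (ψ w) := by
    rintro ⟨_, a, ha, rfl⟩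
    have := (IsLocalization.map_units (FractionRing A) (⟨a, ha⟩ : nonZeroDivisors A)).map
      (C : FractionRing A →+* DetRing (FractionRing A) m n (r + 1))
    simpa [ψ] using this
  have hu : ∀ a : nonZeroDivisors A,
      IsUnit (((algebraMap _ (Localization W)).comp (C : A →+* DetRing A m n (r + 1))) a) :=
    fun a => IsLocalization.map_units (Localization W) (⟨C a, a, a.2, rfl⟩ : W)
  let χ : DetRing (FractionRing A) m n (r + 1) →+* Localization W :=
    lift (IsLocalization.lift (S := FractionRing A) hu)
      (fun i j => algebraMap (DetRing A m n (r + 1)) (Localization W) (X i j)) fun α γ => by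
        exact map_det_eq_zero (B := DetRing A m n (r + 1)) (B' := Localization W)
          (algebraMap (DetRing A m n (r + 1)) (Localization W)) α γ
          (det_X_eq_zero α γ)
  refine DualExactCyclic.of_isLocalization W hW (Localization W)
    (DualExactCyclic.localization_of_ringHoms W h0 ψ hψ χ ?_ ?_ h)
  · refine hom_ext (B := Localization W) ?_ fun i j => ?_
    · ext a
      simp [χ, ψ]
    · simp [χ, ψ]
  · refine hom_ext ?_ fun i j => ?_
    · refine IsLocalization.ringHom_ext (nonZeroDivisors A) ?_
      ext a
      simp [χ, ψ]
    · simp [χ, ψ]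

end DetRing

end DetRing

section Schur

theorem Matrix.det_rankOne_add_eq_zero {T : Type*} [CommRing T] {q : ℕ}
    (Y : Matrix (Fin (q + 1)) (Fin (q + 1)) T) (u w : Fin (q + 1) → T)
    (hY : ∀ α γ : Fin q → Fin (q + 1), (Matrix.of fun a b => Y (α a) (γ b)).det = 0) :
    (Matrix.of fun a b => u a * w b + Y a b).det = 0 := by
  have hY0 : Y.det = 0 := by
    rw [Matrix.det_succ_row_zero]
    refine Finset.sum_eq_zero fun b _ => ?_
    rw [show (Y.submatrix Fin.succ b.succAbove).det = 0 from hY _ _, mul_zero]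
  let B : Matrix (Fin (q + 2)) (Fin (q + 2)) T := Matrix.of <|
    Fin.cons (Fin.cons 1 w) fun a => Fin.cons (-u a) (Y a)
  let B' : Matrix (Fin (q + 2)) (Fin (q + 2)) T := Matrix.of <|
    Fin.cons (Fin.cons 1 w) fun a => Fin.cons 0 fun b => u a * w b + Y a b
  have hBB' : B'.det = B.det := by
    refine Matrix.det_eq_of_forall_row_eq_smul_add_const (Fin.cons 0 u) 0 rfl fun i j => ?_
    refine Fin.cases ?_ (fun i => ?_) i
    · simp [B, B']
    · refine Fin.cases ?_ (fun j => ?_) j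
      · simp [B, B']
      · simp [B, B']; ring
  have hB' : B'.det = (Matrix.of fun a b => u a * w b + Y a b).det := by
    rw [Matrix.det_succ_column_zero, Fin.sum_univ_succ]
    simp [B', Matrix.submatrix]
  have hB : B.det = 0 := by
    rw [Matrix.det_succ_row_zero]
    refine Finset.sum_eq_zero fun b _ => ?_
    suffices (B.submatrix Fin.succ b.succAbove).det = 0 by rw [this, mul_zero]
    refine Fin.cases ?_ (fun b => ?_) b
    · rw [← hY0]
      congr 1
    · rw [Matrix.det_succ_column_zero]
      refine Finset.sum_eq_zero fun a _ => ?_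
      rw [Matrix.submatrix_submatrix]
      suffices (B.submatrix (Fin.succ ∘ a.succAbove) (b.succ.succAbove ∘ Fin.succ)).det = 0 by
        rw [this, mul_zero]
      rw [← hY a.succAbove b.succAbove]
      congr 1
      ext i j
      simp [B, Fin.succ_succAbove_succ]
  rw [← hB', hBB', hB]

theorem Matrix.det_schur_complement {T : Type*} [CommRing T] {q : ℕ}
    (M : Matrix (Fin (q + 1)) (Fin (q + 1)) T) {v : T} (hv : M 0 0 * v = 1) :
    M 0 0 * (Matrix.of fun a b : Fin q =>
      M a.succ b.succ - M a.succ 0 * M 0 b.succ * v).det = M.det := by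
  let B : Matrix (Fin (q + 1)) (Fin (q + 1)) T := Matrix.of <|
    Fin.cons (M 0) fun a => Fin.cons 0 fun b => M a.succ b.succ - M a.succ 0 * M 0 b.succ * v
  have h1 : M.det = B.det := by
    symm
    refine Matrix.det_eq_of_forall_row_eq_smul_add_const
      (Fin.cons 0 fun a => - (M a.succ 0 * v)) 0 rfl fun i j => ?_
    refine Fin.cases ?_ (fun i => ?_) i
    · simp [B]
    · refine Fin.cases ?_ (fun j => ?_) j
      · simp only [B, Matrix.of_apply, Fin.cons_succ, Fin.cons_zero]
        linear_combination (M i.succ 0) * hv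
      · simp only [B, Matrix.of_apply, Fin.cons_succ]
        ring
  rw [h1, Matrix.det_succ_column_zero, Fin.sum_univ_succ]
  simp [B, Matrix.submatrix]

namespace DetRing

variable (K : Type) [CommRing K] (m n : ℕ)

/-- The localized polynomial ring in the entries of the initial row and column. -/
abbrev SchurBase : Type :=
  Localization.Away (MvPolynomial.X none : MvPolynomial (Option (Fin m ⊕ Fin n)) K)

variable {K m n}

/-- The image of a variable in `SchurBase`. -/
noncomputable def SchurBase.var (x : Option (Fin m ⊕ Fin n)) : SchurBase K m n :=
  algebraMap (MvPolynomial (Option (Fin m ⊕ Fin n)) K) _ (MvPolynomial.X x)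

theorem det_schurMatrix_eq_zero {T : Type*} [CommRing T] {q : ℕ} (Y : Fin m → Fin n → T)
    (hY : ∀ (α : Fin q → Fin m) (γ : Fin q → Fin n), (Matrix.of fun a b => Y (α a) (γ b)).det = 0)
    (u : Fin (m + 1) → T) (w : Fin (n + 1) → T) (α : Fin (q + 1) → Fin (m + 1))
    (γ : Fin (q + 1) → Fin (n + 1)) :
    (Matrix.of fun a b => u (α a) * w (γ b) +
      (Fin.cons (fun _ => 0) fun i => Fin.cons 0 (Y i) : Fin (m + 1) → Fin (n + 1) → T)
        (α a) (γ b)).det = 0 := by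
  refine Matrix.det_rankOne_add_eq_zero (fun a b =>
    (Fin.cons (fun _ => 0) fun i => Fin.cons 0 (Y i) : Fin (m + 1) → Fin (n + 1) → T)
      (α a) (γ b)) (fun a => u (α a)) (fun b => w (γ b)) fun α' γ' => ?_
  by_cases hα : ∃ a, α (α' a) = 0
  · obtain ⟨a, ha⟩ := hα
    exact Matrix.det_eq_zero_of_row_eq_zero a fun b => by simp [ha]
  by_cases hγ : ∃ b, γ (γ' b) = 0
  · obtain ⟨b, hb⟩ := hγ
    refine Matrix.det_eq_zero_of_column_eq_zero b fun a => ?_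
    rw [Matrix.of_apply, hb]
    refine Fin.cases ?_ (fun i => ?_) (α (α' a)) <;> simp
  push Not at hα hγ
  choose α₁ hα₁ using fun a => Fin.exists_succ_eq.2 (hα a)
  choose γ₁ hγ₁ using fun b => Fin.exists_succ_eq.2 (hγ b)
  rw [← hY α₁ γ₁]
  congr 1
  ext a b
  simp [← hα₁, ← hγ₁]

theorem dualExactCyclic_localization [IsDomain K] [IsNoetherianRing K] {r : ℕ} (hr : r < n + 1)
    (hX : (X 0 0 : DetRing K (m + 1) (n + 1) (r + 1)) ≠ 0)
    (h : DualExactCyclic (DetRing (SchurBase K m n) m n r)) :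
    DualExactCyclic (Localization
      (Submonoid.powers (X 0 0 : DetRing K (m + 1) (n + 1) (r + 1)))) := by
  have : IsDomain (DetRing K (m + 1) (n + 1) (r + 1)) := isDomain hr m.succ_pos
  let x : DetRing K (m + 1) (n + 1) (r + 1) := X 0 0
  let W : Submonoid (DetRing K (m + 1) (n + 1) (r + 1)) := Submonoid.powers x
  have h0 : (0 : DetRing K (m + 1) (n + 1) (r + 1)) ∉ W := by
    rintro ⟨N, hN⟩
    exact pow_ne_zero N hX hN
  let cv : Option (Fin m ⊕ Fin n) → DetRing (SchurBase K m n) m n r := fun p =>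
    C (SchurBase.var p)
  obtain ⟨v, hv⟩ : ∃ v : DetRing (SchurBase K m n) m n r, cv none * v = 1 :=
    ((IsLocalization.Away.algebraMap_isUnit (S := SchurBase K m n)
      (MvPolynomial.X none : MvPolynomial (Option (Fin m ⊕ Fin n)) K)).map
        (C : SchurBase K m n →+* DetRing (SchurBase K m n) m n r)).exists_right_inv
  let u : Fin (m + 1) → DetRing (SchurBase K m n) m n r :=
    Fin.cons (cv none) fun i => cv (some (Sum.inl i))
  let w : Fin (n + 1) → DetRing (SchurBase K m n) m n r :=
    Fin.cons 1 fun j => cv (some (Sum.inr j)) * v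
  let ψ : DetRing K (m + 1) (n + 1) (r + 1) →+* DetRing (SchurBase K m n) m n r := lift
    (C.comp ((algebraMap (MvPolynomial (Option (Fin m ⊕ Fin n)) K)
      (SchurBase K m n)).comp MvPolynomial.C))
    (fun i j => u i * w j +
      (Fin.cons (fun _ => 0) fun i => Fin.cons 0 (X i) :
        Fin (m + 1) → Fin (n + 1) → DetRing (SchurBase K m n) m n r) i j)
    (det_schurMatrix_eq_zero X det_X_eq_zero u w)
  have hψ00 : ψ (X 0 0) = cv none := by simp [ψ, u, w]
  have hψ0 : ∀ j : Fin n, ψ (X 0 j.succ) = cv (some (Sum.inr j)) := fun j => by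
    simp only [ψ, u, w, lift_X, Fin.cons_zero, Fin.cons_succ]
    linear_combination cv (some (Sum.inr j)) * hv
  have hψ1 : ∀ i : Fin m, ψ (X i.succ 0) = cv (some (Sum.inl i)) := fun i => by
    simp [ψ, u, w]
  have hψ2 : ∀ (i : Fin m) (j : Fin n), ψ (X i.succ j.succ) =
      cv (some (Sum.inl i)) * (cv (some (Sum.inr j)) * v) + X i j := fun i j => by
    simp [ψ, u, w]
  have hψ : ∀ w : W, IsUnit (ψ w) := by
    rintro ⟨_, N, rfl⟩
    simp only [map_pow]
    exact (hψ00 ▸ IsUnit.of_mul_eq_one v hv).pow N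
  let ι : DetRing K (m + 1) (n + 1) (r + 1) →+* Localization W :=
    algebraMap (DetRing K (m + 1) (n + 1) (r + 1)) (Localization W)
  have hxu : IsUnit (ι x) :=
    IsLocalization.map_units (Localization W) (⟨x, Submonoid.mem_powers x⟩ : W)
  obtain ⟨y, hy⟩ := hxu.exists_right_inv
  let e : MvPolynomial (Option (Fin m ⊕ Fin n)) K →+* Localization W :=
    MvPolynomial.eval₂Hom (ι.comp C)
      (Option.elim · (ι x) (Sum.elim (fun i => ι (X i.succ 0)) fun j => ι (X 0 j.succ)))
  have he : IsUnit (e (MvPolynomial.X none)) := by simpa [e] using hxu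
  let χ : DetRing (SchurBase K m n) m n r →+* Localization W := lift
    (IsLocalization.Away.lift (S := SchurBase K m n) _ he)
    (fun i j => ι (X i.succ j.succ) - ι (X i.succ 0) * ι (X 0 j.succ) * y) fun α γ => by
      have h1 := map_det_eq_zero (B := DetRing K (m + 1) (n + 1) (r + 1)) (B' := Localization W) ι
        (Fin.cons 0 fun a => (α a).succ) (Fin.cons 0 fun b => (γ b).succ) (det_X_eq_zero _ _)
      rw [← Matrix.det_schur_complement _ (v := y) (by simpa using hy)] at h1
      have h2 := (hxu.mul_right_eq_zero).1 h1
      simpa using h2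
  have hχv : ∀ p, χ (cv p) = e (MvPolynomial.X p) := fun p => by
    simp [χ, cv, SchurBase.var]
  have hχy : χ v = y := by
    have h1 := congrArg χ hv
    rw [map_mul, hχv, map_one] at h1
    have h2 : e (MvPolynomial.X none) = ι x := by simp [e]
    rw [h2] at h1
    exact hxu.mul_left_cancel (h1.trans hy.symm)
  have h1 : χ.comp ψ = algebraMap (DetRing K (m + 1) (n + 1) (r + 1)) (Localization W) := by
    refine hom_ext (B := Localization W) ?_ fun i j => ?_
    · ext a
      simp [χ, ψ, e, ι]
    · refine Fin.cases ?_ (fun i => ?_) i <;> refine Fin.cases ?_ (fun j => ?_) j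
      · rw [RingHom.comp_apply, hψ00, hχv]; simp [e, ι, x]
      · rw [RingHom.comp_apply, hψ0, hχv]; simp [e, ι]
      · rw [RingHom.comp_apply, hψ1, hχv]; simp [e, ι]
      · rw [RingHom.comp_apply, hψ2, map_add, map_mul, map_mul, hχv, hχv, hχy]
        simp only [χ, lift_X, e, MvPolynomial.eval₂Hom_X']
        simp [ι]
        ring
  refine DualExactCyclic.localization_of_ringHoms W h0 ψ hψ χ h1 ?_ h
  have hl : ∀ a, IsLocalization.lift (S := (Localization W)) hψ (ι a) = ψ a := fun a =>
    IsLocalization.lift_eq hψ a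
  have hly : IsLocalization.lift (S := (Localization W)) hψ y = v := by
    have h3 := congrArg (IsLocalization.lift (S := (Localization W)) hψ) hy
    rw [map_mul, hl, map_one, hψ00] at h3
    exact (IsUnit.of_mul_eq_one v hv).mul_left_cancel (h3.trans hv.symm)
  refine hom_ext ?_ fun i j => ?_
  · refine IsLocalization.ringHom_ext (Submonoid.powers
      (MvPolynomial.X none : MvPolynomial (Option (Fin m ⊕ Fin n)) K)) ?_
    refine MvPolynomial.ringHom_ext (fun a => ?_) fun p => ?_
    · simp [χ, e, hl]
      simp [ψ]
    · simp only [RingHom.comp_apply, RingHom.id_apply]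
      change IsLocalization.lift hψ (χ (cv p)) = cv p
      rw [hχv]
      rcases p with _ | i | j
      · simp [e, hl, x, hψ00]
      · simp [e, hl, hψ1]
      · simp [e, hl, hψ0]
  · simp only [RingHom.comp_apply, RingHom.id_apply, χ, lift_X, map_sub, map_mul, hl, hly, hψ0,
      hψ1, hψ2]
    ring

theorem dualExactCyclic_succ [IsDomain K] [IsNoetherianRing K] {r : ℕ} (hr : r < n + 1)
    (hX : Prime (X 0 0 : DetRing K (m + 1) (n + 1) (r + 1)))
    (h : DualExactCyclic (DetRing (SchurBase K m n) m n r)) :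
    DualExactCyclic (DetRing K (m + 1) (n + 1) (r + 1)) := by
  have : IsDomain (DetRing K (m + 1) (n + 1) (r + 1)) := isDomain hr m.succ_pos
  refine DualExactCyclic.of_isLocalization (Submonoid.powers (X 0 0)) ?_ _
    (dualExactCyclic_localization hr hX.ne_zero h)
  rw [Submonoid.powers_le]
  exact Submonoid.subset_closure (Or.inr hX)

end DetRing

end Schur

section SchurInduction

namespace DetRing

variable {K : Type} [CommRing K] {m n : ℕ}

theorem SchurBase.isNoetherianRing [IsNoetherianRing K] : IsNoetherianRing (SchurBase K m n) :=
  IsLocalization.isNoetherianRing (Submonoid.powers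
    (MvPolynomial.X none : MvPolynomial (Option (Fin m ⊕ Fin n)) K)) _ inferInstance

theorem SchurBase.uniqueFactorizationMonoid [IsDomain K] [UniqueFactorizationMonoid K] :
    UniqueFactorizationMonoid (SchurBase K m n) :=
  UniqueFactorizationMonoid.of_isLocalization (M := MvPolynomial (Option (Fin m ⊕ Fin n)) K)
    (Submonoid.powers (MvPolynomial.X none)) _

variable [IsDomain K]

theorem prime_X_zero_zero {r : ℕ} (hr : r < n + 1) (hr2 : 2 ≤ r) :
    Prime (X 0 0 : DetRing K (m + 1) (n + 1) (r + 1)) := by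
  have hp : (minorsIdeal K (m + 1) (n + 1) (r + 1) ⊔
      Ideal.span {MvPolynomial.X (0, 0)}).IsPrime :=
    minorsIdeal_sup_span_X_isPrime hr hr2 m.succ_pos
  have h1 := Ideal.map_isPrime_of_surjective (f := Ideal.Quotient.mk
    (minorsIdeal K (m + 1) (n + 1) (r + 1))) Ideal.Quotient.mk_surjective
    (I := minorsIdeal K (m + 1) (n + 1) (r + 1) ⊔ Ideal.span {MvPolynomial.X (0, 0)})
    (by rw [Ideal.mk_ker]; exact le_sup_left)
  rw [Ideal.map_sup, Ideal.map_quotient_self, bot_sup_eq, Ideal.map_span, Set.image_singleton] at h1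
  refine (Ideal.span_singleton_prime fun h0 => ?_).1 h1
  have h2 := Ideal.Quotient.eq_zero_iff_mem.1 h0
  rw [minorsIdeal_eq_ker hr (by omega) m.succ_pos] at h2
  exact X_notMem_ker (D := K) (ρ := fun j => min j r) (0 : Fin (m + 1)) (0 : Fin (n + 1))
    (by simp; omega) h2

theorem powers_X_le_nonZeroDivisors : Submonoid.powers
    (MvPolynomial.X none : MvPolynomial (Option (Fin m ⊕ Fin n)) K) ≤ nonZeroDivisors _ :=
  powers_le_nonZeroDivisors_of_noZeroDivisors (MvPolynomial.X_ne_zero _)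

theorem SchurBase.isDomain : IsDomain (SchurBase K m n) :=
  IsLocalization.isDomain_localization powers_X_le_nonZeroDivisors

theorem dualExactCyclic_one (K : Type) [Field K] (m n : ℕ) :
    DualExactCyclic (DetRing K m n 1) := by
  let e : DetRing K m n 1 ≃+* K :=
    (Ideal.quotEquivOfEq minorsIdeal_one_eq_ker).trans
      (RingHom.quotientKerEquivOfSurjective fun a => ⟨MvPolynomial.C a, by simp⟩)
  have : IsDomain (DetRing K m n 1) := e.toMulEquiv.isDomain K
  exact DualExactCyclic.of_ringEquiv e (DualExactCyclic.of_field K)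

/-- Reduction of the cyclicity of dual exact modules over determinantal rings of square matrices
to rank one. -/
theorem dualExactCyclic_of_rankOne
    (hS : ∀ (K : Type) [Field K] (n : ℕ), 1 < n → DualExactCyclic (DetRing K n n 2)) (r : ℕ) :
    ∀ (A : Type) [CommRing A] [IsDomain A] [IsNoetherianRing A] [UniqueFactorizationMonoid A]
      (n : ℕ), r < n → DualExactCyclic (DetRing A n n (r + 1)) := by
  induction r with
  | zero =>
    intro A _ _ _ _ n hn
    exact dualExactCyclic_of_fractionRing hn hn (dualExactCyclic_one _ _ _)
  | succ r ih =>
    intro A _ _ _ _ n hn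
    refine dualExactCyclic_of_fractionRing hn (by omega) ?_
    rcases Nat.eq_zero_or_pos r with rfl | hr
    · exact hS _ _ hn
    · obtain ⟨n, rfl⟩ : ∃ n', n = n' + 1 := ⟨n - 1, by omega⟩
      have := SchurBase.isDomain (K := FractionRing A) (m := n) (n := n)
      have := SchurBase.isNoetherianRing (K := FractionRing A) (m := n) (n := n)
      have := SchurBase.uniqueFactorizationMonoid (K := FractionRing A) (m := n) (n := n)
      exact dualExactCyclic_succ hn (prime_X_zero_zero hn (by omega)) (ih _ _ (by omega))

end DetRing

end SchurInduction

section DedekindMertens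

variable {A : Type*} [CommRing A]

/-- The coefficients of a product of power series. -/
def convCoeff (x y : ℕ → A) (s : ℕ) : A :=
  ∑ p ∈ Finset.HasAntidiagonal.antidiagonal s, x p.1 * y p.2

theorem convCoeff_comm (x y : ℕ → A) : convCoeff x y = convCoeff y x := by
  funext s
  rw [convCoeff, convCoeff, ← Finset.Nat.sum_antidiagonal_swap]
  exact Finset.sum_congr rfl fun p _ => mul_comm _ _

theorem convCoeff_sub_mem (x x' y : ℕ → A) (X : Ideal A) (hX : ∀ i, x i - x' i ∈ X) (s : ℕ) :
    convCoeff x y s - convCoeff x' y s ∈ X * Ideal.span (Set.range y) := by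
  rw [convCoeff, convCoeff, ← Finset.sum_sub_distrib]
  refine Ideal.sum_mem _ fun p _ => ?_
  rw [← sub_mul]
  exact Ideal.mul_mem_mul (hX _) (Ideal.subset_span ⟨_, rfl⟩)

theorem span_convCoeff_le (x x' y : ℕ → A) (X : Ideal A) (hX : ∀ i, x i - x' i ∈ X) :
    Ideal.span (Set.range (convCoeff x' y)) ≤
      Ideal.span (Set.range (convCoeff x y)) + X * Ideal.span (Set.range y) := by
  refine Ideal.span_le.2 ?_
  rintro _ ⟨s, rfl⟩
  rw [show convCoeff x' y s = convCoeff x y s - (convCoeff x y s - convCoeff x' y s) by ring]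
  exact sub_mem (Submodule.mem_sup_left (Ideal.subset_span ⟨s, rfl⟩))
    (Submodule.mem_sup_right (convCoeff_sub_mem x x' y X hX s))

theorem dedekindMertens_step {S : Type*} [IdemCommSemiring S] {c c' d d' X Y t u v : S} {q : ℕ}
    (hc : c ≤ c' + X) (hc' : c' ≤ c) (hX : X ≤ c) (hd : d ≤ d' + Y)
    (hXY : X * Y ≤ t) (hu : u ≤ t + X * d) (hv : v ≤ t + Y * c)
    (h1 : c ^ (q + 1) * d' ≤ c ^ q * v) (h2 : c' ^ (q + 2) * d ≤ c' ^ (q + 1) * u) :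
    c ^ (q + 2) * d ≤ c ^ (q + 1) * t := by
  have e1 : c ^ (q + 1) * d' ≤ c ^ q * t + c ^ (q + 1) * Y :=
    calc c ^ (q + 1) * d' ≤ c ^ q * (t + Y * c) := h1.trans (by gcongr)
      _ = c ^ q * t + c ^ (q + 1) * Y := by ring
  have e2 : c ^ (q + 1) * X * d ≤ c ^ (q + 1) * t :=
    calc c ^ (q + 1) * X * d ≤ c ^ (q + 1) * X * (d' + Y) := by gcongr
      _ = X * (c ^ (q + 1) * d') + c ^ (q + 1) * (X * Y) := by ring
      _ ≤ X * (c ^ q * t + c ^ (q + 1) * Y) + c ^ (q + 1) * (X * Y) := by gcongr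
      _ = X * (c ^ q * t) + (c ^ (q + 1) * (X * Y) + c ^ (q + 1) * (X * Y)) := by ring
      _ ≤ c * (c ^ q * t) + (c ^ (q + 1) * t + c ^ (q + 1) * t) := by gcongr
      _ = c ^ (q + 1) * t := by
        rw [add_idem, ← mul_assoc, ← pow_succ', add_idem]
  have e3 : ∀ k, c ^ (k + 1) ≤ c' ^ (k + 1) + X * c ^ k := fun k => by
    induction k with
    | zero => simpa using hc
    | succ k ih =>
      calc c ^ (k + 2) = c * c ^ (k + 1) := by ring
        _ ≤ (c' + X) * c ^ (k + 1) := by gcongr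
        _ = c' * c ^ (k + 1) + X * c ^ (k + 1) := by ring
        _ ≤ c' * (c' ^ (k + 1) + X * c ^ k) + X * c ^ (k + 1) := by gcongr
        _ = c' ^ (k + 2) + (X * (c' * c ^ k) + X * c ^ (k + 1)) := by ring
        _ ≤ c' ^ (k + 2) + (X * (c * c ^ k) + X * c ^ (k + 1)) := by gcongr
        _ = c' ^ (k + 2) + X * c ^ (k + 1) := by rw [← pow_succ', add_idem]
  have e4 : c' ^ (q + 2) * d ≤ c ^ (q + 1) * t :=
    calc c' ^ (q + 2) * d ≤ c' ^ (q + 1) * (t + X * d) := h2.trans (by gcongr)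
      _ ≤ c ^ (q + 1) * (t + X * d) := by gcongr
      _ = c ^ (q + 1) * t + c ^ (q + 1) * X * d := by ring
      _ ≤ c ^ (q + 1) * t + c ^ (q + 1) * t := by gcongr
      _ = c ^ (q + 1) * t := add_idem _
  calc c ^ (q + 2) * d ≤ (c' ^ (q + 2) + X * c ^ (q + 1)) * d := by gcongr; exact e3 _
    _ = c' ^ (q + 2) * d + c ^ (q + 1) * X * d := by ring
    _ ≤ c ^ (q + 1) * t + c ^ (q + 1) * t := by gcongr
    _ = c ^ (q + 1) * t := add_idem _

theorem sub_ite_mem_span (x : ℕ → A) {p : ℕ} (hx : ∀ i, p + 1 ≤ i → x i = 0) (i : ℕ) :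
    x i - (if i < p then x i else 0) ∈ Ideal.span {x p} := by
  split_ifs with h
  · simp
  · rcases (not_lt.1 h).eq_or_lt with rfl | h
    · simp
    · simp [hx i h]

theorem span_range_ite_le (x : ℕ → A) (p : ℕ) :
    Ideal.span (Set.range fun i => if i < p then x i else 0) ≤ Ideal.span (Set.range x) := by
  refine Ideal.span_le.2 ?_
  rintro _ ⟨i, rfl⟩
  dsimp only
  split_ifs
  · exact Ideal.subset_span ⟨i, rfl⟩
  · exact zero_mem _

theorem span_range_le_add (x : ℕ → A) {p : ℕ} (hx : ∀ i, p + 1 ≤ i → x i = 0) :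
    Ideal.span (Set.range x) ≤
      Ideal.span (Set.range fun i => if i < p then x i else 0) + Ideal.span {x p} := by
  refine Ideal.span_le.2 ?_
  rintro _ ⟨i, rfl⟩
  have h := sub_ite_mem_span x hx i
  rw [show x i = (if i < p then x i else 0) + (x i - (if i < p then x i else 0)) by ring]
  exact add_mem (Submodule.mem_sup_left (Ideal.subset_span ⟨i, rfl⟩)) (Submodule.mem_sup_right h)

/-- The Dedekind–Mertens lemma. -/
theorem dedekindMertens (q : ℕ) : ∀ (p : ℕ) (x y : ℕ → A), (∀ i, p ≤ i → x i = 0) →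
    (∀ i, q + 1 ≤ i → y i = 0) →
    Ideal.span (Set.range x) ^ (q + 1) * Ideal.span (Set.range y) ≤
      Ideal.span (Set.range x) ^ q * Ideal.span (Set.range (convCoeff x y)) := by
  induction q with
  | zero =>
    intro p x y _ hy
    rw [zero_add, pow_one, pow_zero, one_mul, Ideal.span_mul_span', Ideal.span_le]
    rintro _ ⟨_, ⟨i, rfl⟩, _, ⟨j, rfl⟩, rfl⟩
    dsimp only
    rcases j with _ | j
    · refine Ideal.subset_span ⟨i, ?_⟩
      rw [convCoeff, Finset.sum_eq_single (i, 0)]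
      · rintro ⟨a, b⟩ hab hne
        rw [Finset.HasAntidiagonal.mem_antidiagonal] at hab
        rcases b with _ | b
        · simp at hab; simp [hab] at hne
        · rw [hy _ (by simp), mul_zero]
      · simp
    · rw [hy _ (by simp), mul_zero]
      exact zero_mem _
  | succ q ihq =>
    intro p
    induction p with
    | zero =>
      intro x y hx _
      have : Ideal.span (Set.range x) ≤ ⊥ := by
        refine Ideal.span_le.2 ?_
        rintro _ ⟨i, rfl⟩
        exact hx i (Nat.zero_le i)
      rw [le_bot_iff.1 this]
      simp
    | succ p ihp =>
      intro x y hx hy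
      refine dedekindMertens_step (span_range_le_add x hx) (span_range_ite_le x p)
        (Ideal.span_mono (by rintro _ rfl; exact ⟨p, rfl⟩))
        (span_range_le_add y hy) ?_ (span_convCoeff_le x _ y _ (sub_ite_mem_span x hx)) ?_
        (ihq (p + 1) x _ hx fun i hi => if_neg (by omega))
        (ihp _ y (fun i hi => if_neg (by omega)) hy)
      · rw [Ideal.span_singleton_mul_span_singleton, Ideal.span_singleton_le_iff_mem]
        refine Ideal.subset_span ⟨p + (q + 1), ?_⟩
        rw [convCoeff, Finset.sum_eq_single (p, q + 1)]
        · rintro ⟨a, b⟩ hab hne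
          rw [Finset.HasAntidiagonal.mem_antidiagonal] at hab
          dsimp only at hab ⊢
          rcases lt_trichotomy a p with h | rfl | h
          · rw [hy _ (by omega), mul_zero]
          · simp at hab; simp [hab] at hne
          · rw [hx _ h, zero_mul]
        · simp
      · rw [convCoeff_comm x, convCoeff_comm x]
        exact span_convCoeff_le y _ x _ (sub_ite_mem_span y hy)

end DedekindMertens

section SegreSystem

variable {B : Type*} [CommRing B]

/-- The ideal generated by the first `a` terms of `x` and the first `b` terms of `y`. -/
def initIdeal (x y : ℕ → B) (a b : ℕ) : Ideal B :=
  Ideal.span ({f | ∃ i < a, f = x i} ∪ {f | ∃ i < b, f = y i})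

/-- The ideal generated by `initIdeal x y a b` and the coefficients of the product of `x` and `y`
in degrees from `a + b` to `s - 1`. -/
def convIdeal (x y : ℕ → B) (a b s : ℕ) : Ideal B :=
  initIdeal x y a b ⊔ Ideal.span {f | ∃ t, a + b ≤ t ∧ t < s ∧ f = convCoeff x y t}

theorem initIdeal_swap (x y : ℕ → B) (a b : ℕ) : initIdeal y x b a = initIdeal x y a b := by
  rw [initIdeal, initIdeal, Set.union_comm]

theorem convIdeal_swap (x y : ℕ → B) (a b s : ℕ) : convIdeal y x b a s = convIdeal x y a b s := by
  rw [convIdeal, convIdeal, initIdeal_swap, convCoeff_comm, add_comm]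

theorem mem_initIdeal_left {x y : ℕ → B} {a b i : ℕ} (h : i < a) : x i ∈ initIdeal x y a b :=
  Ideal.subset_span (Or.inl ⟨i, h, rfl⟩)

theorem mem_initIdeal_right {x y : ℕ → B} {a b i : ℕ} (h : i < b) : y i ∈ initIdeal x y a b :=
  Ideal.subset_span (Or.inr ⟨i, h, rfl⟩)

theorem initIdeal_mono {x y : ℕ → B} {a b a' b' : ℕ} (ha : a ≤ a') (hb : b ≤ b') :
    initIdeal x y a b ≤ initIdeal x y a' b' := by
  refine Ideal.span_le.2 ?_
  rintro _ (⟨i, hi, rfl⟩ | ⟨i, hi, rfl⟩)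
  · exact mem_initIdeal_left (by omega)
  · exact mem_initIdeal_right (by omega)

theorem initIdeal_le_convIdeal {x y : ℕ → B} {a b s : ℕ} :
    initIdeal x y a b ≤ convIdeal x y a b s := le_sup_left

theorem convCoeff_mem_convIdeal {x y : ℕ → B} {a b s t : ℕ} (h : a + b ≤ t) (hts : t < s) :
    convCoeff x y t ∈ convIdeal x y a b s :=
  Submodule.mem_sup_right (Ideal.subset_span ⟨t, h, hts, rfl⟩)

theorem convIdeal_self (x y : ℕ → B) (a b : ℕ) :
    convIdeal x y a b (a + b) = initIdeal x y a b := by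
  rw [convIdeal, sup_eq_left, Ideal.span_le]
  rintro _ ⟨t, h1, h2, rfl⟩
  omega

theorem convIdeal_mono {x y : ℕ → B} {a b s s' : ℕ} (h : s ≤ s') :
    convIdeal x y a b s ≤ convIdeal x y a b s' := by
  refine sup_le initIdeal_le_convIdeal (Ideal.span_le.2 ?_)
  rintro _ ⟨t, h1, h2, rfl⟩
  exact convCoeff_mem_convIdeal h1 (by omega)

theorem exists_of_mem_convIdeal_succ {x y : ℕ → B} {a b s : ℕ} {f : B}
    (hf : f ∈ convIdeal x y a b (s + 1)) : ∃ g ∈ convIdeal x y a b s, ∃ q,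
      f = g + convCoeff x y s * q := by
  have h : convIdeal x y a b (s + 1) ≤ convIdeal x y a b s ⊔ Ideal.span {convCoeff x y s} := by
    refine sup_le (initIdeal_le_convIdeal.trans le_sup_left) (Ideal.span_le.2 ?_)
    rintro _ ⟨t, h1, h2, rfl⟩
    rcases (Nat.lt_succ_iff.1 h2).eq_or_lt with rfl | h3
    · exact Submodule.mem_sup_right (Ideal.mem_span_singleton_self _)
    · exact Submodule.mem_sup_left (convCoeff_mem_convIdeal h1 h3)
  obtain ⟨g, hg, q, hq, rfl⟩ := Submodule.mem_sup.1 (h hf)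
  obtain ⟨q, rfl⟩ := Ideal.mem_span_singleton'.1 hq
  exact ⟨g, hg, q, by ring⟩

theorem convCoeff_sub_mem_initIdeal (x y : ℕ → B) (a b : ℕ) :
    convCoeff x y (a + b) - x a * y b ∈ initIdeal x y a b := by
  have h : (a, b) ∈ Finset.HasAntidiagonal.antidiagonal (a + b) := by simp
  rw [convCoeff, ← Finset.add_sum_erase _ _ h, add_sub_cancel_left]
  refine Ideal.sum_mem _ fun p hp => ?_
  rw [Finset.mem_erase, Finset.HasAntidiagonal.mem_antidiagonal] at hp
  rcases lt_or_ge p.1 a with h1 | h1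
  · exact Ideal.mul_mem_right _ _ (mem_initIdeal_left h1)
  · refine Ideal.mul_mem_left _ _ (mem_initIdeal_right ?_)
    by_contra h2
    exact hp.1 (Prod.ext (by simp; omega) (by simp; omega))

theorem convCoeff_mem_initIdeal_succ (x y : ℕ → B) (a b : ℕ) :
    convCoeff x y (a + b) ∈ initIdeal x y (a + 1) b := by
  rw [show convCoeff x y (a + b) = (convCoeff x y (a + b) - x a * y b) + x a * y b by ring]
  exact add_mem (initIdeal_mono a.le_succ le_rfl (convCoeff_sub_mem_initIdeal x y a b))
    (Ideal.mul_mem_right _ _ (mem_initIdeal_left a.lt_succ_self))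

theorem convIdeal_le_succ (x y : ℕ → B) (a b s : ℕ) :
    convIdeal x y a b s ≤ convIdeal x y (a + 1) b s := by
  refine sup_le ((initIdeal_mono a.le_succ le_rfl).trans initIdeal_le_convIdeal)
    (Ideal.span_le.2 ?_)
  rintro _ ⟨t, h1, h2, rfl⟩
  rcases h1.eq_or_lt with rfl | h1
  · exact initIdeal_le_convIdeal (convCoeff_mem_initIdeal_succ x y a b)
  · exact convCoeff_mem_convIdeal (by omega) h2

theorem exists_of_mem_convIdeal_left_succ {x y : ℕ → B} {a b s : ℕ} {f : B}
    (hf : f ∈ convIdeal x y (a + 1) b s) : ∃ g ∈ convIdeal x y a b s, ∃ q, f = g + x a * q := by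
  have h : convIdeal x y (a + 1) b s ≤ convIdeal x y a b s ⊔ Ideal.span {x a} := by
    refine sup_le (Ideal.span_le.2 ?_) (Ideal.span_le.2 ?_)
    · rintro _ (⟨i, hi, rfl⟩ | ⟨i, hi, rfl⟩)
      · rcases (Nat.lt_succ_iff.1 hi).eq_or_lt with rfl | h3
        · exact Submodule.mem_sup_right (Ideal.mem_span_singleton_self _)
        · exact Submodule.mem_sup_left (initIdeal_le_convIdeal (mem_initIdeal_left h3))
      · exact Submodule.mem_sup_left (initIdeal_le_convIdeal (mem_initIdeal_right hi))
    · rintro _ ⟨t, h1, h2, rfl⟩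
      exact Submodule.mem_sup_left (convCoeff_mem_convIdeal (by omega) h2)
  obtain ⟨g, hg, q, hq, rfl⟩ := Submodule.mem_sup.1 (h hf)
  obtain ⟨q, rfl⟩ := Ideal.mem_span_singleton'.1 hq
  exact ⟨g, hg, q, by ring⟩

theorem mul_mem_convIdeal {x y : ℕ → B} {a b s : ℕ} (hs : a + b < s) {u : B}
    (hu : u ∈ convIdeal x y a (b + 1) s) : x a * u ∈ convIdeal x y a b s := by
  rw [← convIdeal_swap] at hu
  obtain ⟨g, hg, q, rfl⟩ := exists_of_mem_convIdeal_left_succ hu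
  rw [convIdeal_swap] at hg
  rw [show x a * (g + y b * q) = x a * g + (convCoeff x y (a + b) * q -
    (convCoeff x y (a + b) - x a * y b) * q) by ring]
  exact add_mem (Ideal.mul_mem_left _ _ hg) (sub_mem
    (Ideal.mul_mem_right _ _ (convCoeff_mem_convIdeal le_rfl hs))
    (Ideal.mul_mem_right _ _ (initIdeal_le_convIdeal (convCoeff_sub_mem_initIdeal x y a b))))

/-- Sequences behaving like the variables of a polynomial ring `k[x₀, …, y₀, …]`, where `π j` is
the projection onto the part of weight `j` when all `x i` have weight `1` and all `y i` have
weight `-1`. -/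
structure SegreSystem (N : ℕ) (x y : ℕ → B) (π : ℤ → B →+ B) : Prop where
  mul_x : ∀ i j f, π j (x i * f) = x i * π (j - 1) f
  mul_y : ∀ i j f, π j (y i * f) = y i * π (j + 1) f
  idem : ∀ j f, π j (π j f) = π j f
  one : π 0 1 = 1
  cancel_x : ∀ a < N, ∀ b ≤ N, ∀ u, x a * u ∈ initIdeal x y a b → u ∈ initIdeal x y a b
  cancel_y : ∀ a ≤ N, ∀ b < N, ∀ u, y b * u ∈ initIdeal x y a b → u ∈ initIdeal x y a b
  mem_of_pos : ∀ j > 0, ∀ f, π j f = f → f ∈ initIdeal x y N 0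
  mem_of_neg : ∀ j < 0, ∀ f, π j f = f → f ∈ initIdeal x y 0 N
  one_notMem : 1 ∉ initIdeal x y N N
  x_eq_zero : ∀ i ≥ N, x i = 0
  y_eq_zero : ∀ i ≥ N, y i = 0

/-- Regularity of a coefficient of the product on a strand. -/
def StrandRegular (x y : ℕ → B) (π : ℤ → B →+ B) (a b : ℕ) (j : ℤ) (s : ℕ) : Prop :=
  ∀ f, π j f = f → convCoeff x y s * f ∈ convIdeal x y a b s → f ∈ convIdeal x y a b s

theorem strandRegular_swap {x y : ℕ → B} {π : ℤ → B →+ B} {a b : ℕ} {j : ℤ} {s : ℕ} :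
    StrandRegular y x (fun j => π (-j)) b a (-j) s ↔ StrandRegular x y π a b j s := by
  simp only [StrandRegular, neg_neg, convIdeal_swap, convCoeff_comm y x]

namespace SegreSystem

variable {N : ℕ} {x y : ℕ → B} {π : ℤ → B →+ B}

theorem swap (h : SegreSystem N x y π) : SegreSystem N y x fun j => π (-j) where
  mul_x i j f := by rw [h.mul_y]; congr 2; ring_nf
  mul_y i j f := by rw [h.mul_x]; congr 2; ring_nf
  idem j f := h.idem _ _
  one := by rw [neg_zero, h.one]
  cancel_x a ha b hb u hu := by rw [initIdeal_swap] at *; exact h.cancel_y b hb a ha u hu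
  cancel_y a ha b hb u hu := by rw [initIdeal_swap] at *; exact h.cancel_x b hb a ha u hu
  mem_of_pos j hj f hf := by
    rw [initIdeal_swap]; exact h.mem_of_neg (-j) (by omega) f hf
  mem_of_neg j hj f hf := by
    rw [initIdeal_swap]; exact h.mem_of_pos (-j) (by omega) f hf
  one_notMem := by rw [initIdeal_swap]; exact h.one_notMem
  x_eq_zero := h.y_eq_zero
  y_eq_zero := h.x_eq_zero

theorem mul_convCoeff (h : SegreSystem N x y π) (j : ℤ) (s : ℕ) (f : B) :
    π j (convCoeff x y s * f) = convCoeff x y s * π j f := by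
  rw [convCoeff, Finset.sum_mul, map_sum, Finset.sum_mul]
  refine Finset.sum_congr rfl fun p _ => ?_
  rw [mul_assoc, h.mul_x, h.mul_y, sub_add_cancel, mul_assoc]

theorem map_mul_mem {I : Set B} (hI : ∀ g ∈ I, ∀ c j, π j (c * g) ∈ Ideal.span I) {f : B}
    (hf : f ∈ Ideal.span I) (c : B) (j : ℤ) : π j (c * f) ∈ Ideal.span I := by
  induction hf using Submodule.span_induction generalizing c with
  | mem g hg => exact hI g hg c j
  | zero => rw [mul_zero, map_zero]; exact zero_mem _
  | add f g _ _ hf hg => rw [mul_add, map_add]; exact add_mem (hf c) (hg c)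
  | smul a g hg ih => rw [smul_eq_mul, ← mul_assoc]; exact ih _

theorem map_mem_convIdeal (h : SegreSystem N x y π) {a b s : ℕ} {f : B}
    (hf : f ∈ convIdeal x y a b s) (j : ℤ) : π j f ∈ convIdeal x y a b s := by
  rw [convIdeal, initIdeal, ← Ideal.span_union] at *
  rw [← one_mul f]
  refine map_mul_mem ?_ hf 1 j
  intro g hg c j
  suffices ∃ c', π j (c * g) = c' * g by
    obtain ⟨c', hc⟩ := this
    exact hc ▸ Ideal.mul_mem_left _ _ (Ideal.subset_span hg)
  rcases hg with (⟨i, -, rfl⟩ | ⟨i, -, rfl⟩) | ⟨t, -, -, rfl⟩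
  · exact ⟨π (j - 1) c, by rw [mul_comm, h.mul_x, mul_comm]⟩
  · exact ⟨π (j + 1) c, by rw [mul_comm, h.mul_y, mul_comm]⟩
  · exact ⟨π j c, by rw [mul_comm, h.mul_convCoeff, mul_comm]⟩

theorem mem_convIdeal_of_mul_mem (h : SegreSystem N x y π) {a b : ℕ} (ha : a < N) (hb : b < N)
    (j : ℤ) {s : ℕ} (hs : a + b + 1 ≤ s)
    (hr : ∀ t, a + b < t → t < s → StrandRegular x y π (a + 1) b j t) {u : B}
    (hu : π (j - 1) u = u) (hm : x a * u ∈ convIdeal x y a b s) :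
    u ∈ convIdeal x y a (b + 1) s := by
  induction s, hs using Nat.le_induction generalizing u with
  | base =>
    obtain ⟨g, hg, q, hq⟩ := exists_of_mem_convIdeal_succ hm
    rw [convIdeal_self] at hg
    have h1 : u - y b * q ∈ initIdeal x y a b := by
      refine h.cancel_x a ha b hb.le _ ?_
      rw [show x a * (u - y b * q) = g + (convCoeff x y (a + b) - x a * y b) * q by
        rw [mul_sub, hq]; ring]
      exact add_mem hg (Ideal.mul_mem_right _ _ (convCoeff_sub_mem_initIdeal x y a b))
    refine initIdeal_le_convIdeal ?_
    rw [← sub_add_cancel u (y b * q)]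
    exact add_mem (initIdeal_mono le_rfl b.le_succ h1)
      (Ideal.mul_mem_right _ _ (mem_initIdeal_right b.lt_succ_self))
  | succ s hs ih =>
    obtain ⟨g, hg, q, hq⟩ := exists_of_mem_convIdeal_succ hm
    have hq' : x a * u = π j g + convCoeff x y s * π j q := by
      rw [← h.mul_convCoeff, ← map_add, ← hq, h.mul_x, hu]
    have h1 : π j q ∈ convIdeal x y (a + 1) b s := by
      refine hr s hs s.lt_succ_self _ (h.idem _ _) ?_
      rw [show convCoeff x y s * π j q = x a * u - π j g by rw [hq']; ring]
      exact sub_mem (Ideal.mul_mem_right _ _ (initIdeal_le_convIdeal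
        (mem_initIdeal_left a.lt_succ_self)))
        (convIdeal_le_succ _ _ _ _ _ (h.map_mem_convIdeal hg j))
    obtain ⟨i, hi, v, hv⟩ := exists_of_mem_convIdeal_left_succ h1
    have hv' : π j q = π j i + x a * π (j - 1) v := by
      rw [← h.mul_x, ← map_add, ← hv, h.idem]
    have h2 : u - convCoeff x y s * π (j - 1) v ∈ convIdeal x y a (b + 1) s := by
      refine ih (fun t h1 h2 => hr t h1 (by omega)) ?_ ?_
      · rw [map_sub, h.mul_convCoeff, hu, h.idem]
      · rw [show x a * (u - convCoeff x y s * π (j - 1) v) = π j g + convCoeff x y s * π j i by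
          rw [mul_sub, hq', hv']; ring]
        exact add_mem (h.map_mem_convIdeal hg j)
          (Ideal.mul_mem_left _ _ (h.map_mem_convIdeal hi j))
    rw [← sub_add_cancel u (convCoeff x y s * π (j - 1) v)]
    exact add_mem (convIdeal_mono s.le_succ h2)
      (Ideal.mul_mem_right _ _ (convCoeff_mem_convIdeal (by omega) s.lt_succ_self))

theorem strandRegular_of_succ (h : SegreSystem N x y π) {a b : ℕ} (ha : a < N) (hb : b < N)
    {j : ℤ} {s : ℕ} (hs : a + b < s)
    (hr : ∀ t, a + b < t → t ≤ s → StrandRegular x y π (a + 1) b j t)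
    (hr' : StrandRegular x y π a (b + 1) (j - 1) s) : StrandRegular x y π a b j s := by
  intro f hf hm
  obtain ⟨g, hg, v, hv⟩ := exists_of_mem_convIdeal_left_succ
    (hr s hs le_rfl f hf (convIdeal_le_succ _ _ _ _ _ hm))
  have hv' : f = π j g + x a * π (j - 1) v := by rw [← h.mul_x, ← map_add, ← hv, hf]
  have hg' := h.map_mem_convIdeal hg j
  have h1 : convCoeff x y s * π (j - 1) v ∈ convIdeal x y a (b + 1) s := by
    refine h.mem_convIdeal_of_mul_mem ha hb j hs (fun t h1 h2 => hr t h1 h2.le) ?_ ?_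
    · rw [h.mul_convCoeff, h.idem]
    · rw [show x a * (convCoeff x y s * π (j - 1) v) =
        convCoeff x y s * f - convCoeff x y s * π j g by rw [hv']; ring]
      exact sub_mem hm (Ideal.mul_mem_left _ _ hg')
  rw [hv']
  exact add_mem hg' (mul_mem_convIdeal hs (hr' _ (h.idem _ _) h1))

/-- The coefficients of the product form a regular sequence on the strands of weight close
to zero. -/
theorem strandRegular (c : ℕ) {x y : ℕ → B} {π : ℤ → B →+ B} (h : SegreSystem N x y π) (a b : ℕ)
    (ha : a ≤ N) (hb : b ≤ N) (hc : (N - a) + (N - b) = c) (j : ℤ) (hj : (a : ℤ) - N < j)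
    (hj' : j < (N : ℤ) - b) (s : ℕ) (hs : a + b ≤ s) (hsN : s + 2 ≤ 2 * N) :
    StrandRegular x y π a b j s := by
  induction c using Nat.strong_induction_on generalizing x y π a b j s with
  | _ c ih =>
    rcases ha.eq_or_lt with rfl | ha
    · intro f hf _
      exact initIdeal_le_convIdeal (initIdeal_mono le_rfl b.zero_le
        (h.mem_of_pos j (by omega) f hf))
    rcases hb.eq_or_lt with rfl | hb
    · intro f hf _
      exact initIdeal_le_convIdeal (initIdeal_mono a.zero_le le_rfl
        (h.mem_of_neg j (by omega) f hf))
    rcases hs.eq_or_lt with rfl | hs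
    · intro f hf hm
      rw [convIdeal_self] at *
      refine h.cancel_y a ha.le b hb _ (h.cancel_x a ha b hb.le _ ?_)
      rw [show x a * (y b * f) = convCoeff x y (a + b) * f -
        (convCoeff x y (a + b) - x a * y b) * f by ring]
      exact sub_mem hm (Ideal.mul_mem_right _ _ (convCoeff_sub_mem_initIdeal x y a b))
    by_cases h1 : (a : ℤ) + 2 - N ≤ j
    · refine h.strandRegular_of_succ ha hb hs (fun t h2 h3 => ?_) ?_
      · exact ih _ (by omega) h _ _ (by omega) (by omega) rfl _ (by push_cast; omega) (by omega) _
          (by omega) (by omega)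
      · exact ih _ (by omega) h _ _ (by omega) (by omega) rfl _ (by omega) (by push_cast; omega) _
          (by omega) (by omega)
    · rw [← strandRegular_swap]
      refine h.swap.strandRegular_of_succ hb ha (by omega) (fun t h2 h3 => ?_) ?_
      · exact ih _ (by omega) h.swap _ _ (by omega) (by omega) rfl _ (by push_cast; omega)
          (by omega) _ (by omega) (by omega)
      · exact ih _ (by omega) h.swap _ _ (by omega) (by omega) rfl _ (by omega)
          (by push_cast; omega) _ (by omega) (by omega)

theorem mem_of_mem_convIdeal (h : SegreSystem N x y π) {s : ℕ} {j : ℤ} (P : AddSubgroup B)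
    (hP : ∀ t < s, ∀ f, π j f = f → convCoeff x y t * f ∈ P) {f : B} (hf : π j f = f)
    (hm : f ∈ convIdeal x y 0 0 s) : f ∈ P := by
  induction s generalizing f with
  | zero =>
    have h0 : convIdeal x y 0 0 0 = ⊥ := by
      rw [convIdeal, initIdeal]
      simp
    rw [h0, Ideal.mem_bot] at hm
    exact hm ▸ zero_mem _
  | succ s ih =>
    obtain ⟨g, hg, q, hq⟩ := exists_of_mem_convIdeal_succ hm
    rw [← hf, hq, map_add, h.mul_convCoeff]
    exact add_mem (ih (fun t ht => hP t (by omega)) (h.idem _ _) (h.map_mem_convIdeal hg j))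
      (hP s s.lt_succ_self _ (h.idem _ _))

/-- An element of weight zero that is not in the ideal of the coefficients of the product. -/
def prodElem (N : ℕ) (x y : ℕ → B) (i : ℕ) : B :=
  ∏ k ∈ Finset.Ico i (N - 1), x k * y (k + 1)

theorem map_prodElem (h : SegreSystem N x y π) (i : ℕ) :
    π 0 (prodElem N x y i) = prodElem N x y i := by
  rw [prodElem]
  refine Finset.prod_induction _ (fun f => ∀ g, π 0 g = g → π 0 (f * g) = f * g) ?_ ?_ ?_ 1
    h.one |> fun h1 => by simpa using h1
  · intro f g hf hg u hu
    rw [mul_assoc, hf _ (hg _ hu)]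
  · intro g hg
    rw [one_mul, hg]
  · intro k _ g hg
    rw [mul_assoc, h.mul_x, h.mul_y, sub_add_cancel, hg]

theorem prodElem_notMem (h : SegreSystem N x y π) {i : ℕ} (hi : i + 1 ≤ N) :
    prodElem N x y i ∉ convIdeal x y i i (2 * N - 1) := by
  obtain ⟨d, rfl⟩ := Nat.exists_eq_add_of_le hi
  induction d generalizing i with
  | zero =>
    intro hm
    rw [prodElem, Finset.Ico_eq_empty (by omega), Finset.prod_empty,
      show 2 * (i + 1 + 0) - 1 = i + i + 1 by omega] at hm
    obtain ⟨g, hg, q, hq⟩ := exists_of_mem_convIdeal_succ hm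
    rw [convIdeal_self] at hg
    refine h.one_notMem (hq ▸ add_mem (initIdeal_mono (by omega) (by omega) hg)
      (Ideal.mul_mem_right _ _ ?_))
    exact initIdeal_mono (by omega) (by omega) (convCoeff_mem_initIdeal_succ x y i i)
  | succ d ih =>
    intro hm
    obtain ⟨N, rfl⟩ : ∃ N', N' = i + 1 + (d + 1) := ⟨_, rfl⟩
    have hN : i + 1 + (d + 1) = i + 1 + 1 + d := by ring
    rw [hN] at hm h
    rw [prodElem, Finset.prod_eq_prod_Ico_succ_bot (by omega), mul_assoc] at hm
    change x i * (y (i + 1) * prodElem (i + 1 + 1 + d) x y (i + 1)) ∈ _ at hm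
    refine ih h (by omega) ?_
    have h1 := h.mem_convIdeal_of_mul_mem (by omega) (by omega) 0 (by omega)
      (fun t h1 h2 => h.strandRegular _ _ _ (by omega) (by omega) rfl _ (by push_cast; omega)
        (by push_cast; omega) _ (by omega) (by omega))
      (by rw [h.mul_y]; simp [h.map_prodElem]) hm
    rw [← convIdeal_swap] at h1 ⊢
    exact h.swap.mem_convIdeal_of_mul_mem (by omega) (by omega) 1 (by omega)
      (fun t h1 h2 => h.swap.strandRegular _ _ _ (by omega) (by omega) rfl _ (by push_cast; omega)
        (by push_cast; omega) _ (by omega) (by omega))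
      (by simp [h.map_prodElem]) h1

theorem mem_convIdeal_of_mem_pow_mul (h : SegreSystem N x y π) (hN : 0 < N) {f : B}
    (hf : f ∈ Ideal.span (Set.range x) ^ N * Ideal.span (Set.range y)) :
    f ∈ convIdeal x y 0 0 (2 * N - 1) := by
  obtain ⟨q, rfl⟩ : ∃ q, N = q + 1 := ⟨N - 1, by omega⟩
  have h1 := Ideal.mul_le_right (dedekindMertens q (q + 1) x y h.x_eq_zero h.y_eq_zero hf)
  refine Ideal.span_le.2 ?_ h1
  rintro _ ⟨t, rfl⟩
  rcases lt_or_ge t (2 * (q + 1) - 1) with ht | ht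
  · exact convCoeff_mem_convIdeal (by omega) ht
  · suffices convCoeff x y t = 0 by rw [this]; exact zero_mem _
    refine Finset.sum_eq_zero fun p hp => ?_
    rw [Finset.HasAntidiagonal.mem_antidiagonal] at hp
    rcases lt_or_ge p.1 (q + 1) with hp1 | hp1
    · rw [h.y_eq_zero _ (by omega), mul_zero]
    · rw [h.x_eq_zero _ hp1, zero_mul]

theorem prodElem_mul_mem (h : SegreSystem N x y π) (hN : 1 < N) {j : ℤ} (hj : j ≠ 0) {f : B}
    (hf : π j f = f) : prodElem N x y 0 * f ∈ convIdeal x y 0 0 (2 * N - 1) := by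
  have hp : ∀ (z : ℕ → B) (e : ℕ → ℕ), ∏ k ∈ Finset.Ico 0 (N - 1), z (e k) ∈
      Ideal.span (Set.range z) ^ (N - 1) := fun z e => by
    have := Ideal.prod_mem_prod (s := Finset.Ico 0 (N - 1)) (I := fun _ => Ideal.span (Set.range z))
      (x := fun k => z (e k)) fun k _ => Ideal.subset_span ⟨_, rfl⟩
    simpa using this
  have hi : ∀ (z w : ℕ → B) (a : ℕ), initIdeal z w a 0 ≤ Ideal.span (Set.range z) := fun z w a => by
    refine Ideal.span_mono ?_
    rintro _ (⟨i, -, rfl⟩ | ⟨i, hi, -⟩)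
    · exact ⟨i, rfl⟩
    · omega
  have hle : ∀ z : ℕ → B, Ideal.span (Set.range z) ^ (N - 1) ≤ Ideal.span (Set.range z) :=
    fun z => Ideal.pow_le_self (by omega)
  have hpow : ∀ I : Ideal B, I ^ N = I ^ (N - 1) * I := fun I => by
    rw [← pow_succ]; congr 1; omega
  rw [prodElem, Finset.prod_mul_distrib]
  rcases lt_or_gt_of_ne hj with hj | hj
  · rw [← convIdeal_swap]
    refine h.swap.mem_convIdeal_of_mem_pow_mul (by omega) ?_
    have h1 := h.mem_of_neg j hj f hf
    rw [← initIdeal_swap] at h1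
    have h2 := Ideal.mul_mem_mul (Ideal.mul_mem_mul (hp y (· + 1)) (hi _ _ _ h1)) (hle _ (hp x id))
    rw [← hpow] at h2
    convert h2 using 1
    simp only [id]
    ring
  · refine h.mem_convIdeal_of_mem_pow_mul (by omega) ?_
    have h2 := Ideal.mul_mem_mul (Ideal.mul_mem_mul (hp x id)
      (hi _ _ _ (h.mem_of_pos j hj f hf))) (hle _ (hp y (· + 1)))
    rw [← hpow] at h2
    convert h2 using 1
    simp only [id]
    ring

end SegreSystem

end SegreSystem

section Segre

open MvPolynomial

variable (K : Type) [Field K] (N : ℕ)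

/-- The polynomial ring in two groups of `N` variables. -/
abbrev SegreRing : Type := MvPolynomial (Fin N ⊕ Fin N) K

/-- The weights `1` for the first group of variables and `-1` for the second. -/
def segreWeight : Fin N ⊕ Fin N → ℤ := Sum.elim (fun _ => 1) fun _ => -1

/-- The projection onto a weighted homogeneous component. -/
noncomputable def segreProj (j : ℤ) : SegreRing K N →+ SegreRing K N :=
  (weightedHomogeneousComponent (segreWeight N) j).toAddMonoidHom

/-- The first group of variables. -/
noncomputable def segreX (i : ℕ) : SegreRing K N := if h : i < N then X (Sum.inl ⟨i, h⟩) else 0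

/-- The second group of variables. -/
noncomputable def segreY (i : ℕ) : SegreRing K N := if h : i < N then X (Sum.inr ⟨i, h⟩) else 0

variable {K N}

theorem coeff_segreProj (j : ℤ) (f : SegreRing K N) (d : Fin N ⊕ Fin N →₀ ℕ) :
    coeff d (segreProj K N j f) = if Finsupp.weight (segreWeight N) d = j then coeff d f else 0 :=
  coeff_weightedHomogeneousComponent _ _ _

theorem weight_segreWeight (d : Fin N ⊕ Fin N →₀ ℕ) :
    Finsupp.weight (segreWeight N) d =
      ∑ i, (d (Sum.inl i) : ℤ) - ∑ i, (d (Sum.inr i) : ℤ) := by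
  simp [Finsupp.weight_eq_sum, segreWeight, Fintype.sum_sum_type, sub_eq_add_neg]

theorem segreProj_X_mul (s : Fin N ⊕ Fin N) (j : ℤ) (f : SegreRing K N) :
    segreProj K N j (X s * f) = X s * segreProj K N (j - segreWeight N s) f := by
  ext d
  rw [coeff_segreProj, coeff_X_mul', coeff_X_mul', coeff_segreProj]
  by_cases hs : s ∈ d.support
  · have := Finsupp.weight_sub_single_add (w := segreWeight N) (Finsupp.mem_support_iff.1 hs)
    simp only [if_pos hs, ← this, eq_sub_iff_add_eq]
  · simp only [if_neg hs, ite_self]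

theorem weight_of_segreProj_eq {j : ℤ} {f : SegreRing K N} (hf : segreProj K N j f = f)
    {d : Fin N ⊕ Fin N →₀ ℕ} (hd : d ∈ f.support) : Finsupp.weight (segreWeight N) d = j := by
  by_contra h
  rw [mem_support_iff, ← hf, coeff_segreProj, if_neg h] at hd
  exact hd rfl

theorem segreX_of_lt {i : ℕ} (h : i < N) : segreX K N i = X (Sum.inl ⟨i, h⟩) := dif_pos h

theorem segreY_of_lt {i : ℕ} (h : i < N) : segreY K N i = X (Sum.inr ⟨i, h⟩) := dif_pos h

theorem initIdeal_segre {a b : ℕ} (ha : a ≤ N) (hb : b ≤ N) :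
    initIdeal (segreX K N) (segreY K N) a b = Ideal.span (X ''
      {s : Fin N ⊕ Fin N | Sum.elim (fun i : Fin N => i.val < a)
        (fun i : Fin N => i.val < b) s}) := by
  rw [initIdeal]
  congr 1
  ext f
  constructor
  · rintro (⟨i, hi, rfl⟩ | ⟨i, hi, rfl⟩)
    · exact ⟨_, hi, (segreX_of_lt (by omega)).symm⟩
    · exact ⟨_, hi, (segreY_of_lt (by omega)).symm⟩
  · rintro ⟨i | i, hi, rfl⟩
    · exact Or.inl ⟨i, hi, (segreX_of_lt i.2).symm⟩
    · exact Or.inr ⟨i, hi, (segreY_of_lt i.2).symm⟩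

theorem mem_span_X_image_of_X_mul_mem {σ : Type*} {S : Set σ} {s : σ} (hs : s ∉ S)
    {u : MvPolynomial σ K} (h : X s * u ∈ Ideal.span (X '' S : Set (MvPolynomial σ K))) :
    u ∈ Ideal.span (X '' S : Set (MvPolynomial σ K)) := by
  rw [mem_ideal_span_X_image] at *
  intro d hd
  obtain ⟨i, hi, h1⟩ := h (Finsupp.single s 1 + d) (by
    rw [mem_support_iff, coeff_X_mul]; exact mem_support_iff.1 hd)
  refine ⟨i, hi, ?_⟩
  have : s ≠ i := fun h => hs (h ▸ hi)
  rwa [Finsupp.add_apply, Finsupp.single_eq_of_ne' this, zero_add] at h1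

theorem segreSystem : SegreSystem N (segreX K N) (segreY K N) (segreProj K N) where
  mul_x i j f := by
    by_cases h : i < N
    · rw [segreX_of_lt h, segreProj_X_mul]; rfl
    · simp [segreX, h]
  mul_y i j f := by
    by_cases h : i < N
    · rw [segreY_of_lt h, segreProj_X_mul]
      simp [segreWeight]
    · simp [segreY, h]
  idem j f := by
    ext d
    simp only [coeff_segreProj]
    split_ifs <;> rfl
  one := by
    ext d
    rw [coeff_segreProj]
    by_cases h : 0 = d
    · subst h; simp
    · simp [coeff_one, h]
  cancel_x a ha b hb u hu := by
    rw [initIdeal_segre ha.le hb] at *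
    rw [segreX_of_lt ha] at hu
    exact mem_span_X_image_of_X_mul_mem (by simp) hu
  cancel_y a ha b hb u hu := by
    rw [initIdeal_segre ha hb.le] at *
    rw [segreY_of_lt hb] at hu
    exact mem_span_X_image_of_X_mul_mem (by simp) hu
  mem_of_pos j hj f hf := by
    rw [initIdeal_segre le_rfl N.zero_le, mem_ideal_span_X_image]
    intro d hd
    have h1 := weight_of_segreProj_eq hf hd
    by_contra! h2
    rw [weight_segreWeight, Finset.sum_eq_zero fun i _ => by
      rw [h2 (Sum.inl i) i.2, Nat.cast_zero]] at h1
    have : 0 ≤ ∑ i, (d (Sum.inr i) : ℤ) := Finset.sum_nonneg fun _ _ => by positivity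
    omega
  mem_of_neg j hj f hf := by
    rw [initIdeal_segre N.zero_le le_rfl, mem_ideal_span_X_image]
    intro d hd
    have h1 := weight_of_segreProj_eq hf hd
    by_contra! h2
    rw [weight_segreWeight, Finset.sum_eq_zero (f := fun i => (d (Sum.inr i) : ℤ))
      fun i _ => by rw [h2 (Sum.inr i) i.2, Nat.cast_zero]] at h1
    have : 0 ≤ ∑ i, (d (Sum.inl i) : ℤ) := Finset.sum_nonneg fun _ _ => by positivity
    omega
  one_notMem h := by
    rw [initIdeal_segre le_rfl le_rfl, mem_ideal_span_X_image] at h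
    obtain ⟨i, -, hi⟩ := h 0 (by simp)
    exact hi rfl
  x_eq_zero i hi := dif_neg (by omega)
  y_eq_zero i hi := dif_neg (by omega)

/-- The Segre parametrization of the matrices of rank at most one. -/
noncomputable def segreHom : DetRing K N N 2 →+* SegreRing K N :=
  DetRing.lift MvPolynomial.C (fun i j => X (Sum.inl i) * X (Sum.inr j)) fun α γ => by
    simp [Matrix.det_fin_two]; ring

theorem segreHom_C (a : K) : segreHom (N := N) (DetRing.C a) = MvPolynomial.C a := by
  simp [segreHom]

theorem segreHom_X (i j : Fin N) :
    segreHom (K := K) (DetRing.X i j) = X (Sum.inl i) * X (Sum.inr j) := by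
  simp [segreHom]

theorem segreHom_injective (hN : 1 < N) :
    Function.Injective (segreHom : DetRing K N N 2 →+* SegreRing K N) := by
  rw [injective_iff_map_eq_zero]
  intro a ha
  obtain ⟨f, rfl⟩ := Ideal.Quotient.mk_surjective a
  rw [Ideal.Quotient.eq_zero_iff_mem, minorsIdeal_eq_ker hN le_rfl (by omega), RingHom.mem_ker]
  let g : SegreRing K N →ₐ[K] MvPolynomial ((Fin N × ℕ) ⊕ (ℕ × Fin N)) K :=
    aeval (Sum.elim (fun i => X (Sum.inl (i, 0))) fun j => X (Sum.inr (0, j)))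
  have h1 : (rankParam K N N (fun j => min j 1) 0 0).toRingHom =
      g.toRingHom.comp (segreHom.comp (Ideal.Quotient.mk _)) := by
    refine MvPolynomial.ringHom_ext (fun a => ?_) fun p => ?_
    · have := segreHom_C (N := N) a
      rw [DetRing.C, RingHom.comp_apply] at this
      simp [this]
    · have := segreHom_X (K := K) p.1 p.2
      rw [DetRing.X] at this
      simp [this, rankParam, g]
  have h2 := RingHom.congr_fun h1 f
  rw [RingHom.comp_apply, RingHom.comp_apply, ha, map_zero] at h2
  exact h2

theorem segreProj_segreHom (r : DetRing K N N 2) : segreProj K N 0 (segreHom r) = segreHom r := by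
  obtain ⟨f, rfl⟩ := Ideal.Quotient.mk_surjective r
  induction f using MvPolynomial.induction_on with
  | C a =>
    change segreProj K N 0 (segreHom (DetRing.C a)) = segreHom (DetRing.C a)
    rw [segreHom_C]
    ext d
    rw [coeff_segreProj, coeff_C]
    by_cases h : 0 = d
    · subst h; simp
    · simp [h]
  | add f g hf hg => simp only [map_add, hf, hg]
  | mul_X f p hf =>
    have := segreHom_X (K := K) p.1 p.2
    rw [DetRing.X] at this
    rw [map_mul, map_mul, this, mul_comm, mul_assoc, segreProj_X_mul, segreProj_X_mul]
    simp [segreWeight, hf]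

theorem exists_segreHom_eq_monomial (n : ℕ) (d : Fin N ⊕ Fin N →₀ ℕ) (hn : d.degree = n)
    (hd : Finsupp.weight (segreWeight N) d = 0) (c : K) :
    ∃ r, segreHom r = monomial d c := by
  induction n using Nat.strong_induction_on generalizing d with
  | _ n ih =>
    by_cases h0 : d = 0
    · exact ⟨DetRing.C c, by rw [segreHom_C, h0]; rfl⟩
    obtain ⟨i, j, hi, hj⟩ : ∃ i j, d (Sum.inl i) ≠ 0 ∧ d (Sum.inr j) ≠ 0 := by
      rw [weight_segreWeight] at hd
      by_contra! h
      refine h0 ?_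
      by_cases h1 : ∃ i, d (Sum.inl i) ≠ 0
      · obtain ⟨i, hi⟩ := h1
        have h2 : ∑ i, (d (Sum.inr i) : ℤ) = 0 := Finset.sum_eq_zero fun j _ => by simp [h i j hi]
        rw [h2, sub_zero, Finset.sum_eq_zero_iff_of_nonneg fun _ _ => by positivity] at hd
        exact absurd (by simpa using hd i (Finset.mem_univ i)) hi
      · push Not at h1
        have h2 : ∑ i, (d (Sum.inl i) : ℤ) = 0 := Finset.sum_eq_zero fun j _ => by simp [h1]
        rw [h2, zero_sub, neg_eq_zero, Finset.sum_eq_zero_iff_of_nonneg fun _ _ => by positivity]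
          at hd
        ext (i | j)
        · exact h1 i
        · simpa using hd j (Finset.mem_univ j)
    obtain ⟨d', rfl⟩ : ∃ d', d =
        d' + (Finsupp.single (Sum.inl i) 1 + Finsupp.single (Sum.inr j) 1) := by
      refine ⟨d - (Finsupp.single (Sum.inl i) 1 + Finsupp.single (Sum.inr j) 1), ?_⟩
      rw [tsub_add_cancel_of_le]
      intro s
      rcases s with k | k
      · by_cases hk : i = k
        · subst hk; simp; omega
        · simp [hk]
      · by_cases hk : j = k
        · subst hk; simp; omega
        · simp [hk]
    obtain ⟨r, hr⟩ := ih d'.degree (by simp [← hn]) d' rfl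
      (by simpa [map_add, Finsupp.weight_single, segreWeight] using hd)
    refine ⟨r * DetRing.X i j, ?_⟩
    rw [map_mul, hr, segreHom_X, X, X, monomial_mul, monomial_mul]
    simp

theorem exists_segreHom_eq {f : SegreRing K N} (hf : segreProj K N 0 f = f) :
    ∃ r, segreHom r = f := by
  suffices f ∈ (segreHom : DetRing K N N 2 →+* SegreRing K N).range from this
  rw [f.as_sum]
  exact sum_mem fun d hd => exists_segreHom_eq_monomial _ d rfl (weight_of_segreProj_eq hf hd) _

end Segre

section Strand

open MvPolynomial RingTheory.Sequence

variable {K : Type} [Field K] {N : ℕ} {C : Type} [AddCommGroup C] [Module (DetRing K N N 2) C]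

/-- An embedding of a module over the Segre ring into the strand of weight `j`. -/
structure IsStrandMap (ν : C →+ SegreRing K N) (j : ℤ) : Prop where
  injective : Function.Injective ν
  map_smul : ∀ r z, ν (r • z) = segreHom r * ν z
  proj : ∀ z, segreProj K N j (ν z) = ν z

theorem segreProj_X_pow_mul (s : Fin N ⊕ Fin N) (n : ℕ) (j : ℤ) (f : SegreRing K N) :
    segreProj K N j (X s ^ n * f) = X s ^ n * segreProj K N (j - n * segreWeight N s) f := by
  induction n generalizing j with
  | zero => simp
  | succ n ih =>
    rw [pow_succ', mul_assoc, segreProj_X_mul, ih, mul_assoc]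
    congr 4
    push_cast
    ring

theorem IsStrandMap.exists_div {ν : C →+ SegreRing K N} {j : ℤ} (h : IsStrandMap ν j)
    (s : Fin N ⊕ Fin N) (hs : ∀ z, X s ∣ ν z) :
    ∃ ν' : C →+ SegreRing K N, IsStrandMap ν' (j - segreWeight N s) ∧ ∀ z, ν z = X s * ν' z := by
  choose g hg using hs
  have hX : (X s : SegreRing K N) ≠ 0 := X_ne_zero s
  refine ⟨AddMonoidHom.mk' g fun a b => mul_left_cancel₀ hX ?_, ⟨fun a b hab => h.injective ?_,
    fun r z => mul_left_cancel₀ hX ?_, fun z => mul_left_cancel₀ hX ?_⟩, hg⟩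
  · rw [mul_add, ← hg, ← hg, ← hg, map_add]
  · rw [hg, hg]
    exact congrArg _ hab
  · change X s * g _ = X s * (_ * g z)
    rw [← hg, h.map_smul, hg, mul_left_comm]
  · change X s * segreProj K N _ (g z) = X s * g z
    rw [← segreProj_X_mul, ← hg, h.proj]

theorem not_X_dvd_X_pow {s t : Fin N ⊕ Fin N} (h : s ≠ t) (n : ℕ) :
    ¬ (X s : SegreRing K N) ∣ X t ^ n := fun hd =>
  h (X_dvd_X.1 ((X_prime (i := s)).dvd_of_dvd_pow hd))

theorem IsStrandMap.exists_reduced (i : Fin N) (n : ℕ) : ∀ (p q : ℕ) (ν : C →+ SegreRing K N),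
    p + q = n → IsStrandMap ν ((p : ℤ) - q) →
    (∃ z, ν z = X (Sum.inl i) ^ p * X (Sum.inr i) ^ q) →
    ∃ (p q : ℕ) (ν : C →+ SegreRing K N), IsStrandMap ν ((p : ℤ) - q) ∧
    (∃ z, ν z = X (Sum.inl i) ^ p * X (Sum.inr i) ^ q) ∧ (∃ z, ¬ X (Sum.inl i) ∣ ν z) ∧
    ∃ z, ¬ X (Sum.inr i) ∣ ν z := by
  induction n with
  | zero =>
    rintro p q ν hpq hν ⟨z, hz⟩
    obtain ⟨rfl, rfl⟩ : p = 0 ∧ q = 0 := by omega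
    refine ⟨0, 0, ν, hν, ⟨z, hz⟩, ⟨z, ?_⟩, ⟨z, ?_⟩⟩
    · rw [hz, pow_zero, pow_zero, mul_one]
      exact (X_prime).not_dvd_one
    · rw [hz, pow_zero, pow_zero, mul_one]
      exact (X_prime).not_dvd_one
  | succ n ih =>
    rintro p q ν hpq hν ⟨z, hz⟩
    by_cases h1 : ∀ z, X (Sum.inl i) ∣ ν z
    · obtain ⟨ν', hν', hg⟩ := hν.exists_div _ h1
      rcases p with _ | p
      · have h2 := h1 z
        rw [hz, pow_zero, one_mul] at h2
        exact absurd h2 (not_X_dvd_X_pow (by simp) _)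
      refine ih p q ν' (by omega) ?_ ⟨z, ?_⟩
      · convert hν' using 1
        simp [segreWeight]
        ring
      · refine mul_left_cancel₀ (X_ne_zero (Sum.inl i)) ?_
        rw [← hg, hz]
        ring
    by_cases h2 : ∀ z, X (Sum.inr i) ∣ ν z
    · obtain ⟨ν', hν', hg⟩ := hν.exists_div _ h2
      rcases q with _ | q
      · have h2 := h2 z
        rw [hz, pow_zero, mul_one] at h2
        exact absurd h2 (not_X_dvd_X_pow (by simp) _)
      refine ih p q ν' (by omega) ?_ ⟨z, ?_⟩
      · convert hν' using 1
        simp [segreWeight]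
        ring
      · refine mul_left_cancel₀ (X_ne_zero (Sum.inr i)) ?_
        rw [← hg, hz]
        ring
    push Not at h1 h2
    exact ⟨p, q, ν, hν, ⟨z, hz⟩, h1, h2⟩

theorem not_dvd_mul_X_pow {s t : Fin N ⊕ Fin N} (h : s ≠ t) (n : ℕ) {f : SegreRing K N}
    (hf : ¬ X s ∣ f) : ¬ X s ∣ X t ^ n * f := fun hd =>
  ((X_prime (i := s)).dvd_or_dvd hd).elim (not_X_dvd_X_pow h n) hf

theorem exists_complement (i k : Fin N) (hik : i ≠ k) (j : ℤ) : ∃ (t : Fin N ⊕ Fin N) (n : ℕ),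
    n * segreWeight N t = -j ∧ Sum.inl i ≠ t ∧ Sum.inr i ≠ t := by
  rcases le_total 0 j with h | h
  · exact ⟨Sum.inr k, j.toNat, by simp [segreWeight, h], by simp, by simpa using hik⟩
  · exact ⟨Sum.inl k, (-j).toNat, by simp [segreWeight, h], by simpa using hik, by simp⟩

theorem IsStrandMap.exists_smul_eq {ν : C →+ SegreRing K N} {j : ℤ} (hν : IsStrandMap ν j)
    {i k : Fin N} (hik : i ≠ k) (h1 : ∃ z, ¬ X (Sum.inl i) ∣ ν z)
    (h2 : ∃ z, ¬ X (Sum.inr i) ∣ ν z) : ∃ r : DetRing K N N 2,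
      ¬ X (Sum.inl i) ∣ segreHom r ∧ ¬ X (Sum.inr i) ∣ segreHom r ∧
      ∀ f, segreProj K N j f = f → ∃ z, ν z = segreHom r * f := by
  obtain ⟨z, hz1, hz2⟩ : ∃ z, ¬ X (Sum.inl i) ∣ ν z ∧ ¬ X (Sum.inr i) ∣ ν z := by
    obtain ⟨z1, hz1⟩ := h1
    obtain ⟨z2, hz2⟩ := h2
    by_cases h3 : X (Sum.inr i) ∣ ν z1
    · by_cases h4 : X (Sum.inl i) ∣ ν z2
      · exact ⟨z1 + z2, by rwa [map_add, dvd_add_left h4], by rwa [map_add, dvd_add_right h3]⟩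
      · exact ⟨z2, h4, hz2⟩
    · exact ⟨z1, hz1, h3⟩
  obtain ⟨t, n, hn, ht1, ht2⟩ := exists_complement i k hik j
  have hw : ∀ f, segreProj K N j f = f → segreProj K N 0 (X t ^ n * f) = X t ^ n * f :=
    fun f hf => by rw [segreProj_X_pow_mul, hn, zero_sub, neg_neg, hf]
  obtain ⟨r, hr⟩ := exists_segreHom_eq (hw _ (hν.proj z))
  refine ⟨r, hr ▸ not_dvd_mul_X_pow ht1 n hz1, hr ▸ not_dvd_mul_X_pow ht2 n hz2, fun f hf => ?_⟩
  obtain ⟨s, hs⟩ := exists_segreHom_eq (hw f hf)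
  exact ⟨s • z, by rw [hν.map_smul, hs, hr]; ring⟩

theorem mul_pow_dvd_of_dvd_mul {i : Fin N} {e : ℕ} {r f : SegreRing K N}
    (h1 : ¬ X (Sum.inl i) ∣ r) (h2 : ¬ X (Sum.inr i) ∣ r)
    (h : (X (Sum.inl i) * X (Sum.inr i)) ^ e ∣ r * f) :
    (X (Sum.inl i) * X (Sum.inr i)) ^ e ∣ f := by
  rw [mul_pow] at *
  obtain ⟨g, rfl⟩ := (X_prime (i := Sum.inl i)).pow_dvd_of_dvd_mul_left e h1
    ((dvd_mul_right _ _).trans h)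
  refine mul_dvd_mul_left _ ?_
  refine (X_prime (i := Sum.inr i)).pow_dvd_of_dvd_mul_left e
    (not_X_dvd_X_pow (t := Sum.inl i) (by simp) e)
    ((X_prime (i := Sum.inr i)).pow_dvd_of_dvd_mul_left e h2 ((dvd_mul_left _ _).trans h))

theorem isWeaklyRegular_X_pow (hN : 1 < N) {i : Fin N} (e : ℕ) {r : DetRing K N N 2}
    (h1 : ¬ X (Sum.inl i) ∣ segreHom r) (h2 : ¬ X (Sum.inr i) ∣ segreHom r) :
    IsWeaklyRegular (DetRing K N N 2) [DetRing.X i i ^ e, r] := by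
  have : IsDomain (DetRing K N N 2) := DetRing.isDomain hN (by omega)
  have hne : (X (Sum.inl i) * X (Sum.inr i) : SegreRing K N) ^ e ≠ 0 :=
    pow_ne_zero e (mul_ne_zero (X_ne_zero _) (X_ne_zero _))
  have hX : segreHom (K := K) (DetRing.X i i ^ e) = (X (Sum.inl i) * X (Sum.inr i)) ^ e := by
    rw [map_pow, segreHom_X]
  rw [isWeaklyRegular_cons_iff, isWeaklyRegular_singleton_iff, isSMulRegular_quotSMulTop_iff]
  constructor
  · refine IsSMulRegular.of_right_eq_zero_of_smul fun z hz => ?_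
    refine (mul_eq_zero.1 hz).resolve_left fun h0 => hne ?_
    rw [← hX, h0, map_zero]
  · rintro s ⟨s', hs⟩
    have h3 : segreHom r * segreHom s =
        (X (Sum.inl i) * X (Sum.inr i)) ^ e * segreHom s' := by
      rw [← hX, ← map_mul, ← map_mul]
      exact congrArg _ hs
    obtain ⟨g, hg⟩ := mul_pow_dvd_of_dvd_mul h1 h2 (Dvd.intro _ h3.symm)
    have hg0 : segreProj K N 0 g = g := by
      have h4 := segreProj_segreHom s
      rw [hg, mul_pow, mul_assoc, segreProj_X_pow_mul, segreProj_X_pow_mul, ← mul_assoc,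
        ← mul_assoc, ← mul_pow] at h4
      have h5 := mul_left_cancel₀ hne h4
      convert h5 using 3
      simp [segreWeight]
    obtain ⟨s'', hs''⟩ := exists_segreHom_eq hg0
    refine ⟨s'', segreHom_injective hN ?_⟩
    rw [hg, smul_eq_mul, map_mul, hX, hs'']

theorem IsStrandMap.surjective (hN : 1 < N) (hC : DualExact (DetRing K N N 2) C)
    {ν : C →+ SegreRing K N} {p q : ℕ} (hν : IsStrandMap ν ((p : ℤ) - q)) {i : Fin N}
    (h0 : ∃ z, ν z = X (Sum.inl i) ^ p * X (Sum.inr i) ^ q) (h1 : ∃ z, ¬ X (Sum.inl i) ∣ ν z)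
    (h2 : ∃ z, ¬ X (Sum.inr i) ∣ ν z) {f : SegreRing K N}
    (hf : segreProj K N ((p : ℤ) - q) f = f) : ∃ z, ν z = f := by
  have : Nontrivial (Fin N) := Fin.nontrivial_iff_two_le.2 hN
  obtain ⟨k, hk⟩ := exists_ne i
  obtain ⟨r, hr1, hr2, hr⟩ := hν.exists_smul_eq hk.symm h1 h2
  obtain ⟨z0, hz0⟩ := h0
  obtain ⟨s, hs⟩ := exists_segreHom_eq (f := X (Sum.inl i) ^ q * (X (Sum.inr i) ^ p * f)) (by
    rw [segreProj_X_pow_mul, segreProj_X_pow_mul]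
    congr 2
    conv_rhs => rw [← hf]
    congr 2
    simp [segreWeight]
    ring)
  have hX : segreHom (K := K) (DetRing.X i i ^ (p + q)) =
      (X (Sum.inl i) * X (Sum.inr i)) ^ (p + q) := by
    rw [map_pow, segreHom_X]
  have hs' : ν (s • z0) = segreHom (DetRing.X i i ^ (p + q)) * f := by
    rw [hν.map_smul, hs, hz0, hX]
    ring
  obtain ⟨z, hz⟩ := hr f hf
  have h3 := (hC.isWeaklyRegular (isWeaklyRegular_X_pow hN (p + q) hr1 hr2)).1
  rw [isWeaklyRegular_cons_iff, isWeaklyRegular_singleton_iff, isSMulRegular_quotSMulTop_iff] at h3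
  obtain ⟨y, hy⟩ := h3.2 (s • z0) ⟨z, hν.injective (by
    rw [hν.map_smul, hs', hν.map_smul, hz]; ring)⟩
  refine ⟨y, ?_⟩
  rw [hy, hν.map_smul] at hs'
  refine mul_left_cancel₀ ?_ hs'
  rw [hX]
  exact pow_ne_zero _ (mul_ne_zero (X_ne_zero _) (X_ne_zero _))

theorem DualExact.exists_isStrandMap (hN : 1 < N) (hC : DualExact (DetRing K N N 2) C) :
    ∃ (ν : C →+ SegreRing K N) (j : ℤ), IsStrandMap ν j ∧
      ∀ f, segreProj K N j f = f → ∃ z, ν z = f := by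
  obtain ⟨m, rfl⟩ : ∃ m, N = m + 1 := ⟨N - 1, by omega⟩
  have hdom : IsDomain (DetRing K (m + 1) (m + 1) 2) := DetRing.isDomain hN (by omega)
  have := DetRing.SchurBase.isDomain (K := K) (m := m) (n := m)
  have := DetRing.SchurBase.isNoetherianRing (K := K) (m := m) (n := m)
  have := DetRing.SchurBase.uniqueFactorizationMonoid (K := K) (m := m) (n := m)
  have hX : (DetRing.X 0 0 : DetRing K (m + 1) (m + 1) 2) ≠ 0 := fun h => by
    have h1 := congrArg segreHom h
    rw [segreHom_X, map_zero] at h1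
    exact mul_ne_zero (X_ne_zero _) (X_ne_zero _) h1
  obtain ⟨_, ⟨d, rfl⟩, c, hc⟩ := (DetRing.dualExactCyclic_localization hN hX
    (DetRing.dualExactCyclic_of_fractionRing (by omega) (by omega)
      (DetRing.dualExactCyclic_one _ m m))).exists_smul_of_isLocalization
        (Submonoid.powers (DetRing.X 0 0)) _ hC
  have hXd : (DetRing.X 0 0 : DetRing K (m + 1) (m + 1) 2) ^ d ≠ 0 := pow_ne_zero d hX
  have hc0 : c ≠ 0 := by
    rintro rfl
    refine hXd (hC.eq_zero_of_forall_smul fun z => ?_)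
    obtain ⟨s, hs⟩ := hc z
    exact hs.trans (smul_zero s)
  have hinj : ∀ a b : DetRing K (m + 1) (m + 1) 2, a • c = b • c → a = b := fun a b hab => by
    by_contra hne
    refine hc0 (hC.isSMulRegular (sub_ne_zero.2 hne) ?_)
    simp [sub_smul, hab]
  choose σ hσ using hc
  let ν : C →+ SegreRing K (m + 1) := AddMonoidHom.mk' (fun z => segreHom (σ z)) fun a b => by
    rw [← map_add]
    congr 1
    refine hinj _ _ ?_
    rw [add_smul, ← hσ, ← hσ, ← hσ, smul_add]
  have hν : IsStrandMap ν (((d : ℕ) : ℤ) - (d : ℕ)) := by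
    refine ⟨fun a b hab => hC.isSMulRegular hXd ?_, fun r z => ?_, fun z => ?_⟩
    · have h1 : σ a = σ b := segreHom_injective hN hab
      change DetRing.X 0 0 ^ d • a = DetRing.X 0 0 ^ d • b
      exact (hσ a).trans (h1 ▸ (hσ b).symm)
    · change segreHom (σ (r • z)) = segreHom r * segreHom (σ z)
      rw [← map_mul]
      congr 1
      refine hinj _ _ ?_
      rw [mul_smul, ← hσ, ← hσ, smul_comm]
    · rw [sub_self]
      exact segreProj_segreHom _
  have hz : ∃ z, ν z = X (Sum.inl 0) ^ d * X (Sum.inr 0) ^ d := by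
    refine ⟨c, ?_⟩
    change segreHom (σ c) = _
    rw [← hinj _ _ (hσ c)]
    simp only [map_pow, segreHom_X, mul_pow]
  obtain ⟨p, q, ν, hν, h0, h1, h2⟩ := IsStrandMap.exists_reduced 0 _ d d ν rfl hν hz
  exact ⟨ν, _, hν, fun f hf => hν.surjective hN hC h0 h1 h2 hf⟩

end Strand

section SegreCyclic

open MvPolynomial RingTheory.Sequence

variable {K : Type} [Field K] {N : ℕ} {C : Type} [AddCommGroup C] [Module (DetRing K N N 2) C]

theorem exists_segreHom_eq_convCoeff (K : Type) [Field K] (N : ℕ) : ∃ θ : ℕ → DetRing K N N 2,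
    ∀ t, segreHom (θ t) = convCoeff (segreX K N) (segreY K N) t := by
  choose θ hθ using fun t => exists_segreHom_eq (f := convCoeff (segreX K N) (segreY K N) t) (by
    have h := segreSystem (K := K) (N := N)
    rw [← mul_one (convCoeff _ _ _), h.mul_convCoeff, h.one])
  exact ⟨θ, hθ⟩

theorem IsStrandMap.mem_iff {ν : C →+ SegreRing K N} {j : ℤ} (hν : IsStrandMap ν j)
    (hs : ∀ f, segreProj K N j f = f → ∃ z, ν z = f) {θ : ℕ → DetRing K N N 2}
    (hθ : ∀ t, segreHom (θ t) = convCoeff (segreX K N) (segreY K N) t) (s : ℕ) (z : C) :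
    z ∈ Ideal.ofList ((List.range s).map θ) • (⊤ : Submodule (DetRing K N N 2) C) ↔
      ν z ∈ convIdeal (segreX K N) (segreY K N) 0 0 s := by
  have hmem : ∀ r ∈ (List.range s).map θ, ∃ t < s, r = θ t := by
    simp only [List.mem_map, List.mem_range]
    rintro _ ⟨t, ht, rfl⟩
    exact ⟨t, ht, rfl⟩
  constructor
  · intro hz
    induction hz using Submodule.smul_induction_on' with
    | smul r hr z _ =>
      rw [hν.map_smul]
      refine Ideal.mul_mem_right _ _ ?_
      suffices Ideal.ofList ((List.range s).map θ) ≤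
        (convIdeal (segreX K N) (segreY K N) 0 0 s).comap segreHom from this hr
      refine Ideal.span_le.2 fun r hr => ?_
      obtain ⟨t, ht, rfl⟩ := hmem r hr
      rw [SetLike.mem_coe, Ideal.mem_comap, hθ]
      exact convCoeff_mem_convIdeal (by omega) ht
    | add a ha b hb iha ihb =>
      rw [map_add]
      exact add_mem iha ihb
  · intro hz
    have h1 := segreSystem.mem_of_mem_convIdeal ((Ideal.ofList ((List.range s).map θ) •
      (⊤ : Submodule (DetRing K N N 2) C)).toAddSubgroup.map ν) (fun t ht f hf => ?_)
      (hν.proj z) hz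
    · obtain ⟨z', hz', h2⟩ := h1
      exact hν.injective h2 ▸ hz'
    · obtain ⟨y, rfl⟩ := hs f hf
      refine ⟨θ t • y, Submodule.smul_mem_smul (Ideal.subset_span ?_) trivial, ?_⟩
      · exact List.mem_map.2 ⟨t, List.mem_range.2 ht, rfl⟩
      · rw [hν.map_smul, hθ]

theorem isStrandMap_segreHom (hN : 1 < N) :
    IsStrandMap (segreHom : DetRing K N N 2 →+* SegreRing K N).toAddMonoidHom 0 :=
  ⟨segreHom_injective hN, fun r z => map_mul segreHom r z, segreProj_segreHom⟩

theorem isWeaklyRegular_convCoeff (hN : 1 < N) {θ : ℕ → DetRing K N N 2}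
    (hθ : ∀ t, segreHom (θ t) = convCoeff (segreX K N) (segreY K N) t) :
    IsWeaklyRegular (DetRing K N N 2) ((List.range (2 * N - 1)).map θ) := by
  have key := fun s r => (isStrandMap_segreHom (K := K) hN).mem_iff
    (fun f hf => exists_segreHom_eq hf) hθ s r
  rw [isWeaklyRegular_iff]
  intro i hi
  rw [List.length_map, List.length_range] at hi
  rw [List.getElem_map, List.getElem_range, ← List.map_take, List.take_range, min_eq_left hi.le,
    isSMulRegular_iff_right_eq_zero_of_smul]
  intro z hz
  obtain ⟨r, rfl⟩ := Submodule.Quotient.mk_surjective _ z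
  rw [← Submodule.Quotient.mk_smul, Submodule.Quotient.mk_eq_zero, key] at hz
  rw [Submodule.Quotient.mk_eq_zero, key]
  refine segreSystem.strandRegular _ 0 0 N.zero_le N.zero_le rfl 0 (by push_cast; omega)
    (by push_cast; omega) i (by omega) (by omega) _ (segreProj_segreHom r) ?_
  rw [← hθ]
  exact map_mul segreHom (θ i) r ▸ hz

theorem DetRing.dualExactCyclic_two (K : Type) [Field K] (N : ℕ) (hN : 1 < N) :
    DualExactCyclic (DetRing K N N 2) := by
  intro C _ _ hC
  obtain ⟨ν, j, hν, hs⟩ := hC.exists_isStrandMap hN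
  by_cases hj : j = 0
  · subst hj
    obtain ⟨c, hc⟩ := hs 1 segreSystem.one
    refine ⟨c, fun z => ?_⟩
    obtain ⟨r, hr⟩ := exists_segreHom_eq (hν.proj z)
    exact ⟨r, hν.injective (by rw [hν.map_smul, hc, hr, mul_one])⟩
  · obtain ⟨θ, hθ⟩ := exists_segreHom_eq_convCoeff K N
    obtain ⟨g, hg⟩ := exists_segreHom_eq (segreSystem (K := K) (N := N).map_prodElem 0)
    have h1 := (hC.isWeaklyRegular (isWeaklyRegular_convCoeff hN hθ)).2 g fun z => by
      rw [hν.mem_iff hs hθ, hν.map_smul, hg]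
      exact segreSystem.prodElem_mul_mem hN hj (hν.proj z)
    have h2 := ((isStrandMap_segreHom (K := K) hN).mem_iff
      (fun f hf => exists_segreHom_eq hf) hθ _ g).1 (by
        rw [smul_eq_mul, Ideal.mul_top]
        exact h1)
    refine absurd (?_ : SegreSystem.prodElem N (segreX K N) (segreY K N) 0 ∈ _)
      (segreSystem.prodElem_notMem (i := 0) (by omega))
    exact hg ▸ h2

end SegreCyclic

theorem IsSemidualizing.self (R : Type) [CommRing R] : IsSemidualizing R R := by
  refine ⟨inferInstance, ⟨fun a b hab => ?_, fun f => ⟨f 1, ?_⟩⟩, fun i hi => ?_⟩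
  · simpa using LinearMap.congr_fun hab 1
  · ext
    simp
  · obtain ⟨j, rfl⟩ := Nat.exists_eq_succ_of_ne_zero hi.ne'
    have : Projective (ModuleCat.of R R) :=
      ModuleCat.projective_of_free (Module.Basis.singleton Unit R)
    exact ModuleCat.subsingleton_of_isZero
      (isZero_Ext_succ_of_projective (ModuleCat.of R R) (ModuleCat.of R R) j)

/-- for a field `k` and nonnegative integers `r < min{m,n}` with `r = 0` or
`m = n`, every semidualizing module over the determinantal ring `R = R_{r+1}(k;m,n)` is
isomorphic to `R`; in particular there is exactly one isomorphism class. -/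
theorem statement17
    (k : Type) [Field k] (m n r : ℕ)
    (hm : r < m) (hn : r < n) (h : r = 0 ∨ m = n) :
    IsSemidualizing (DetRing k m n (r + 1)) (DetRing k m n (r + 1)) ∧
    ∀ (C : Type) [AddCommGroup C] [Module (DetRing k m n (r + 1)) C],
      IsSemidualizing (DetRing k m n (r + 1)) C →
      Nonempty (C ≃ₗ[DetRing k m n (r + 1)] DetRing k m n (r + 1)) := by
  refine ⟨IsSemidualizing.self _, fun C _ _ hC => ?_⟩
  have hcyc : DualExactCyclic (DetRing k m n (r + 1)) := by
    rcases h with rfl | rfl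
    · exact DetRing.dualExactCyclic_one k m n
    · exact DetRing.dualExactCyclic_of_rankOne
        (fun K _ n hn => DetRing.dualExactCyclic_two K n hn) r k m hn
  obtain ⟨c, hc⟩ := hcyc C hC.dualExact
  exact hC.dualExact.nonempty_linearEquiv hc
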